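/- arXiv:1206.4584 — 6 statements merged into one kernel-verified Lean document; each statement's English description precedes it below -/
import Mathlib

section
/- Let β ∈ {1,2,4}, let n ≥ 1 be an integer (with n ≥ 3 if β = 1 and n ≥ 2 if β = 4), and set b := 3βn/2 + 2 − β. Define the polynomials p_1(z) = 2z − (b − βn − 2 + β)(b − βn) and p_2(z) = 4z² + βz − (b − βn − 6 + 3β)(b − βn − 2 + β)z. Then each ξ_m^{(β)} is infinitely differentiable on (−∞,0) and ξ_n^{(β)} satisfies, for all z < 0: η^{(β)} z³ ξ_n'''' + 2β z² ξ_n''' + β z (ξ_n')² + 4β z² ξ_n'' ξ_n' + 6 η^{(β)} z³ (ξ_n'')² + p_2(z) ξ_n'' + p_1(z) ξ_n' + n(b − βn) = (12 d_n^{(β)}/β) · z³ · exp(ξ_{n−i(β)}(z) + ξ_{n+i(β)}(z) − 2ξ_n(z)). -/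
open MeasureTheory Filter Finset

/-- The β-deformed Vandermonde interaction factor `∏_{j<k} |λ_k - λ_j|^β`. -/
noncomputable def vand (β : ℝ) {n : ℕ} (T : Fin n → ℝ) : ℝ :=
  ∏ j, ∏ k ∈ Finset.Ioi j, |T k - T j| ^ β

/-- The deformed Laguerre weight `∏_j λ_j^{-b} e^{-1/λ_j + zλ_j} ∏_{j<k}|λ_k-λ_j|^β`
appearing in the Wigner delay time partition function. -/
noncomputable def wigW (β b : ℝ) (m : ℕ) (z : ℝ) (lam : Fin m → ℝ) : ℝ :=
  (∏ j, lam j ^ (-b) * Real.exp (-(lam j)⁻¹ + z * lam j)) * vand β lam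

/-- The normalization constant `m_m^{(β)}`. -/
noncomputable def mNorm (β b : ℝ) (m : ℕ) : ℝ :=
  ∫ lam in Set.univ.pi (fun _ : Fin m => Set.Ioi (0 : ℝ)), wigW β b m 0 lam

/-- The moment generating function `M_m^{(β)}(z)` of the Wigner delay time ensemble. -/
noncomputable def Mwig (β b : ℝ) (m : ℕ) (z : ℝ) : ℝ :=
  (∫ lam in Set.univ.pi (fun _ : Fin m => Set.Ioi (0 : ℝ)), wigW β b m z lam) / mNorm β b m

/-- The cumulant generating function `ξ_m^{(β)}(z) = log M_m^{(β)}(z)`. -/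
noncomputable def xiWig (β b : ℝ) (m : ℕ) (z : ℝ) : ℝ :=
  Real.log (Mwig β b m z)

open Classical in
/-- The constant `d_n^{(β)}` built from ratios of the normalization constants. -/
noncomputable def dcoef (β b : ℝ) (n : ℕ) : ℝ :=
  if β = 1 then
    ((n : ℝ) * (n - 1) / ((n + 1) * (n + 2))) *
      (mNorm 1 b (n - 2) * mNorm 1 b (n + 2)) / (mNorm 1 b n) ^ 2
  else if β = 4 then
    ((n : ℝ) / (n + 1)) * (mNorm 4 b (n - 1) * mNorm 4 b (n + 1)) / (mNorm 4 b n) ^ 2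
  else 0

open Classical in
/-- The parameter `η^{(β)}`: 4 if β = 4, otherwise 1. -/
noncomputable def eta (β : ℝ) : ℝ := if β = 4 then 4 else 1

open Classical in
/-- The shift `i(β)`: 1 if β = 4, otherwise 2. -/
noncomputable def ibeta (β : ℝ) : ℕ := if β = 4 then 1 else 2

namespace WignerDelay

open Polynomial in
/-- The monic polynomial with roots `Y j`. -/
noncomputable def nod {m : ℕ} (Y : Fin m → ℝ) : ℝ[X] := ∏ j, (X - C (Y j))

/-- The product of the geometric series `1 / (1 - Y j * X)`. -/
noncomputable def geo {m : ℕ} (Y : Fin m → ℝ) : PowerSeries ℝ :=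
  ∏ j, PowerSeries.mk fun k => Y j ^ k

section PartialFractions

open Polynomial

variable {m : ℕ}

lemma nod_succAbove (Y : Fin (m + 1) → ℝ) (i : Fin (m + 1)) :
    nod Y = (X - C (Y i)) * nod (i.removeNth Y) := by
  simp [nod, Fin.prod_univ_succAbove _ i, Fin.removeNth]

lemma geo_succAbove (Y : Fin (m + 1) → ℝ) (i : Fin (m + 1)) :
    geo Y = (PowerSeries.mk fun k => Y i ^ k) * geo (i.removeNth Y) := by
  simp [geo, Fin.prod_univ_succAbove _ i, Fin.removeNth]

lemma nod_monic (Y : Fin m → ℝ) : (nod Y).Monic :=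
  monic_prod_of_monic _ _ fun j _ => monic_X_sub_C (Y j)

lemma natDegree_nod (Y : Fin m → ℝ) : (nod Y).natDegree = m := by
  simp [nod]

lemma eval_nod (Y : Fin m → ℝ) (t : ℝ) : (nod Y).eval t = ∏ j, (t - Y j) := by
  simp [nod, eval_prod]

lemma eval_nod_self (Y : Fin m → ℝ) (i : Fin m) : (nod Y).eval (Y i) = 0 := by
  rw [eval_nod]
  exact prod_eq_zero (mem_univ i) (sub_self _)

lemma eval_nod_removeNth_ne_zero {Y : Fin (m + 1) → ℝ} (hY : Function.Injective Y)
    (i : Fin (m + 1)) : (nod (i.removeNth Y)).eval (Y i) ≠ 0 := by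
  rw [eval_nod, prod_ne_zero_iff]
  intro j _
  exact sub_ne_zero.2 fun h => (Fin.succAbove_ne i j) (hY h).symm

lemma eval_nod_removeNth_of_ne (Y : Fin (m + 1) → ℝ) {i j : Fin (m + 1)} (h : j ≠ i) :
    (nod (i.removeNth Y)).eval (Y j) = 0 := by
  obtain ⟨k, rfl⟩ := Fin.exists_succAbove_eq h
  exact eval_nod_self (i.removeNth Y) k

lemma one_sub_mul_mk_pow (a : ℝ) :
    (1 - PowerSeries.C a * PowerSeries.X) * (PowerSeries.mk fun k => a ^ k) = 1 := by
  ext k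
  rw [sub_mul, one_mul, mul_assoc, map_sub, PowerSeries.coeff_C_mul, mul_comm PowerSeries.X]
  cases k with
  | zero => simp
  | succ k => simp [PowerSeries.coeff_succ_mul_X, PowerSeries.coeff_one, pow_succ']

lemma reflect_X_sub_C (a : ℝ) : reflect 1 (X - C a) = 1 - C a * X := by
  rw [sub_eq_add_neg, ← C_neg, reflect_add, reflect_C, reflect_one_X]
  simp [sub_eq_add_neg]

lemma reflect_nod (Y : Fin m → ℝ) : reflect m (nod Y) = ∏ j, (1 - C (Y j) * X) := by
  induction m with
  | zero => simp [nod]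
  | succ m ih =>
    have h := nod_succAbove Y 0
    rw [h, mul_comm, reflect_mul _ _ (natDegree_nod _).le (natDegree_X_sub_C _).le,
      reflect_X_sub_C, ih, Fin.prod_univ_succ, mul_comm]
    simp [Fin.removeNth]

lemma reflect_add_nat {f : ℝ[X]} {m : ℕ} (hf : f.natDegree ≤ m) (r : ℕ) :
    reflect (m + r) f = reflect m f * X ^ r := by
  have := reflect_mul f 1 hf (natDegree_one.trans_le (Nat.zero_le r))
  rwa [mul_one, reflect_one] at this

lemma reflect_sum {ι : Type*} (s : Finset ι) (f : ι → ℝ[X]) (d : ℕ) :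
    reflect d (∑ i ∈ s, f i) = ∑ i ∈ s, reflect d (f i) := by
  classical
  induction s using Finset.induction_on with
  | empty => simp
  | insert a s ha ih => rw [sum_insert ha, sum_insert ha, reflect_add, ih]

lemma reflect_nod_mul_geo (Y : Fin m → ℝ) :
    ((reflect m (nod Y) : ℝ[X]) : PowerSeries ℝ) * geo Y = 1 := by
  rw [reflect_nod, geo, ← coeToPowerSeries.ringHom_apply, map_prod, ← prod_mul_distrib]
  refine prod_eq_one fun j _ => ?_
  rw [coeToPowerSeries.ringHom_apply]
  simpa using one_sub_mul_mk_pow (Y j)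

/-- Partial fractions with simple poles: the coefficients of `N / nod Y` at infinity. -/
lemma sum_simple_residues {Y : Fin (m + 1) → ℝ} (hY : Function.Injective Y) {N : ℝ[X]}
    (hN : N.natDegree ≤ m + 1) (k : ℕ) :
    ∑ i, Y i ^ k * (N.eval (Y i) / (nod (i.removeNth Y)).eval (Y i)) =
      PowerSeries.coeff (k + 1)
        (((reflect (m + 1) N : ℝ[X]) : PowerSeries ℝ) * geo Y) := by
  set c : Fin (m + 1) → ℝ := fun i => N.eval (Y i) / (nod (i.removeNth Y)).eval (Y i) with hc
  have key : N = C (N.coeff (m + 1)) * nod Y + ∑ i, C (c i) * nod (i.removeNth Y) := by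
    have hdeg : ∀ i, (C (c i) * nod (i.removeNth Y)).natDegree ≤ m := fun i =>
      natDegree_C_mul_le _ _ |>.trans (natDegree_nod _).le
    have hsum : (∑ i, C (c i) * nod (i.removeNth Y)).natDegree ≤ m :=
      natDegree_sum_le_of_forall_le _ _ fun i _ => hdeg i
    refine eq_of_degree_sub_lt_of_eval_finset_eq (univ.image Y) ?_ ?_
    · rw [card_image_of_injective _ hY, card_fin, degree_lt_iff_coeff_zero]
      intro d hd
      have h2 : (∑ i, C (c i) * nod (i.removeNth Y)).coeff d = 0 :=
        coeff_eq_zero_of_natDegree_lt (by omega)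
      rcases eq_or_lt_of_le hd with rfl | hlt
      · have h1 : (nod Y).coeff (m + 1) = 1 := by
          have := (nod_monic Y).coeff_natDegree
          rwa [natDegree_nod] at this
        rw [coeff_sub, coeff_add, coeff_C_mul, h1, h2]; ring
      · have h1 : (nod Y).coeff d = 0 :=
          coeff_eq_zero_of_natDegree_lt (by rw [natDegree_nod]; omega)
        rw [coeff_sub, coeff_add, coeff_C_mul, h1, h2,
          coeff_eq_zero_of_natDegree_lt (show N.natDegree < d by omega)]; ring
    · intro x hx
      obtain ⟨j, -, rfl⟩ := mem_image.1 hx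
      rw [eval_add, eval_mul, eval_nod_self, mul_zero, zero_add, eval_finsetSum,
        sum_eq_single j]
      · rw [eval_mul, eval_C, hc]
        field_simp [eval_nod_removeNth_ne_zero hY j]
      · intro i _ hi
        rw [eval_mul, eval_nod_removeNth_of_ne Y hi.symm, mul_zero]
      · simp
  have hq : ∀ i : Fin (m + 1), ((reflect (m + 1) (nod (i.removeNth Y)) : ℝ[X]) : PowerSeries ℝ)
      * geo Y = PowerSeries.X * PowerSeries.mk fun k => Y i ^ k := by
    intro i
    rw [reflect_add_nat (natDegree_nod _).le, geo_succAbove Y i, pow_one, Polynomial.coe_mul, coe_X]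
    linear_combination (PowerSeries.X * PowerSeries.mk fun k => Y i ^ k) *
      reflect_nod_mul_geo (i.removeNth Y)
  have href : ((reflect (m + 1) N : ℝ[X]) : PowerSeries ℝ) * geo Y =
      PowerSeries.C (N.coeff (m + 1)) +
        ∑ i, PowerSeries.C (c i) * (PowerSeries.X * PowerSeries.mk fun k => Y i ^ k) := by
    have hr : reflect (m + 1) N = C (N.coeff (m + 1)) * reflect (m + 1) (nod Y) +
        ∑ i, C (c i) * reflect (m + 1) (nod (i.removeNth Y)) := by
      conv_lhs => rw [key]
      rw [reflect_add, reflect_C_mul]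
      congr 1
      rw [reflect_sum]
      simp_rw [reflect_C_mul]
    rw [hr, ← coeToPowerSeries.ringHom_apply, map_add, map_mul, map_sum, add_mul, mul_assoc,
      sum_mul]
    simp only [map_mul, coeToPowerSeries.ringHom_apply, mul_assoc, coe_C, reflect_nod_mul_geo,
      hq, mul_one]
  rw [href, map_add, map_sum, PowerSeries.coeff_C, if_neg (Nat.succ_ne_zero k), zero_add]
  refine sum_congr rfl fun i _ => ?_
  rw [PowerSeries.coeff_C_mul, PowerSeries.coeff_succ_X_mul, PowerSeries.coeff_mk]
  ring

end PartialFractions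

section DoublePoles

open Polynomial

variable {m : ℕ}

lemma sq_X_sub_C_dvd {M : ℝ[X]} {a : ℝ} (h0 : M.eval a = 0) (h1 : (derivative M).eval a = 0) :
    (X - C a) ^ 2 ∣ M := by
  obtain ⟨M₁, rfl⟩ := dvd_iff_isRoot.2 h0
  have h2 : M₁.eval a = 0 := by simpa using h1
  obtain ⟨M₂, rfl⟩ := dvd_iff_isRoot.2 h2
  exact ⟨M₂, by ring⟩

lemma nod_sq_dvd {Y : Fin m → ℝ} (hY : Function.Injective Y) {M : ℝ[X]}
    (h0 : ∀ i, M.eval (Y i) = 0) (h1 : ∀ i, (derivative M).eval (Y i) = 0) :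
    nod Y ^ 2 ∣ M := by
  rw [nod, ← prod_pow]
  refine Finset.prod_dvd_of_coprime (fun i _ j _ hij => ?_) fun i _ => sq_X_sub_C_dvd (h0 i) (h1 i)
  exact (pairwise_coprime_X_sub_C hY hij).pow

lemma coeff_mk_pow_sq (a : ℝ) (k : ℕ) :
    PowerSeries.coeff (k + 1)
      (PowerSeries.X ^ 2 * (PowerSeries.mk fun k => a ^ k) ^ 2) = k * a ^ (k - 1) := by
  cases k with
  | zero => rw [PowerSeries.coeff_X_pow_mul']; simp
  | succ k =>
    rw [show k + 1 + 1 = k + 2 from rfl, PowerSeries.coeff_X_pow_mul, sq, PowerSeries.coeff_mul]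
    simp only [PowerSeries.coeff_mk, ← pow_add]
    rw [sum_congr rfl fun x hx => by rw [mem_antidiagonal.1 hx]]
    simp

/-- Partial fractions with double poles: the coefficients of `N / nod Y ^ 2` at infinity. -/
lemma sum_double_residues {Y : Fin (m + 1) → ℝ} (hY : Function.Injective Y) {N : ℝ[X]}
    (hN : N.natDegree ≤ 2 * m + 2) (k : ℕ) :
    ∑ i, (k * Y i ^ (k - 1) * (N.eval (Y i) / (nod (i.removeNth Y)).eval (Y i) ^ 2) +
        Y i ^ k * ((derivative N).eval (Y i) / (nod (i.removeNth Y)).eval (Y i) ^ 2 -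
          2 * N.eval (Y i) * (derivative (nod (i.removeNth Y))).eval (Y i) /
            (nod (i.removeNth Y)).eval (Y i) ^ 3)) =
      PowerSeries.coeff (k + 1)
        (((reflect (2 * m + 2) N : ℝ[X]) : PowerSeries ℝ) * geo Y ^ 2) := by
  set q : Fin (m + 1) → ℝ[X] := fun i => nod (i.removeNth Y) with hqdef
  have hq0 : ∀ i, (q i).eval (Y i) ≠ 0 := eval_nod_removeNth_ne_zero hY
  set γ : Fin (m + 1) → ℝ := fun i => N.eval (Y i) / (q i).eval (Y i) ^ 2 with hγ
  set α : Fin (m + 1) → ℝ := fun i => (derivative N).eval (Y i) / (q i).eval (Y i) ^ 2 -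
    2 * N.eval (Y i) * (derivative (q i)).eval (Y i) / (q i).eval (Y i) ^ 3 with hα
  set L : Fin (m + 1) → ℝ[X] := fun i => C (α i) * (X - C (Y i)) + C (γ i) with hL
  have hLdeg : ∀ i, (L i).natDegree ≤ 1 := fun i =>
    natDegree_add_le_of_degree_le ((natDegree_C_mul_le _ _).trans (natDegree_X_sub_C _).le)
      (by simp)
  have hqdeg : ∀ i, (q i ^ 2).natDegree ≤ 2 * m := fun i =>
    natDegree_pow_le_of_le 2 (natDegree_nod _).le
  have key : N = C (N.coeff (2 * m + 2)) * nod Y ^ 2 + ∑ i, L i * q i ^ 2 := by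
    have hsum : (∑ i, L i * q i ^ 2).natDegree ≤ 2 * m + 1 :=
      natDegree_sum_le_of_forall_le _ _ fun i _ =>
        natDegree_mul_le.trans (by linarith [hLdeg i, hqdeg i])
    have hnd : (nod Y ^ 2).natDegree = 2 * m + 2 := by
      rw [(nod_monic Y).natDegree_pow, natDegree_nod]; ring
    refine sub_eq_zero.1 (eq_zero_of_dvd_of_degree_lt (nod_sq_dvd hY ?_ ?_) ?_)
    · intro j
      have h3 : ∑ i, (L i * q i ^ 2).eval (Y j) = N.eval (Y j) := by
        rw [sum_eq_single j]
        · simp only [hL, hγ, eval_mul, eval_add, eval_C, eval_sub, eval_X, eval_pow]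
          field_simp [hq0 j]
          ring
        · intro i _ hi
          rw [eval_mul, eval_pow, hqdef, eval_nod_removeNth_of_ne Y hi.symm]; ring
        · simp
      rw [eval_sub, eval_add, eval_finsetSum, h3, eval_mul, eval_pow, eval_nod_self]; ring
    · intro j
      have h3 : ∑ i, (derivative (L i * q i ^ 2)).eval (Y j) = (derivative N).eval (Y j) := by
        rw [sum_eq_single j]
        · simp only [hL, hγ, hα, derivative_mul, derivative_add, derivative_sub, derivative_C,
            derivative_X, derivative_pow, eval_mul, eval_add, eval_C, eval_sub, eval_X, eval_pow,
            eval_zero, eval_one]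
          field_simp [hq0 j]
          push_cast
          ring
        · intro i _ hi
          have := eval_nod_removeNth_of_ne Y hi.symm
          simp [derivative_mul, derivative_pow, hqdef, this]
        · simp
      rw [derivative_sub, derivative_add, derivative_sum, eval_sub, eval_add, eval_finsetSum, h3]
      simp [derivative_mul, derivative_pow, eval_nod_self]
    · rw [degree_eq_natDegree ((nod_monic Y).pow 2).ne_zero, hnd, degree_lt_iff_coeff_zero]
      intro d hd
      have h2 : (∑ i, L i * q i ^ 2).coeff d = 0 := coeff_eq_zero_of_natDegree_lt (by omega)
      rcases eq_or_lt_of_le hd with rfl | hlt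
      · have h1 : (nod Y ^ 2).coeff (2 * m + 2) = 1 := by
          have := ((nod_monic Y).pow 2).coeff_natDegree
          rwa [hnd] at this
        rw [coeff_sub, coeff_add, coeff_C_mul, h1, h2]; ring
      · have h1 : (nod Y ^ 2).coeff d = 0 := coeff_eq_zero_of_natDegree_lt (by omega)
        rw [coeff_sub, coeff_add, coeff_C_mul, h1, h2,
          coeff_eq_zero_of_natDegree_lt (show N.natDegree < d by omega)]; ring
  have hsq : reflect (2 * m + 2) (nod Y ^ 2) = reflect (m + 1) (nod Y) ^ 2 := by
    rw [show 2 * m + 2 = (m + 1) + (m + 1) by ring, sq, sq,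
      reflect_mul _ _ (natDegree_nod _).le (natDegree_nod _).le]
  have hLq : ∀ i, ((reflect (2 * m + 2) (L i * q i ^ 2) : ℝ[X]) : PowerSeries ℝ) * geo Y ^ 2 =
      PowerSeries.C (α i) * (PowerSeries.X * PowerSeries.mk fun k => Y i ^ k) +
      PowerSeries.C (γ i) * (PowerSeries.X ^ 2 * (PowerSeries.mk fun k => Y i ^ k) ^ 2) := by
    intro i
    have h1 : reflect (2 * m + 2) (L i * q i ^ 2) =
        (C (α i) * (X * (1 - C (Y i) * X)) + C (γ i) * X ^ 2) * reflect m (q i) ^ 2 := by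
      rw [show 2 * m + 2 = 2 + (m + m) by ring, sq (q i),
        reflect_mul _ _ ((hLdeg i).trans one_le_two) (by rw [← sq, ← two_mul]; exact hqdeg i),
        reflect_mul _ _ (natDegree_nod _).le (natDegree_nod _).le, ← sq]
      congr 1
      have h2 : reflect 2 (X - C (Y i)) = _ := reflect_add_nat (natDegree_X_sub_C _).le 1
      rw [hL, reflect_add, reflect_C_mul, reflect_C, h2, reflect_X_sub_C]
      ring
    rw [h1, geo_succAbove Y i]
    have e1 := reflect_nod_mul_geo (i.removeNth Y)
    have e2 := one_sub_mul_mk_pow (Y i)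
    simp only [Polynomial.coe_mul, Polynomial.coe_pow, Polynomial.coe_add, Polynomial.coe_sub,
      coe_X, coe_C, Polynomial.coe_one, hqdef]
    set g := PowerSeries.mk fun k => Y i ^ k
    set R := ((reflect m (nod (i.removeNth Y)) : ℝ[X]) : PowerSeries ℝ)
    set G := geo (i.removeNth Y)
    calc _ = (PowerSeries.C (α i) * (PowerSeries.X * g) *
              ((1 - PowerSeries.C (Y i) * PowerSeries.X) * g) +
            PowerSeries.C (γ i) * (PowerSeries.X ^ 2 * g ^ 2)) * (R * G) ^ 2 := by ring
      _ = _ := by rw [e1, e2]; ring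
  have href : ((reflect (2 * m + 2) N : ℝ[X]) : PowerSeries ℝ) * geo Y ^ 2 =
      PowerSeries.C (N.coeff (2 * m + 2)) +
        ∑ i, (PowerSeries.C (α i) * (PowerSeries.X * PowerSeries.mk fun k => Y i ^ k) +
      PowerSeries.C (γ i) * (PowerSeries.X ^ 2 * (PowerSeries.mk fun k => Y i ^ k) ^ 2)) := by
    have hr : reflect (2 * m + 2) N = C (N.coeff (2 * m + 2)) * reflect (m + 1) (nod Y) ^ 2 +
        ∑ i, reflect (2 * m + 2) (L i * q i ^ 2) := by
      conv_lhs => rw [key]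
      rw [reflect_add, reflect_C_mul, reflect_sum, hsq]
    rw [hr, ← coeToPowerSeries.ringHom_apply, map_add, map_mul, map_sum, add_mul, mul_assoc,
      sum_mul, map_pow]
    simp only [coeToPowerSeries.ringHom_apply, hLq, coe_C, ← mul_pow, reflect_nod_mul_geo,
      one_pow, mul_one]
  rw [href, map_add, map_sum, PowerSeries.coeff_C, if_neg (Nat.succ_ne_zero k), zero_add]
  refine sum_congr rfl fun i _ => ?_
  rw [map_add, PowerSeries.coeff_C_mul, PowerSeries.coeff_C_mul, PowerSeries.coeff_succ_X_mul,
    coeff_mk_pow_sq, PowerSeries.coeff_mk]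
  ring

end DoublePoles

section PowerSums

open PowerSeries

variable {m : ℕ}

/-- The power sum `∑ j, X j ^ k`. -/
noncomputable def psum (k : ℕ) (T : Fin m → ℝ) : ℝ := ∑ j, T j ^ k

lemma derivative_prod_of_logDeriv {ι : Type*} (s : Finset ι) (f l : ι → PowerSeries ℝ)
    (h : ∀ i, derivative ℝ (f i) = f i * l i) :
    derivative ℝ (∏ i ∈ s, f i) = (∏ i ∈ s, f i) * ∑ i ∈ s, l i := by
  classical
  induction s using Finset.induction_on with
  | empty => simp
  | insert a s ha ih =>
    rw [prod_insert ha, sum_insert ha, Derivation.leibniz, ih, h, smul_eq_mul, smul_eq_mul]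
    ring

lemma derivative_mk_pow (a : ℝ) :
    derivative ℝ (PowerSeries.mk fun k => a ^ k) = (PowerSeries.mk fun k => a ^ k) * PowerSeries.mk fun k => a ^ (k + 1) := by
  ext k
  rw [PowerSeries.coeff_derivative, PowerSeries.coeff_mul]
  have h : ∀ x ∈ antidiagonal k, coeff x.1 (PowerSeries.mk fun k => a ^ k) *
      coeff x.2 (PowerSeries.mk fun k => a ^ (k + 1)) = a ^ (k + 1) := fun x hx => by
    simp only [PowerSeries.coeff_mk, ← pow_add, ← add_assoc, mem_antidiagonal.1 hx]
  rw [sum_congr rfl h]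
  simp [mul_comm]

lemma derivative_one_sub (a : ℝ) :
    derivative ℝ (1 - C a * X) = (1 - C a * X) * -(PowerSeries.mk fun k => a ^ (k + 1)) := by
  have h1 : (PowerSeries.mk fun k => a ^ (k + 1)) = C a * PowerSeries.mk fun k => a ^ k := by
    ext k; simp [pow_succ']
  have h2 := one_sub_mul_mk_pow a
  have h3 : derivative ℝ (1 - C a * X) = -C a := by
    rw [map_sub, Derivation.leibniz]; simp
  rw [h1, h3]
  linear_combination C a * h2

lemma sum_mk_pow (T : Fin m → ℝ) :
    ∑ j, (PowerSeries.mk fun k => T j ^ (k + 1) : PowerSeries ℝ) = PowerSeries.mk fun k => psum (k + 1) T := by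
  ext k
  simp [psum]

/-- Newton's identities for the quotient `∏ (1 - x X) / ∏ (1 - y X)`. -/
lemma derivative_reflect_nod_mul_geo {a c : ℕ} (S : Fin a → ℝ) (T : Fin c → ℝ) :
    derivative ℝ ((Polynomial.reflect a (nod S) : PowerSeries ℝ) * geo T) =
      (Polynomial.reflect a (nod S) : PowerSeries ℝ) * geo T *
        PowerSeries.mk fun k => psum (k + 1) T - psum (k + 1) S := by
  have h1 : (Polynomial.reflect a (nod S) : PowerSeries ℝ) = ∏ j, (1 - C (S j) * X) := by
    rw [reflect_nod, ← Polynomial.coeToPowerSeries.ringHom_apply, map_prod]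
    simp
  have h2 := derivative_prod_of_logDeriv univ _ _ fun j : Fin a => derivative_one_sub (S j)
  have h3 := derivative_prod_of_logDeriv univ _ _ fun j : Fin c => derivative_mk_pow (T j)
  rw [sum_mk_pow] at h3
  rw [sum_neg_distrib, sum_mk_pow, ← h1] at h2
  have h4 : (PowerSeries.mk fun k => psum (k + 1) T - psum (k + 1) S : PowerSeries ℝ) =
      (PowerSeries.mk fun k => psum (k + 1) T) - PowerSeries.mk fun k => psum (k + 1) S := rfl
  rw [Derivation.leibniz, h2, geo, h3, h4, smul_eq_mul, smul_eq_mul]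
  ring

lemma coeff_zero_reflect_nod_mul_geo {a c : ℕ} (S : Fin a → ℝ) (T : Fin c → ℝ) :
    coeff 0 ((Polynomial.reflect a (nod S) : PowerSeries ℝ) * geo T) = 1 := by
  have h : Polynomial.coeff (nod S) a = 1 := by
    have := (nod_monic S).coeff_natDegree
    rwa [natDegree_nod] at this
  rw [coeff_zero_eq_constantCoeff_apply, map_mul, geo, map_prod]
  simp [Polynomial.constantCoeff_coe, Polynomial.coeff_reflect, h, PowerSeries.constantCoeff_mk]

lemma coeff_of_derivative_eq {H : PowerSeries ℝ} {δ : ℕ → ℝ} (h0 : coeff 0 H = 1)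
    (hH : derivative ℝ H = H * PowerSeries.mk δ) :
    coeff 1 H = δ 0 ∧ coeff 4 H =
      (δ 0 ^ 4 + 6 * δ 0 ^ 2 * δ 1 + 3 * δ 1 ^ 2 + 8 * δ 0 * δ 2 + 6 * δ 3) / 24 := by
  have e : ∀ k, coeff (k + 1) H * (k + 1) =
      ∑ i ∈ range (k + 1), coeff i H * δ (k - i) := by
    intro k
    rw [← PowerSeries.coeff_derivative, hH, PowerSeries.coeff_mul,
      Finset.Nat.sum_antidiagonal_eq_sum_range_succ_mk]
    simp
  have e0 := e 0
  have e1 := e 1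
  have e2 := e 2
  have e3 := e 3
  simp only [sum_range_succ, range_zero, sum_empty, h0] at e0 e1 e2 e3
  norm_num at e0 e1 e2 e3
  refine ⟨e0, ?_⟩
  have f2 : coeff 2 H = (δ 0 ^ 2 + δ 1) / 2 := by rw [e0] at e1; linarith
  have f3 : coeff 3 H = (δ 0 ^ 3 + 3 * δ 0 * δ 1 + 2 * δ 2) / 6 := by
    rw [e0, f2] at e2; linarith
  rw [e0, f2, f3] at e3
  linarith

end PowerSums

section Vandermonde

open Polynomial

variable {m : ℕ}

/-- The Vandermonde factor with a natural exponent. -/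
noncomputable def npv (p : ℕ) (T : Fin m → ℝ) : ℝ := ∏ j, ∏ k ∈ Ioi j, |T k - T j| ^ p

lemma npv_eq_abs_det (p : ℕ) (T : Fin m → ℝ) : npv p T = |(Matrix.vandermonde T).det| ^ p := by
  rw [npv, Matrix.det_vandermonde, abs_prod, ← prod_pow]
  refine prod_congr rfl fun j _ => ?_
  rw [abs_prod, prod_pow]

lemma vand_natCast (p : ℕ) (T : Fin m → ℝ) : vand p T = npv p T := by
  simp [vand, npv]

lemma npv_nonneg (p : ℕ) (T : Fin m → ℝ) : 0 ≤ npv p T := by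
  rw [npv_eq_abs_det]; positivity

lemma npv_eq_zero_of_not_injective {p : ℕ} (hp : p ≠ 0) {T : Fin m → ℝ}
    (hT : ¬ Function.Injective T) : npv p T = 0 := by
  rw [npv_eq_abs_det]
  have : (Matrix.vandermonde T).det = 0 := by
    by_contra h
    exact hT (Matrix.det_vandermonde_ne_zero_iff.1 h)
  simp [this, hp]

lemma npv_comp_perm (p : ℕ) (T : Fin m → ℝ) (σ : Equiv.Perm (Fin m)) :
    npv p (T ∘ σ) = npv p T := by
  have h : Matrix.vandermonde (T ∘ σ) = (Matrix.vandermonde T).submatrix σ id := by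
    ext i j; simp [Matrix.vandermonde_apply]
  rw [npv_eq_abs_det, npv_eq_abs_det, h, Matrix.det_permute, abs_mul]
  rcases Int.units_eq_one_or (Equiv.Perm.sign σ) with h | h <;> simp [h]

lemma npv_removeNth (p : ℕ) (Y : Fin (m + 1) → ℝ) (i : Fin (m + 1)) :
    npv p Y = npv p (i.removeNth Y) * |(nod (i.removeNth Y)).eval (Y i)| ^ p := by
  rw [← npv_comp_perm p Y i.cycleRange.symm, npv, Fin.prod_univ_succ, mul_comm]
  congr 1
  · simp [npv, Fin.removeNth]
  · rw [eval_nod, abs_prod, ← prod_pow]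
    simp [Fin.removeNth, abs_sub_comm]

lemma psum_removeNth (k : ℕ) (Y : Fin (m + 1) → ℝ) (i : Fin (m + 1)) :
    psum k (i.removeNth Y) = psum k Y - Y i ^ k := by
  simp [psum, Fin.removeNth, Fin.sum_univ_succAbove _ i]

lemma npv_removeNth_mul_eq_zero {p : ℕ} (hp : p ≠ 0) {Y : Fin (m + 1) → ℝ}
    (hY : ¬ Function.Injective Y) (i : Fin (m + 1)) :
    npv p (i.removeNth Y) = 0 ∨ (nod (i.removeNth Y)).eval (Y i) = 0 := by
  have h := npv_eq_zero_of_not_injective hp hY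
  rw [npv_removeNth p Y i, mul_eq_zero] at h
  exact h.imp_right fun h => abs_eq_zero.1 (pow_eq_zero_iff hp |>.1 h)

end Vandermonde

section Residues

open Polynomial

variable {m : ℕ}

/-- The complete homogeneous polynomial of degree four in terms of power sums. -/
noncomputable def chp (d₁ d₂ d₃ d₄ : ℝ) : ℝ :=
  (d₁ ^ 4 + 6 * d₁ ^ 2 * d₂ + 3 * d₂ ^ 2 + 8 * d₁ * d₃ + 6 * d₄) / 24

/-- Difference of power sums. -/
noncomputable def dps (k : ℕ) {a c : ℕ} (X : Fin a → ℝ) (Y : Fin c → ℝ) : ℝ := psum k Y - psum k X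

lemma sum_nod_div_nod {Y : Fin (m + 1) → ℝ} (hY : Function.Injective Y) (X : Fin (m + 1) → ℝ) :
    (∑ i, (nod X).eval (Y i) / (nod (i.removeNth Y)).eval (Y i) = dps 1 X Y) ∧
    ∑ i, Y i ^ 3 * ((nod X).eval (Y i) / (nod (i.removeNth Y)).eval (Y i)) =
      chp (dps 1 X Y) (dps 2 X Y) (dps 3 X Y) (dps 4 X Y) := by
  have h := coeff_of_derivative_eq (coeff_zero_reflect_nod_mul_geo X Y)
    (derivative_reflect_nod_mul_geo X Y)
  have hd := (natDegree_nod X).le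
  have h0 := sum_simple_residues hY hd 0
  have h3 := sum_simple_residues hY hd 3
  rw [zero_add, h.1] at h0
  rw [h.2] at h3
  exact ⟨by simpa [dps] using h0, h3⟩

lemma sum_nod_div_nod_of_lt {a r : ℕ} {Y : Fin (m + 1) → ℝ} (hY : Function.Injective Y)
    (X : Fin a → ℝ) (hr : a + r = m + 1) (k : ℕ) :
    (k + 1 < r → ∑ i, Y i ^ k * ((nod X).eval (Y i) / (nod (i.removeNth Y)).eval (Y i)) = 0) ∧
    (k + 1 = r → ∑ i, Y i ^ k * ((nod X).eval (Y i) / (nod (i.removeNth Y)).eval (Y i)) = 1) := by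
  have hd := (natDegree_nod X).le
  have h := sum_simple_residues hY (hd.trans (by omega : a ≤ m + 1)) k
  have e : reflect (m + 1) (nod X) = reflect a (nod X) * Polynomial.X ^ r := by
    rw [← hr, reflect_add_nat hd]
  rw [e, Polynomial.coe_mul, Polynomial.coe_pow, Polynomial.coe_X,
    mul_assoc, mul_left_comm, PowerSeries.coeff_X_pow_mul'] at h
  refine ⟨fun hk => ?_, fun hk => ?_⟩
  · rw [h, if_neg (by omega)]
  · rw [h, if_pos hk.ge, hk, Nat.sub_self, coeff_zero_reflect_nod_mul_geo]

/-- The residue at `y` of `t ^ k * (P / Q) ^ 2 / (t - y) ^ 2`, up to the factor `Q y ^ 4`. -/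
noncomputable def dres (P Q : ℝ[X]) (y : ℝ) : ℝ :=
  2 * P.eval y * (derivative P).eval y * Q.eval y ^ 2 -
    2 * P.eval y ^ 2 * Q.eval y * (derivative Q).eval y

lemma double_residue_eq (P Q : ℝ[X]) (y : ℝ) (hQ : Q.eval y ≠ 0) (k : ℕ) :
    (k * y ^ (k - 1) * ((P ^ 2).eval y / Q.eval y ^ 2) +
        y ^ k * ((derivative (P ^ 2)).eval y / Q.eval y ^ 2 -
          2 * (P ^ 2).eval y * (derivative Q).eval y / Q.eval y ^ 3)) * Q.eval y ^ 4 =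
      k * y ^ (k - 1) * P.eval y ^ 2 * Q.eval y ^ 2 + y ^ k * dres P Q y := by
  rw [dres, derivative_pow]
  simp only [eval_pow, eval_mul, eval_C, Nat.cast_ofNat]
  field_simp
  norm_num
  ring

lemma sum_double_nod_div_nod {Y : Fin (m + 1) → ℝ} (hY : Function.Injective Y)
    (X : Fin (m + 1) → ℝ) :
    (∑ i, (dres (nod X) (nod (i.removeNth Y)) (Y i)) / (nod (i.removeNth Y)).eval (Y i) ^ 4 =
      2 * dps 1 X Y) ∧
    ∑ i, (3 * Y i ^ 2 * (nod X).eval (Y i) ^ 2 * (nod (i.removeNth Y)).eval (Y i) ^ 2 +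
        Y i ^ 3 * dres (nod X) (nod (i.removeNth Y)) (Y i)) /
          (nod (i.removeNth Y)).eval (Y i) ^ 4 =
      chp (2 * dps 1 X Y) (2 * dps 2 X Y) (2 * dps 3 X Y) (2 * dps 4 X Y) := by
  have hq := fun i => eval_nod_removeNth_ne_zero hY i
  have hd := (natDegree_nod X).le
  have hd2 : (nod X ^ 2).natDegree ≤ 2 * m + 2 := by
    rw [natDegree_pow, natDegree_nod]; omega
  have hH : (((reflect (2 * m + 2) (nod X ^ 2) : ℝ[X]) : PowerSeries ℝ) * geo Y ^ 2) =
      ((reflect (m + 1) (nod X) : PowerSeries ℝ) * geo Y) ^ 2 := by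
    rw [sq (nod X), show 2 * m + 2 = (m + 1) + (m + 1) by ring, reflect_mul _ _ hd hd,
      Polynomial.coe_mul]
    ring
  have h0 := coeff_zero_reflect_nod_mul_geo X Y
  have h := coeff_of_derivative_eq
    (H := ((reflect (m + 1) (nod X) : PowerSeries ℝ) * geo Y) ^ 2)
    (δ := fun k => 2 * (psum (k + 1) Y - psum (k + 1) X))
    (by rw [PowerSeries.coeff_zero_eq_constantCoeff_apply] at h0 ⊢; rw [map_pow, h0, one_pow])
    (by
      have e : (PowerSeries.mk fun k => 2 * (psum (k + 1) Y - psum (k + 1) X)) =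
          2 * PowerSeries.mk fun k => psum (k + 1) Y - psum (k + 1) X := by
        rw [two_mul]; ext k; simp [two_mul]
      rw [sq, Derivation.leibniz, derivative_reflect_nod_mul_geo, smul_eq_mul, e]
      ring)
  have e0 := sum_double_residues hY hd2 0
  have e3 := sum_double_residues hY hd2 3
  rw [hH, zero_add, h.1] at e0
  rw [hH, h.2] at e3
  constructor
  · refine Eq.trans (sum_congr rfl fun i _ => ?_) e0
    rw [div_eq_iff (pow_ne_zero 4 (hq i)), double_residue_eq _ _ _ (hq i)]
    simp
  · refine Eq.trans (sum_congr rfl fun i _ => ?_) e3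
    rw [div_eq_iff (pow_ne_zero 4 (hq i)), double_residue_eq _ _ _ (hq i)]
    norm_num

lemma sum_double_nod_div_nod_of_lt {Y : Fin (m + 2) → ℝ} (hY : Function.Injective Y)
    (X : Fin m → ℝ) :
    (∑ i, (dres (nod X) (nod (i.removeNth Y)) (Y i)) / (nod (i.removeNth Y)).eval (Y i) ^ 4 =
      0) ∧
    ∑ i, (3 * Y i ^ 2 * (nod X).eval (Y i) ^ 2 * (nod (i.removeNth Y)).eval (Y i) ^ 2 +
        Y i ^ 3 * dres (nod X) (nod (i.removeNth Y)) (Y i)) /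
          (nod (i.removeNth Y)).eval (Y i) ^ 4 = 1 := by
  have hq := fun i => eval_nod_removeNth_ne_zero hY i
  have hd := (natDegree_nod X).le
  have hd2 : (nod X ^ 2).natDegree ≤ 2 * (m + 1) + 2 := by
    rw [natDegree_pow, natDegree_nod]; omega
  have hH : (((reflect (2 * (m + 1) + 2) (nod X ^ 2) : ℝ[X]) : PowerSeries ℝ) * geo Y ^ 2) =
      PowerSeries.X ^ 4 * ((reflect m (nod X) : PowerSeries ℝ) * geo Y) ^ 2 := by
    rw [sq (nod X), show 2 * (m + 1) + 2 = (m + 2) + (m + 2) by ring,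
      reflect_mul _ _ (hd.trans (by omega)) (hd.trans (by omega)), reflect_add_nat hd,
      Polynomial.coe_mul, Polynomial.coe_mul, Polynomial.coe_pow, Polynomial.coe_X]
    ring
  have h0 := coeff_zero_reflect_nod_mul_geo X Y
  have e0 := sum_double_residues hY hd2 0
  have e3 := sum_double_residues hY hd2 3
  rw [hH, PowerSeries.coeff_X_pow_mul', if_neg (by norm_num)] at e0
  have h0' : PowerSeries.coeff 0 (((reflect m (nod X) : PowerSeries ℝ) * geo Y) ^ 2) = 1 := by
    rw [PowerSeries.coeff_zero_eq_constantCoeff_apply] at h0 ⊢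
    rw [map_pow, h0, one_pow]
  rw [hH, PowerSeries.coeff_X_pow_mul', if_pos (by norm_num), Nat.sub_self, h0'] at e3
  constructor
  · refine Eq.trans (sum_congr rfl fun i _ => ?_) e0
    rw [div_eq_iff (pow_ne_zero 4 (hq i)), double_residue_eq _ _ _ (hq i)]
    simp
  · refine Eq.trans (sum_congr rfl fun i _ => ?_) e3
    rw [div_eq_iff (pow_ne_zero 4 (hq i)), double_residue_eq _ _ _ (hq i)]
    norm_num

end Residues

section Kernels

open Polynomial

variable {m a c : ℕ}

/-- The sign function, as a quotient. -/
noncomputable def sg (x : ℝ) : ℝ := x / |x|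

lemma sg_mul (x y : ℝ) : sg (x * y) = sg x * sg y := by
  rw [sg, abs_mul, mul_div_mul_comm]; rfl

lemma sg_neg (x : ℝ) : sg (-x) = -sg x := by
  rw [sg, abs_neg, neg_div]; rfl

lemma sg_of_pos {x : ℝ} (h : 0 < x) : sg x = 1 := by
  rw [sg, abs_of_pos h, div_self h.ne']

lemma sg_of_neg {x : ℝ} (h : x < 0) : sg x = -1 := by
  rw [← neg_neg x, sg_neg, sg_of_pos (neg_pos.2 h)]

lemma sg_mul_self {x : ℝ} (h : x ≠ 0) : sg x * sg x = 1 := by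
  rcases h.lt_or_gt with h | h
  · simp [sg_of_neg h]
  · simp [sg_of_pos h]

@[simp] lemma sg_zero : sg 0 = 0 := by simp [sg]

lemma abs_mul_sg (x : ℝ) : |x| * sg x = x := by
  rcases eq_or_ne x 0 with rfl | h
  · simp
  · rw [sg, mul_div_cancel₀ _ (abs_ne_zero.2 h)]

lemma sg_prod {ι : Type*} (s : Finset ι) (f : ι → ℝ) : sg (∏ i ∈ s, f i) = ∏ i ∈ s, sg (f i) := by
  classical
  induction s using Finset.induction_on with
  | empty => simp [sg]
  | insert i s hi ih => rw [prod_insert hi, prod_insert hi, sg_mul, ih]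

/-- The transfer kernel for `β = 2`. -/
noncomputable def ker2 (X : Fin a → ℝ) (y : ℝ) (Y : Fin c → ℝ) : ℝ :=
  npv 2 X * npv 2 Y * ((nod X).eval y * (nod Y).eval y * ((y ^ 3 + psum 3 X - psum 3 Y) / 2))

/-- The transfer kernel for `β = 4`. -/
noncomputable def ker4 (X : Fin a → ℝ) (y : ℝ) (Y : Fin c → ℝ) : ℝ :=
  npv 4 X * npv 4 Y * (3 * y ^ 2 * (nod X).eval y ^ 2 * (nod Y).eval y ^ 2 +
    dres (nod X) (nod Y) y * (psum 3 X - psum 3 Y))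

/-- The transfer kernel for `β = 1`. -/
noncomputable def ker1 (X : Fin a → ℝ) (y : ℝ) (Y : Fin c → ℝ) : ℝ :=
  npv 1 X * npv 1 Y * ((nod X).eval y * sg ((nod Y).eval y) * ((y ^ 3 + psum 3 X - psum 3 Y) / 2))

/-- The bilinear density of the Hirota-type identity for `β = 1, 2`. -/
noncomputable def hir (p : ℕ) (X : Fin a → ℝ) (Y : Fin c → ℝ) : ℝ :=
  npv p X * npv p Y * (chp (dps 1 X Y) (dps 2 X Y) (dps 3 X Y) (dps 4 X Y) -
    dps 1 X Y * dps 3 X Y / 2)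

/-- The bilinear density of the Hirota-type identity for `β = 4`. -/
noncomputable def hir4 (X : Fin a → ℝ) (Y : Fin c → ℝ) : ℝ :=
  npv 4 X * npv 4 Y *
    (chp (2 * dps 1 X Y) (2 * dps 2 X Y) (2 * dps 3 X Y) (2 * dps 4 X Y) -
      2 * dps 1 X Y * dps 3 X Y)

lemma hir_two_eq_sum_ker2 (X Y : Fin (m + 1) → ℝ) :
    hir 2 X Y = ∑ i, ker2 X (Y i) (i.removeNth Y) := by
  by_cases hY : Function.Injective Y
  · obtain ⟨h0, h3⟩ := sum_nod_div_nod hY X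
    have h : hir 2 X Y = npv 2 X * npv 2 Y *
        (∑ i, Y i ^ 3 * ((nod X).eval (Y i) / (nod (i.removeNth Y)).eval (Y i)) -
          (∑ i, (nod X).eval (Y i) / (nod (i.removeNth Y)).eval (Y i)) * (dps 3 X Y / 2)) := by
      rw [h0, h3, hir]; ring
    rw [h, sum_mul, ← sum_sub_distrib, mul_sum]
    refine sum_congr rfl fun i _ => ?_
    have hq := eval_nod_removeNth_ne_zero hY i
    rw [ker2, npv_removeNth 2 Y i, psum_removeNth, sq_abs, dps]
    field_simp
    ring
  · rw [hir, npv_eq_zero_of_not_injective two_ne_zero hY, sum_eq_zero]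
    · ring
    · intro i _
      rw [ker2]
      rcases npv_removeNth_mul_eq_zero two_ne_zero hY i with h | h <;> rw [h] <;> ring

lemma sum_ker2_eq_zero (Z : Fin (m + 2) → ℝ) (Y : Fin m → ℝ) :
    ∑ i, ker2 (i.removeNth Z) (Z i) Y = 0 := by
  by_cases hZ : Function.Injective Z
  · have h0 := (sum_nod_div_nod_of_lt hZ Y (show m + 2 = m + 1 + 1 from rfl) 0).1 (by norm_num)
    have h : npv 2 Z * npv 2 Y * ((psum 3 Z - psum 3 Y) / 2) *
        ∑ i, Z i ^ 0 * ((nod Y).eval (Z i) / (nod (i.removeNth Z)).eval (Z i)) = 0 := by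
      rw [h0, mul_zero]
    rw [← h, mul_sum]
    refine sum_congr rfl fun i _ => ?_
    have hq := eval_nod_removeNth_ne_zero hZ i
    rw [ker2, npv_removeNth 2 Z i, psum_removeNth, sq_abs]
    field_simp
    ring
  · refine sum_eq_zero fun i _ => ?_
    rw [ker2]
    rcases npv_removeNth_mul_eq_zero two_ne_zero hZ i with h | h <;> rw [h] <;> ring

lemma hir4_eq_sum_ker4 (X Y : Fin (m + 1) → ℝ) :
    hir4 X Y = ∑ i, ker4 X (Y i) (i.removeNth Y) := by
  by_cases hY : Function.Injective Y
  · obtain ⟨h0, h3⟩ := sum_double_nod_div_nod hY X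
    rw [hir4, ← h3, ← h0, sum_mul, ← sum_sub_distrib, mul_sum]
    refine sum_congr rfl fun i _ => ?_
    have hq := eval_nod_removeNth_ne_zero hY i
    rw [ker4, npv_removeNth 4 Y i, psum_removeNth, Even.pow_abs (by decide), dps]
    field_simp
    ring
  · rw [hir4, npv_eq_zero_of_not_injective four_ne_zero hY, sum_eq_zero]
    · ring
    · intro i _
      rw [ker4, dres]
      rcases npv_removeNth_mul_eq_zero four_ne_zero hY i with h | h <;> rw [h] <;> ring

lemma dres_swap (P Q : ℝ[X]) (y : ℝ) : dres P Q y = -dres Q P y := by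
  rw [dres, dres]; ring

lemma sum_ker4_eq_mul (Z : Fin (m + 2) → ℝ) (Y : Fin m → ℝ) :
    ∑ i, ker4 (i.removeNth Z) (Z i) Y = npv 4 Z * npv 4 Y := by
  by_cases hZ : Function.Injective Z
  · obtain ⟨h0, h3⟩ := sum_double_nod_div_nod_of_lt hZ Y
    have h : npv 4 Z * npv 4 Y * (∑ i, (3 * Z i ^ 2 * (nod Y).eval (Z i) ^ 2 *
          (nod (i.removeNth Z)).eval (Z i) ^ 2 +
          Z i ^ 3 * dres (nod Y) (nod (i.removeNth Z)) (Z i)) /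
            (nod (i.removeNth Z)).eval (Z i) ^ 4 -
        (∑ i, (dres (nod Y) (nod (i.removeNth Z)) (Z i)) /
          (nod (i.removeNth Z)).eval (Z i) ^ 4) * (psum 3 Z - psum 3 Y)) =
        npv 4 Z * npv 4 Y := by
      rw [h0, h3]; ring
    rw [← h, sum_mul, ← sum_sub_distrib, mul_sum]
    refine sum_congr rfl fun i _ => ?_
    have hq := eval_nod_removeNth_ne_zero hZ i
    rw [ker4, npv_removeNth 4 Z i, psum_removeNth, Even.pow_abs (by decide),
      dres_swap (nod (i.removeNth Z))]
    field_simp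
    ring
  · rw [npv_eq_zero_of_not_injective four_ne_zero hZ, zero_mul]
    refine sum_eq_zero fun i _ => ?_
    rw [ker4, dres]
    rcases npv_removeNth_mul_eq_zero four_ne_zero hZ i with h | h <;> rw [h] <;> ring

lemma hir_one_eq_sum_ker1 (X Y : Fin (m + 1) → ℝ) :
    hir 1 X Y = ∑ i, ker1 X (Y i) (i.removeNth Y) := by
  by_cases hY : Function.Injective Y
  · obtain ⟨h0, h3⟩ := sum_nod_div_nod hY X
    have h : hir 1 X Y = npv 1 X * npv 1 Y *
        (∑ i, Y i ^ 3 * ((nod X).eval (Y i) / (nod (i.removeNth Y)).eval (Y i)) -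
          (∑ i, (nod X).eval (Y i) / (nod (i.removeNth Y)).eval (Y i)) * (dps 3 X Y / 2)) := by
      rw [h0, h3, hir]; ring
    rw [h, sum_mul, ← sum_sub_distrib, mul_sum]
    refine sum_congr rfl fun i _ => ?_
    have hq := eval_nod_removeNth_ne_zero hY i
    have hs : sg ((nod (i.removeNth Y)).eval (Y i)) =
        |(nod (i.removeNth Y)).eval (Y i)| / (nod (i.removeNth Y)).eval (Y i) := by
      rw [sg, div_eq_div_iff (abs_ne_zero.2 hq) hq, abs_mul_abs_self]
    rw [ker1, npv_removeNth 1 Y i, psum_removeNth, pow_one, dps, hs]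
    field_simp
    ring
  · rw [hir, npv_eq_zero_of_not_injective one_ne_zero hY, sum_eq_zero]
    · ring
    · intro i _
      rw [ker1]
      rcases npv_removeNth_mul_eq_zero one_ne_zero hY i with h | h <;> rw [h]
      · ring
      · rw [sg_zero]; ring

lemma sum_ker1_eq_mul (Z : Fin (m + 4) → ℝ) (Y : Fin m → ℝ) :
    ∑ i, ker1 Y (Z i) (i.removeNth Z) = npv 1 Z * npv 1 Y := by
  by_cases hZ : Function.Injective Z
  · have h0 := (sum_nod_div_nod_of_lt hZ Y (show m + 4 = m + 3 + 1 from rfl) 0).1 (by norm_num)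
    have h3 := (sum_nod_div_nod_of_lt hZ Y (show m + 4 = m + 3 + 1 from rfl) 3).2 (by norm_num)
    have h : npv 1 Z * npv 1 Y *
        (∑ i, Z i ^ 3 * ((nod Y).eval (Z i) / (nod (i.removeNth Z)).eval (Z i)) -
        (∑ i, Z i ^ 0 * ((nod Y).eval (Z i) / (nod (i.removeNth Z)).eval (Z i))) *
          ((psum 3 Z - psum 3 Y) / 2)) = npv 1 Z * npv 1 Y := by
      rw [h0, h3]; ring
    rw [← h, sum_mul, ← sum_sub_distrib, mul_sum]
    refine sum_congr rfl fun i _ => ?_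
    have hq := eval_nod_removeNth_ne_zero hZ i
    have hs : sg ((nod (i.removeNth Z)).eval (Z i)) =
        |(nod (i.removeNth Z)).eval (Z i)| / (nod (i.removeNth Z)).eval (Z i) := by
      rw [sg, div_eq_div_iff (abs_ne_zero.2 hq) hq, abs_mul_abs_self]
    rw [ker1, npv_removeNth 1 Z i, psum_removeNth, pow_one, hs]
    field_simp
    ring
  · rw [npv_eq_zero_of_not_injective one_ne_zero hZ, zero_mul]
    refine sum_eq_zero fun i _ => ?_
    rw [ker1]
    rcases npv_removeNth_mul_eq_zero one_ne_zero hZ i with h | h <;> rw [h]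
    · ring
    · rw [sg_zero]; ring

lemma sum_ker1_removeNth (Z : Fin (m + 1) → ℝ) (Y : Fin c → ℝ) :
    ∑ i, ker1 (i.removeNth Z) (Z i) Y = npv 1 Z * npv 1 Y * ((psum 3 Z - psum 3 Y) / 2) *
      ∑ i, sg ((nod (i.removeNth Z)).eval (Z i)) * sg ((nod Y).eval (Z i)) := by
  rw [mul_sum]
  refine sum_congr rfl fun i _ => ?_
  rw [ker1, npv_removeNth 1 Z i, psum_removeNth, pow_one]
  nth_rewrite 1 [← abs_mul_sg ((nod (i.removeNth Z)).eval (Z i))]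
  ring

/-- Alternating sign sums over point configurations without triple points. -/
lemma sum_prod_sg {ι : Type*} [DecidableEq ι] (W : ι → ℝ) (s : Finset ι)
    (hW : ∀ i ∈ s, ∀ j ∈ s, ∀ k ∈ s, W i = W j → W i = W k → i = j ∨ i = k ∨ j = k) :
    ∑ x ∈ s, ∏ y ∈ s.erase x, sg (W x - W y) = if Even s.card then 0 else 1 := by
  induction h : s.card using Nat.strong_induction_on generalizing s with
  | _ N ih =>
  rcases s.eq_empty_or_nonempty with rfl | hs
  · simp at h; simp [← h]
  obtain ⟨x, hx, hmax⟩ := exists_max_image s W hs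
  have hc : (s.erase x).card = N - 1 := by rw [card_erase_of_mem hx, h]
  have hN : 0 < N := h ▸ card_pos.2 hs
  by_cases hd : ∃ y ∈ s.erase x, W y = W x
  · obtain ⟨y, hy, hyx⟩ := hd
    have hyx' := ne_of_mem_erase hy
    have hc2 : ((s.erase x).erase y).card = N - 2 := by rw [card_erase_of_mem hy, hc]; omega
    have hN2 : 2 ≤ N := by have := card_pos.2 ⟨y, hy⟩; omega
    have hi := ih (N - 2) (by omega) ((s.erase x).erase y)
      (fun i hi j hj k hk => hW i (mem_of_mem_erase (mem_of_mem_erase hi)) j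
        (mem_of_mem_erase (mem_of_mem_erase hj)) k (mem_of_mem_erase (mem_of_mem_erase hk))) hc2
    have hpar : Even N ↔ Even (N - 2) := by
      rw [Nat.even_sub hN2]; simp
    rw [if_congr hpar rfl rfl, ← hi, ← sum_erase_add _ _ hx, ← sum_erase_add _ _ hy]
    rw [prod_eq_zero (i := y) hy (by simp [hyx]),
      prod_eq_zero (i := x) (mem_erase.2 ⟨hyx'.symm, hx⟩) (by simp [hyx]), add_zero, add_zero]
    refine sum_congr rfl fun k hk => ?_
    have hky := ne_of_mem_erase hk
    have hkx := ne_of_mem_erase (mem_of_mem_erase hk)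
    have hks := mem_of_mem_erase (mem_of_mem_erase hk)
    have hne : W k ≠ W x := fun he => by
      rcases hW x hx y (mem_of_mem_erase hy) k hks hyx.symm he.symm with h | h | h
      · exact hyx' h.symm
      · exact hkx h.symm
      · exact hky h.symm
    rw [← mul_prod_erase (s.erase k) _ (mem_erase.2 ⟨hkx.symm, hx⟩),
      ← mul_prod_erase ((s.erase k).erase x) _
        (mem_erase.2 ⟨hyx', mem_erase.2 ⟨hky.symm, mem_of_mem_erase hy⟩⟩), ← mul_assoc, hyx,
      sg_mul_self (sub_ne_zero.2 hne), one_mul]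
    congr 1
    ext l
    simp only [mem_erase]
    tauto
  · push Not at hd
    have hi := ih (N - 1) (by omega) (s.erase x)
      (fun i hi j hj k hk => hW i (mem_of_mem_erase hi) j
        (mem_of_mem_erase hj) k (mem_of_mem_erase hk)) hc
    have hlt : ∀ y ∈ s.erase x, W y < W x := fun y hy =>
      lt_of_le_of_ne (hmax y (mem_of_mem_erase hy)) (hd y hy)
    have h1 : ∏ y ∈ s.erase x, sg (W x - W y) = 1 :=
      prod_eq_one fun y hy => sg_of_pos (sub_pos.2 (hlt y hy))
    have h2 : ∑ k ∈ s.erase x, ∏ y ∈ s.erase k, sg (W k - W y) =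
        -∑ k ∈ s.erase x, ∏ y ∈ (s.erase x).erase k, sg (W k - W y) := by
      rw [← sum_neg_distrib]
      refine sum_congr rfl fun k hk => ?_
      rw [← mul_prod_erase (s.erase k) _ (mem_erase.2 ⟨(ne_of_mem_erase hk).symm, hx⟩),
        sg_of_neg (sub_neg.2 (hlt k hk)), erase_right_comm]
      ring
    rw [← sum_erase_add _ _ hx, h1, h2, hi]
    obtain ⟨M, rfl⟩ := Nat.exists_eq_succ_of_ne_zero hN.ne'
    rw [Nat.succ_sub_one, Nat.succ_eq_add_one]
    by_cases hM : Even M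
    · simp [hM, Nat.even_add_one]
    · simp [hM, Nat.even_add_one]

lemma sum_sg_nod {Z : Fin (a + 1) → ℝ} {Y : Fin (c + 1) → ℝ} (hZ : Function.Injective Z)
    (hY : Function.Injective Y) (hac : Even (a + c)) :
    ∑ i, sg ((nod (i.removeNth Z)).eval (Z i)) * sg ((nod Y).eval (Z i)) =
      -∑ i, sg ((nod (i.removeNth Y)).eval (Y i)) * sg ((nod Z).eval (Y i)) := by
  have h := sum_prod_sg (Sum.elim Z Y) univ (fun i _ j _ k _ hij hik => by
    rcases i with i | i <;> rcases j with j | j <;> rcases k with k | k <;>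
      simp only [Sum.elim_inl, Sum.elim_inr] at hij hik <;>
      first
        | (left; rw [hZ hij]) | (left; rw [hY hij]) | (right; left; rw [hZ hik])
        | (right; left; rw [hY hik])
        | (right; right; rw [hZ (hij.symm.trans hik)])
        | (right; right; rw [hY (hij.symm.trans hik)]))
  rw [if_pos (by
    rw [card_univ, Fintype.card_sum, Fintype.card_fin, Fintype.card_fin]
    have : a + 1 + (c + 1) = a + c + 2 := by ring
    rw [this]; exact hac.add (by decide))] at h
  have e : ∀ x : Fin (a + 1) ⊕ Fin (c + 1), ∏ y ∈ univ.erase x,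
      sg (Sum.elim Z Y x - Sum.elim Z Y y) =
      ∏ y, if y = x then 1 else sg (Sum.elim Z Y x - Sum.elim Z Y y) := by
    intro x
    rw [← mul_prod_erase univ _ (mem_univ x), if_pos rfl, one_mul]
    exact prod_congr rfl fun y hy => by rw [if_neg (ne_of_mem_erase hy)]
  rw [sum_congr rfl fun x _ => e x, Fintype.sum_sum_type] at h
  rw [eq_neg_iff_add_eq_zero, ← h]
  congr 1
  · refine sum_congr rfl fun i _ => ?_
    rw [Fintype.prod_sum_type, eval_nod, eval_nod, sg_prod, sg_prod, Fin.prod_univ_succAbove _ i]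
    simp [Fin.succAbove_ne, Fin.removeNth]
  · refine sum_congr rfl fun i _ => ?_
    rw [Fintype.prod_sum_type, eval_nod, eval_nod, sg_prod, sg_prod,
      Fin.prod_univ_succAbove (fun j => if Sum.inr j = _ then _ else _) i, mul_comm]
    simp [Fin.succAbove_ne, Fin.removeNth]

lemma sum_ker1_exchange (Z : Fin (a + 1) → ℝ) (Y : Fin (c + 1) → ℝ) (hac : Even (a + c)) :
    ∑ i, ker1 (i.removeNth Z) (Z i) Y = ∑ i, ker1 (i.removeNth Y) (Y i) Z := by
  rw [sum_ker1_removeNth, sum_ker1_removeNth]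
  by_cases hZ : Function.Injective Z
  · by_cases hY : Function.Injective Y
    · rw [sum_sg_nod hZ hY hac]; ring
    · simp [npv_eq_zero_of_not_injective one_ne_zero hY]
  · simp [npv_eq_zero_of_not_injective one_ne_zero hZ]

end Kernels

section Moments

variable {α β : Type*} [MeasurableSpace α] [MeasurableSpace β] {μ : Measure α} {f g : α → ℝ}

/-- All absolute moments of `f` are finite. -/
def AllMoments (f : α → ℝ) (μ : Measure α) : Prop := ∀ p : ENNReal, p ≠ ⊤ → MemLp f p μ

namespace AllMoments

lemma integrable (hf : AllMoments f μ) : Integrable f μ :=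
  memLp_one_iff_integrable.1 (hf 1 ENNReal.one_ne_top)

lemma add (hf : AllMoments f μ) (hg : AllMoments g μ) : AllMoments (fun x => f x + g x) μ :=
  fun p hp => (hf p hp).add (hg p hp)

lemma sub (hf : AllMoments f μ) (hg : AllMoments g μ) : AllMoments (fun x => f x - g x) μ :=
  fun p hp => (hf p hp).sub (hg p hp)

lemma abs (hf : AllMoments f μ) : AllMoments (fun x => |f x|) μ :=
  fun p hp => (hf p hp).norm

lemma mul (hf : AllMoments f μ) (hg : AllMoments g μ) : AllMoments (fun x => f x * g x) μ := by
  intro p hp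
  have h2 : 2 * p ≠ ⊤ := ENNReal.mul_ne_top (by norm_num) hp
  have : ENNReal.HolderTriple (2 * p) (2 * p) p := ⟨by
    rw [ENNReal.mul_inv (by simp) (by simp), ← add_mul, ENNReal.inv_two_add_inv_two, one_mul]⟩
  exact (hg _ h2).mul (hf _ h2)

lemma const [IsFiniteMeasure μ] (c : ℝ) : AllMoments (fun _ : α => c) μ :=
  fun _ _ => memLp_const c

lemma const_mul (hf : AllMoments f μ) (c : ℝ) : AllMoments (fun x => c * f x) μ :=
  fun p hp => (hf p hp).const_mul c

lemma div_const (hf : AllMoments f μ) (c : ℝ) : AllMoments (fun x => f x / c) μ := by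
  simp only [div_eq_inv_mul]
  exact hf.const_mul _

lemma pow [IsFiniteMeasure μ] (hf : AllMoments f μ) (k : ℕ) : AllMoments (fun x => f x ^ k) μ := by
  induction k with
  | zero => simpa using const 1
  | succ k ih => simpa only [pow_succ] using ih.mul hf

lemma sum {ι : Type*} (s : Finset ι) {F : ι → α → ℝ} (hF : ∀ i ∈ s, AllMoments (F i) μ) :
    AllMoments (fun x => ∑ i ∈ s, F i x) μ :=
  fun p hp => memLp_finsetSum s fun i hi => hF i hi p hp

lemma prod [IsFiniteMeasure μ] {ι : Type*} (s : Finset ι) {F : ι → α → ℝ}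
    (hF : ∀ i ∈ s, AllMoments (F i) μ) : AllMoments (fun x => ∏ i ∈ s, F i x) μ := by
  classical
  induction s using Finset.induction_on with
  | empty => simpa using const 1
  | insert i s hi ih =>
    simp only [prod_insert hi]
    exact (hF i (mem_insert_self i s)).mul (ih fun j hj => hF j (mem_insert_of_mem hj))

lemma sg [IsFiniteMeasure μ] (hf : AllMoments f μ) : AllMoments (fun x => sg (f x)) μ := by
  have hm : AEMeasurable f μ := (hf 1 ENNReal.one_ne_top).aestronglyMeasurable.aemeasurable
  refine fun p _ => MemLp.of_bound (hm.div hm.abs).aestronglyMeasurable 1 (.of_forall fun x => ?_)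
  change ‖f x / |f x|‖ ≤ 1
  rw [norm_div, Real.norm_eq_abs, Real.norm_eq_abs, abs_abs]
  exact div_self_le_one _

lemma comp_fst {ν : Measure β} [IsFiniteMeasure ν] (hf : AllMoments f μ) :
    AllMoments (fun x : α × β => f x.1) (μ.prod ν) :=
  fun p hp => (hf p hp).comp_fst ν

lemma comp_snd [SFinite μ] {ν : Measure β} [IsFiniteMeasure ν] (hf : AllMoments f μ) :
    AllMoments (fun x : β × α => f x.2) (ν.prod μ) :=
  fun p hp => (hf p hp).comp_snd ν

end AllMoments

end Moments

section Configurations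

open Polynomial

variable {α : Type*} [MeasurableSpace α] {μ : Measure α} [IsFiniteMeasure μ] {a c : ℕ}
  {X : α → Fin a → ℝ} {Y : α → Fin c → ℝ} {y : α → ℝ}

lemma AllMoments.psum (hX : ∀ i, AllMoments (fun w => X w i) μ) (k : ℕ) :
    AllMoments (fun w => psum k (X w)) μ :=
  AllMoments.sum _ fun i _ => (hX i).pow k

lemma AllMoments.npv (hX : ∀ i, AllMoments (fun w => X w i) μ) (p : ℕ) :
    AllMoments (fun w => npv p (X w)) μ :=
  AllMoments.prod _ fun i _ => AllMoments.prod _ fun j _ => ((hX j).sub (hX i)).abs.pow p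

lemma AllMoments.eval_nod (hX : ∀ i, AllMoments (fun w => X w i) μ) (hy : AllMoments y μ) :
    AllMoments (fun w => (nod (X w)).eval (y w)) μ := by
  simp only [WignerDelay.eval_nod]
  exact AllMoments.prod _ fun i _ => hy.sub (hX i)

lemma AllMoments.eval_derivative_nod (hX : ∀ i, AllMoments (fun w => X w i) μ)
    (hy : AllMoments y μ) : AllMoments (fun w => (derivative (nod (X w))).eval (y w)) μ := by
  classical
  simp only [nod, derivative_prod_finset, eval_finsetSum, eval_mul, eval_prod]
  refine AllMoments.sum _ fun i _ => (AllMoments.prod _ fun j _ => ?_).mul ?_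
  · simpa using hy.sub (hX j)
  · simpa using AllMoments.const 1

lemma AllMoments.dres (hX : ∀ i, AllMoments (fun w => X w i) μ)
    (hY : ∀ i, AllMoments (fun w => Y w i) μ) (hy : AllMoments y μ) :
    AllMoments (fun w => dres (nod (X w)) (nod (Y w)) (y w)) μ :=
  ((((eval_nod hX hy).const_mul 2).mul (eval_derivative_nod hX hy)).mul
    ((eval_nod hY hy).pow 2)).sub
    (((((eval_nod hX hy).pow 2).const_mul 2).mul (eval_nod hY hy)).mul (eval_derivative_nod hY hy))

lemma AllMoments.ker2 (hX : ∀ i, AllMoments (fun w => X w i) μ)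
    (hY : ∀ i, AllMoments (fun w => Y w i) μ) (hy : AllMoments y μ) :
    AllMoments (fun w => ker2 (X w) (y w) (Y w)) μ :=
  ((npv hX 2).mul (npv hY 2)).mul (((eval_nod hX hy).mul (eval_nod hY hy)).mul
    ((((hy.pow 3).add (psum hX 3)).sub (psum hY 3)).div_const 2))

lemma AllMoments.ker1 (hX : ∀ i, AllMoments (fun w => X w i) μ)
    (hY : ∀ i, AllMoments (fun w => Y w i) μ) (hy : AllMoments y μ) :
    AllMoments (fun w => ker1 (X w) (y w) (Y w)) μ :=
  ((npv hX 1).mul (npv hY 1)).mul (((eval_nod hX hy).mul (eval_nod hY hy).sg).mul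
    ((((hy.pow 3).add (psum hX 3)).sub (psum hY 3)).div_const 2))

lemma AllMoments.ker4 (hX : ∀ i, AllMoments (fun w => X w i) μ)
    (hY : ∀ i, AllMoments (fun w => Y w i) μ) (hy : AllMoments y μ) :
    AllMoments (fun w => ker4 (X w) (y w) (Y w)) μ :=
  ((npv hX 4).mul (npv hY 4)).mul (((((hy.pow 2).const_mul 3).mul ((eval_nod hX hy).pow 2)).mul
    ((eval_nod hY hy).pow 2)).add ((dres hX hY hy).mul ((psum hX 3).sub (psum hY 3))))

end Configurations

section Transfer

variable {α : Type*} [MeasurableSpace α] {ρ : Measure α} [IsFiniteMeasure ρ]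
  {ν : Measure ℝ} [IsFiniteMeasure ν] {a c : ℕ}

/-- The product of `a` copies of `ν`. -/
noncomputable abbrev powMeasure (ν : Measure ℝ) (a : ℕ) : Measure (Fin a → ℝ) :=
  Measure.pi fun _ => ν

lemma allMoments_eval (hν : AllMoments (fun x => x) ν) (i : Fin a) :
    AllMoments (fun X : Fin a → ℝ => X i) (powMeasure ν a) := by
  classical
  intro p hp
  have h : MemLp (fun x => x) p ((powMeasure ν a).map (Function.eval i)) := by
    rw [Measure.pi_map_eval]
    exact (hν p hp).smul_measure (ENNReal.prod_ne_top fun j _ => measure_ne_top _ _)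
  exact (memLp_map_measure_iff h.1 (measurable_pi_apply i).aemeasurable).1 h

/-- Integrating a sum over the choice of a distinguished particle. -/
lemma integral_sum_removeNth {F : α → ℝ → (Fin c → ℝ) → ℝ}
    (hF : Integrable (fun w : α × ℝ × (Fin c → ℝ) => F w.1 w.2.1 w.2.2)
      (ρ.prod (ν.prod (powMeasure ν c)))) :
    ∫ w, ∑ i, F w.1 (w.2 i) (i.removeNth w.2) ∂ρ.prod (powMeasure ν (c + 1)) =
      (c + 1) * ∫ w, F w.1 w.2.1 w.2.2 ∂ρ.prod (ν.prod (powMeasure ν c)) := by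
  have hmp : ∀ i : Fin (c + 1), MeasurePreserving
      (MeasurableEquiv.prodCongr (MeasurableEquiv.refl α)
        (MeasurableEquiv.piFinSuccAbove (fun _ => ℝ) i))
      (ρ.prod (powMeasure ν (c + 1))) (ρ.prod (ν.prod (powMeasure ν c))) := fun i =>
    (MeasurePreserving.id ρ).prod (measurePreserving_piFinSuccAbove (fun _ => ν) i)
  rw [integral_finsetSum]
  · refine (Finset.sum_congr rfl fun i _ => (hmp i).integral_comp'
      (fun w : α × ℝ × (Fin c → ℝ) => F w.1 w.2.1 w.2.2)).trans ?_
    simp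
  · intro i _
    exact (hmp i).integrable_comp_of_integrable hF

/-- Exchanging the two configurations in an integrated kernel. -/
lemma integral_exchange (F : (Fin a → ℝ) → ℝ → (Fin c → ℝ) → ℝ) :
    ∫ w, F w.2.2 w.2.1 w.1 ∂(powMeasure ν c).prod (ν.prod (powMeasure ν a)) =
      ∫ w, F w.1 w.2.1 w.2.2 ∂(powMeasure ν a).prod (ν.prod (powMeasure ν c)) := by
  have h1 : MeasurePreserving MeasurableEquiv.prodComm
      ((powMeasure ν c).prod (ν.prod (powMeasure ν a)))
      ((ν.prod (powMeasure ν a)).prod (powMeasure ν c)) := Measure.measurePreserving_swap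
  have h2 : MeasurePreserving (MeasurableEquiv.prodCongr MeasurableEquiv.prodComm
        (MeasurableEquiv.refl (Fin c → ℝ)))
      ((ν.prod (powMeasure ν a)).prod (powMeasure ν c))
      (((powMeasure ν a).prod ν).prod (powMeasure ν c)) :=
    Measure.measurePreserving_swap.prod (MeasurePreserving.id _)
  have h3 := measurePreserving_prodAssoc (powMeasure ν a) ν (powMeasure ν c)
  rw [← ((h1.trans h2).trans h3).integral_comp']
  rfl

end Transfer

section Hirota

variable {ν : Measure ℝ} [IsFiniteMeasure ν] {a c m : ℕ}

/-- Integral of `f` against the interaction factor. -/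
noncomputable def mom (ν : Measure ℝ) (p a : ℕ) (f : (Fin a → ℝ) → ℝ) : ℝ :=
  ∫ X, npv p X * f X ∂powMeasure ν a

lemma allMoments_fst (hν : AllMoments (fun x => x) ν) {β : Type*} [MeasurableSpace β]
    (ρ : Measure β) [IsFiniteMeasure ρ] (i : Fin a) :
    AllMoments (fun w : (Fin a → ℝ) × β => w.1 i) ((powMeasure ν a).prod ρ) :=
  AllMoments.comp_fst (f := fun X : Fin a → ℝ => X i) (allMoments_eval hν i)

lemma allMoments_snd (hν : AllMoments (fun x => x) ν) {β : Type*} [MeasurableSpace β]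
    (ρ : Measure β) [IsFiniteMeasure ρ] (i : Fin a) :
    AllMoments (fun w : β × (Fin a → ℝ) => w.2 i) (ρ.prod (powMeasure ν a)) :=
  AllMoments.comp_snd (f := fun X : Fin a → ℝ => X i) (allMoments_eval hν i)

lemma allMoments_snd_fst (hν : AllMoments (fun x => x) ν) {β : Type*} [MeasurableSpace β]
    (ρ : Measure β) [IsFiniteMeasure ρ] :
    AllMoments (fun w : β × ℝ × (Fin c → ℝ) => w.2.1) (ρ.prod (ν.prod (powMeasure ν c))) :=
  AllMoments.comp_snd (f := fun x : ℝ × (Fin c → ℝ) => x.1)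
    (AllMoments.comp_fst (f := fun x : ℝ => x) hν)

lemma allMoments_snd_snd (hν : AllMoments (fun x => x) ν) {β : Type*} [MeasurableSpace β]
    (ρ : Measure β) [IsFiniteMeasure ρ] (i : Fin c) :
    AllMoments (fun w : β × ℝ × (Fin c → ℝ) => w.2.2 i) (ρ.prod (ν.prod (powMeasure ν c))) :=
  AllMoments.comp_snd (f := fun x : ℝ × (Fin c → ℝ) => x.2 i) (allMoments_snd hν ν i)

lemma integrable_ker2 (hν : AllMoments (fun x => x) ν) (a c : ℕ) :
    Integrable (fun w : (Fin a → ℝ) × ℝ × (Fin c → ℝ) => ker2 w.1 w.2.1 w.2.2)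
      ((powMeasure ν a).prod (ν.prod (powMeasure ν c))) ∧
    Integrable (fun w : (Fin a → ℝ) × ℝ × (Fin c → ℝ) => ker2 w.2.2 w.2.1 w.1)
      ((powMeasure ν a).prod (ν.prod (powMeasure ν c))) := by
  have hX := fun i => allMoments_fst (a := a) hν (ν.prod (powMeasure ν c)) i
  have hy := allMoments_snd_fst (c := c) hν (powMeasure ν a)
  have hY := fun i => allMoments_snd_snd (c := c) hν (powMeasure ν a) i
  exact ⟨(AllMoments.ker2 hX hY hy).integrable, (AllMoments.ker2 hY hX hy).integrable⟩

lemma integrable_ker4 (hν : AllMoments (fun x => x) ν) (a c : ℕ) :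
    Integrable (fun w : (Fin a → ℝ) × ℝ × (Fin c → ℝ) => ker4 w.1 w.2.1 w.2.2)
      ((powMeasure ν a).prod (ν.prod (powMeasure ν c))) ∧
    Integrable (fun w : (Fin a → ℝ) × ℝ × (Fin c → ℝ) => ker4 w.2.2 w.2.1 w.1)
      ((powMeasure ν a).prod (ν.prod (powMeasure ν c))) := by
  have hX := fun i => allMoments_fst (a := a) hν (ν.prod (powMeasure ν c)) i
  have hy := allMoments_snd_fst (c := c) hν (powMeasure ν a)
  have hY := fun i => allMoments_snd_snd (c := c) hν (powMeasure ν a) i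
  exact ⟨(AllMoments.ker4 hX hY hy).integrable, (AllMoments.ker4 hY hX hy).integrable⟩

lemma integrable_ker1 (hν : AllMoments (fun x => x) ν) (a c : ℕ) :
    Integrable (fun w : (Fin a → ℝ) × ℝ × (Fin c → ℝ) => ker1 w.1 w.2.1 w.2.2)
      ((powMeasure ν a).prod (ν.prod (powMeasure ν c))) ∧
    Integrable (fun w : (Fin a → ℝ) × ℝ × (Fin c → ℝ) => ker1 w.2.2 w.2.1 w.1)
      ((powMeasure ν a).prod (ν.prod (powMeasure ν c))) := by
  have hX := fun i => allMoments_fst (a := a) hν (ν.prod (powMeasure ν c)) i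
  have hy := allMoments_snd_fst (c := c) hν (powMeasure ν a)
  have hY := fun i => allMoments_snd_snd (c := c) hν (powMeasure ν a) i
  exact ⟨(AllMoments.ker1 hX hY hy).integrable, (AllMoments.ker1 hY hX hy).integrable⟩

lemma integral_npv_mul_npv (p : ℕ) :
    ∫ w, npv p w.2 * npv p w.1 ∂(powMeasure ν a).prod (powMeasure ν c) =
      mom ν p a (fun _ => 1) * mom ν p c (fun _ => 1) := by
  simp only [mom, mul_one]
  rw [← integral_prod_mul]
  simp only [mul_comm]

lemma integral_hir_two (hν : AllMoments (fun x => x) ν) :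
    ∫ w, hir 2 w.1 w.2 ∂(powMeasure ν (m + 1)).prod (powMeasure ν (m + 1)) = 0 := by
  have h1 := integral_sum_removeNth (F := fun X y Y => ker2 X y Y)
    (integrable_ker2 hν (m + 1) m).1
  have h2 := integral_sum_removeNth (F := fun X y Y => ker2 Y y X)
    (integrable_ker2 hν m (m + 1)).2
  simp only [sum_ker2_eq_zero, integral_zero] at h2
  simp only [← hir_two_eq_sum_ker2] at h1
  rw [integral_exchange (ν := ν) fun X y Y => ker2 X y Y] at h2
  have h3 : ((m + 1 : ℕ) : ℝ) + 1 ≠ 0 := by positivity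
  rw [h1, (mul_eq_zero.1 h2.symm).resolve_left h3, mul_zero]

lemma integral_hir4 (hν : AllMoments (fun x => x) ν) :
    (m + 2) * ∫ w, hir4 w.1 w.2 ∂(powMeasure ν (m + 1)).prod (powMeasure ν (m + 1)) =
      (m + 1) * (mom ν 4 m (fun _ => 1) * mom ν 4 (m + 2) fun _ => 1) := by
  have h1 := integral_sum_removeNth (F := fun X y Y => ker4 X y Y)
    (integrable_ker4 hν (m + 1) m).1
  have h2 := integral_sum_removeNth (F := fun X y Y => ker4 Y y X)
    (integrable_ker4 hν m (m + 1)).2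
  simp only [sum_ker4_eq_mul] at h2
  simp only [← hir4_eq_sum_ker4] at h1
  rw [integral_exchange (ν := ν) fun X y Y => ker4 X y Y, integral_npv_mul_npv] at h2
  rw [h1, h2]
  push_cast
  ring

lemma integral_hir_one (hν : AllMoments (fun x => x) ν) :
    (m + 3) * (m + 4) * ∫ w, hir 1 w.1 w.2 ∂(powMeasure ν (m + 2)).prod (powMeasure ν (m + 2)) =
      (m + 1) * (m + 2) * (mom ν 1 m (fun _ => 1) * mom ν 1 (m + 4) fun _ => 1) := by
  have h1 := integral_sum_removeNth (F := fun X y Y => ker1 X y Y)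
    (integrable_ker1 hν (m + 2) (m + 1)).1
  have h2 := integral_sum_removeNth (F := fun X y Y => ker1 Y y X)
    (integrable_ker1 hν (m + 1) (m + 2)).2
  have h3 := integral_sum_removeNth (F := fun X y Y => ker1 Y y X)
    (integrable_ker1 hν (m + 3) m).2
  have h4 := integral_sum_removeNth (F := fun X y Y => ker1 X y Y)
    (integrable_ker1 hν m (m + 3)).1
  simp only [← hir_one_eq_sum_ker1] at h1
  simp only [sum_ker1_eq_mul] at h4
  rw [integral_exchange (ν := ν) fun X y Y => ker1 X y Y] at h2 h3
  rw [integral_npv_mul_npv] at h4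
  have h5 : ∫ w, ∑ i, ker1 (i.removeNth w.2) (w.2 i) w.1
        ∂(powMeasure ν (m + 1)).prod (powMeasure ν (m + 2 + 1)) =
      ∫ w, ∑ i, ker1 (i.removeNth w.2) (w.2 i) w.1
        ∂(powMeasure ν (m + 3)).prod (powMeasure ν (m + 1)) := by
    rw [← integral_prod_swap]
    refine integral_congr_ae (.of_forall fun w => ?_)
    exact sum_ker1_exchange w.1 w.2 ⟨m + 1, by ring⟩
  rw [h5, h3] at h2
  rw [h1, h4]
  push_cast at h2 ⊢
  linear_combination (-(m + 2 : ℝ) * (m + 4)) * h2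

/-- Existence and value of an integral. -/
def HasInt {α : Type*} [MeasurableSpace α] (μ : Measure α) (f : α → ℝ) (v : ℝ) : Prop :=
  Integrable f μ ∧ ∫ x, f x ∂μ = v

namespace HasInt

variable {α : Type*} [MeasurableSpace α] {μ : Measure α} {f g : α → ℝ} {u v : ℝ}

lemma add (hf : HasInt μ f u) (hg : HasInt μ g v) : HasInt μ (fun x => f x + g x) (u + v) :=
  ⟨hf.1.add hg.1, by rw [integral_add hf.1 hg.1, hf.2, hg.2]⟩

lemma sub (hf : HasInt μ f u) (hg : HasInt μ g v) : HasInt μ (fun x => f x - g x) (u - v) :=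
  ⟨hf.1.sub hg.1, by rw [integral_sub hf.1 hg.1, hf.2, hg.2]⟩

lemma const_mul (r : ℝ) (hf : HasInt μ f u) : HasInt μ (fun x => r * f x) (r * u) :=
  ⟨hf.1.const_mul r, by rw [integral_const_mul, hf.2]⟩

end HasInt

/-- The three bilinear moment combinations of the Hirota-type identity. -/
lemma hasInt_bilinear (hν : AllMoments (fun x => x) ν) (p a : ℕ) :
    let M := mom ν p a
    HasInt ((powMeasure ν a).prod (powMeasure ν a))
      (fun w => npv p w.1 * npv p w.2 * dps 1 w.1 w.2 ^ 4)
      (2 * M (fun _ => 1) * M (fun X => psum 1 X ^ 4) - 8 * M (psum 1) * M (fun X => psum 1 X ^ 3) +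
        6 * M (fun X => psum 1 X ^ 2) ^ 2) ∧
    HasInt ((powMeasure ν a).prod (powMeasure ν a))
      (fun w => npv p w.1 * npv p w.2 * dps 2 w.1 w.2 ^ 2)
      (2 * M (fun _ => 1) * M (fun X => psum 2 X ^ 2) - 2 * M (psum 2) ^ 2) ∧
    HasInt ((powMeasure ν a).prod (powMeasure ν a))
      (fun w => npv p w.1 * npv p w.2 * (dps 1 w.1 w.2 * dps 3 w.1 w.2))
      (2 * M (fun _ => 1) * M (fun X => psum 1 X * psum 3 X) - 2 * M (psum 1) * M (psum 3)) := by
  intro M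
  have hX := fun i : Fin a => allMoments_eval hν i
  have hp := fun k => AllMoments.psum hX k
  have hV := AllMoments.npv hX p
  have key : ∀ f g : (Fin a → ℝ) → ℝ, AllMoments f (powMeasure ν a) →
      AllMoments g (powMeasure ν a) → HasInt ((powMeasure ν a).prod (powMeasure ν a))
        (fun w => (npv p w.1 * f w.1) * (npv p w.2 * g w.2)) (M f * M g) := fun f g hf hg =>
    ⟨Integrable.mul_prod (hV.mul hf).integrable (hV.mul hg).integrable,
      integral_prod_mul (fun X => npv p X * f X) (fun X => npv p X * g X)⟩
  have c1 : AllMoments (fun _ => 1) (powMeasure ν a) := AllMoments.const 1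
  refine ⟨?_, ?_, ?_⟩
  · have h := ((((key _ _ c1 ((hp 1).pow 4)).add (key _ _ ((hp 1).pow 4) c1)).sub
      (((key _ _ (hp 1) ((hp 1).pow 3)).add (key _ _ ((hp 1).pow 3) (hp 1))).const_mul 4)).add
      ((key _ _ ((hp 1).pow 2) ((hp 1).pow 2)).const_mul 6))
    convert h using 1
    · ext w; simp only [dps]; ring
    · ring
  · have h := (((key _ _ c1 ((hp 2).pow 2)).add (key _ _ ((hp 2).pow 2) c1)).sub
      ((key _ _ (hp 2) (hp 2)).const_mul 2))
    convert h using 1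
    · ext w; simp only [dps]; ring
    · ring
  · have h := (((key _ _ c1 ((hp 1).mul (hp 3))).add (key _ _ ((hp 1).mul (hp 3)) c1)).sub
      ((key _ _ (hp 1) (hp 3)).add (key _ _ (hp 3) (hp 1))))
    convert h using 1
    · ext w; simp only [dps]; ring
    · ring

lemma integral_symmetrize {ρ : Measure (Fin a → ℝ)} [IsFiniteMeasure ρ]
    {F : (Fin a → ℝ) → (Fin a → ℝ) → ℝ} {v : ℝ} (hF : Integrable (fun w => F w.1 w.2) (ρ.prod ρ))
    (h : HasInt (ρ.prod ρ) (fun w => (F w.1 w.2 + F w.2 w.1) / 2) v) :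
    ∫ w, F w.1 w.2 ∂ρ.prod ρ = v := by
  have h1 : ∫ w, F w.2 w.1 ∂ρ.prod ρ = ∫ w, F w.1 w.2 ∂ρ.prod ρ :=
    integral_prod_swap (fun w : (Fin a → ℝ) × (Fin a → ℝ) => F w.1 w.2)
  rw [← h.2, integral_div, integral_add hF
    (show Integrable (fun w => F w.2 w.1) (ρ.prod ρ) from hF.swap), h1]
  ring

lemma allMoments_dps (hν : AllMoments (fun x => x) ν) (k : ℕ) :
    AllMoments (fun w => dps k w.1 w.2) ((powMeasure ν a).prod (powMeasure ν a)) :=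
  (AllMoments.psum (allMoments_snd hν _) k).sub (AllMoments.psum (allMoments_fst hν _) k)

lemma allMoments_chp (hν : AllMoments (fun x => x) ν) (r : ℝ) :
    AllMoments (fun w => chp (r * dps 1 w.1 w.2) (r * dps 2 w.1 w.2) (r * dps 3 w.1 w.2)
      (r * dps 4 w.1 w.2)) ((powMeasure ν a).prod (powMeasure ν a)) := by
  have h := fun k => (allMoments_dps (a := a) hν k).const_mul r
  exact ((((((h 1).pow 4).add ((((h 1).pow 2).const_mul 6).mul (h 2))).add
    (((h 2).pow 2).const_mul 3)).add (((h 1).const_mul 8).mul (h 3))).add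
      ((h 4).const_mul 6)).div_const 24

lemma integral_hir_eq (hν : AllMoments (fun x => x) ν) (p a : ℕ) :
    12 * ∫ w, hir p w.1 w.2 ∂(powMeasure ν a).prod (powMeasure ν a) =
      (mom ν p a (fun _ => 1) * mom ν p a (fun X => psum 1 X ^ 4) -
        4 * mom ν p a (psum 1) * mom ν p a (fun X => psum 1 X ^ 3) +
        3 * mom ν p a (fun X => psum 1 X ^ 2) ^ 2) -
      4 * (mom ν p a (fun _ => 1) * mom ν p a (fun X => psum 1 X * psum 3 X) -
        mom ν p a (psum 1) * mom ν p a (psum 3)) +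
      3 * (mom ν p a (fun _ => 1) * mom ν p a (fun X => psum 2 X ^ 2) -
        mom ν p a (psum 2) ^ 2) := by
  obtain ⟨h1, h2, h3⟩ := hasInt_bilinear hν p a
  rw [integral_symmetrize (F := hir p) ?_]
  rotate_left
  · have h := ((h1.add (h2.const_mul 3)).sub (h3.const_mul 4)).const_mul (1 / 24)
    convert h using 1
    ext w
    simp only [hir, chp, dps]
    ring
  · have hc := allMoments_chp (a := a) hν 1
    simp only [one_mul] at hc
    exact (((AllMoments.npv (allMoments_fst hν _) p).mul (AllMoments.npv (allMoments_snd hν _) p)).mul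
      (hc.sub (((allMoments_dps hν 1).mul (allMoments_dps hν 3)).div_const 2))).integrable
  · ring

lemma integral_hir4_eq (hν : AllMoments (fun x => x) ν) (a : ℕ) :
    3 * ∫ w, hir4 w.1 w.2 ∂(powMeasure ν a).prod (powMeasure ν a) =
      4 * (mom ν 4 a (fun _ => 1) * mom ν 4 a (fun X => psum 1 X ^ 4) -
        4 * mom ν 4 a (psum 1) * mom ν 4 a (fun X => psum 1 X ^ 3) +
        3 * mom ν 4 a (fun X => psum 1 X ^ 2) ^ 2) -
      4 * (mom ν 4 a (fun _ => 1) * mom ν 4 a (fun X => psum 1 X * psum 3 X) -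
        mom ν 4 a (psum 1) * mom ν 4 a (psum 3)) +
      3 * (mom ν 4 a (fun _ => 1) * mom ν 4 a (fun X => psum 2 X ^ 2) -
        mom ν 4 a (psum 2) ^ 2) := by
  obtain ⟨h1, h2, h3⟩ := hasInt_bilinear hν 4 a
  rw [integral_symmetrize (F := hir4) ?_]
  rotate_left
  · have h := (((h1.const_mul 4).add (h2.const_mul 3)).sub (h3.const_mul 4)).const_mul (1 / 6)
    convert h using 1
    ext w
    simp only [hir4, chp, dps]
    ring
  · exact (((AllMoments.npv (allMoments_fst hν _) 4).mul (AllMoments.npv (allMoments_snd hν _) 4)).mul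
      ((allMoments_chp hν 2).sub
        (((allMoments_dps hν 1).const_mul 2).mul (allMoments_dps hν 3)))).integrable
  · ring

end Hirota

section Weight

open scoped Topology Nat
open Polynomial (X C)

/-- The one-particle weight. -/
noncomputable def wt (b z x : ℝ) : ℝ := x ^ (-b) * Real.exp (-x⁻¹ + z * x)

/-- The one-particle measure. -/
noncomputable def wtMeasure (b z : ℝ) : Measure ℝ :=
  (volume.restrict (Set.Ioi 0)).withDensity fun x => ENNReal.ofReal (wt b z x)

lemma wt_pos (b z : ℝ) {x : ℝ} (hx : 0 < x) : 0 < wt b z x :=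
  mul_pos (Real.rpow_pos_of_pos hx _) (Real.exp_pos _)

lemma measurable_wt (b z : ℝ) : Measurable (wt b z) := by
  unfold wt; fun_prop

lemma pow_mul_wt (b z : ℝ) (k : ℕ) {x : ℝ} (hx : 0 < x) : x ^ k * wt b z x = wt (b - k) z x := by
  rw [wt, wt, ← mul_assoc, ← Real.rpow_natCast, ← Real.rpow_add hx]
  ring_nf

lemma wt_le (b z : ℝ) (N : ℕ) {x : ℝ} (hx : 0 < x) :
    wt b z x ≤ N ! * (x ^ (N - b) * Real.exp (z * x)) := by
  have h1 : Real.exp (-x⁻¹) ≤ N ! * x ^ N := by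
    have h := Real.pow_div_factorial_le_exp (x := x⁻¹) (by positivity) N
    rw [Real.exp_neg, inv_le_comm₀ (Real.exp_pos _) (by positivity)]
    refine le_trans (le_of_eq ?_) h
    rw [mul_inv, inv_pow, div_eq_inv_mul]
  have h2 : x ^ ((N : ℝ) - b) = x ^ N * x ^ (-b) := by
    rw [← Real.rpow_natCast, ← Real.rpow_add hx, sub_eq_add_neg]
  have h3 : 0 ≤ x ^ (-b) := Real.rpow_nonneg hx.le _
  rw [wt, Real.exp_add, h2]
  calc x ^ (-b) * (Real.exp (-x⁻¹) * Real.exp (z * x))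
      ≤ x ^ (-b) * (N ! * x ^ N * Real.exp (z * x)) := by gcongr
    _ = _ := by ring

lemma integrableOn_wt (b : ℝ) {z : ℝ} (hz : z < 0) :
    IntegrableOn (wt b z) (Set.Ioi 0) := by
  obtain ⟨N, hN⟩ := exists_nat_gt (b - 1)
  have h := integrableOn_rpow_mul_exp_neg_mul_rpow (p := 1) (s := N - b) (b := -z)
    (by linarith) one_pos (by linarith)
  refine Integrable.mono' (h.const_mul (N ! : ℝ)) (measurable_wt b z).aestronglyMeasurable ?_
  filter_upwards [ae_restrict_mem measurableSet_Ioi] with x hx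
  rw [Real.norm_of_nonneg (wt_pos b z hx).le]
  simpa using wt_le b z N hx

lemma tendsto_wt_atTop (b : ℝ) {z : ℝ} (hz : z < 0) : Tendsto (wt b z) atTop (𝓝 0) := by
  have h := tendsto_rpow_mul_exp_neg_mul_atTop_nhds_zero (-b) (-z) (by linarith)
  refine tendsto_of_tendsto_of_tendsto_of_le_of_le' tendsto_const_nhds h ?_ ?_
  · filter_upwards [eventually_gt_atTop 0] with x hx using (wt_pos b z hx).le
  · filter_upwards [eventually_gt_atTop 0] with x hx
    simpa using wt_le b z 0 hx

lemma tendsto_wt_nhdsGT (b : ℝ) {z : ℝ} (hz : z < 0) : Tendsto (wt b z) (𝓝[>] 0) (𝓝 0) := by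
  obtain ⟨N, hN⟩ := exists_nat_gt b
  have h : Tendsto (fun x : ℝ => (N ! : ℝ) * x ^ ((N : ℝ) - b)) (𝓝[>] 0) (𝓝 0) := by
    have hc : ContinuousAt (fun x : ℝ => (N ! : ℝ) * x ^ ((N : ℝ) - b)) 0 :=
      continuousAt_const.mul (Real.continuousAt_rpow_const _ _ (Or.inr (by linarith)))
    have := hc.tendsto.mono_left (nhdsWithin_le_nhds (s := Set.Ioi 0))
    simpa [Real.zero_rpow (by linarith : (N : ℝ) - b ≠ 0)] using this
  refine tendsto_of_tendsto_of_tendsto_of_le_of_le' tendsto_const_nhds h ?_ ?_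
  · filter_upwards [self_mem_nhdsWithin] with x hx using (wt_pos b z hx).le
  · filter_upwards [self_mem_nhdsWithin] with x hx
    have hx : 0 < x := hx
    refine (wt_le b z N hx).trans ?_
    have : Real.exp (z * x) ≤ 1 := Real.exp_le_one_iff.2 (by nlinarith)
    have := Real.rpow_nonneg hx.le (N - b)
    gcongr
    nlinarith

lemma eval_mul_wt (Q : Polynomial ℝ) (b z : ℝ) {x : ℝ} (hx : 0 < x) :
    Q.eval x * wt b z x = ∑ k ∈ range (Q.natDegree + 1), Q.coeff k * wt (b - k) z x := by
  rw [Polynomial.eval_eq_sum_range, Finset.sum_mul]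
  exact sum_congr rfl fun k _ => by rw [mul_assoc, pow_mul_wt b z k hx]

lemma tendsto_eval_mul_wt (Q : Polynomial ℝ) (b z : ℝ) {l : Filter ℝ}
    (hl : ∀ᶠ x in l, 0 < x) (h : ∀ c, Tendsto (wt c z) l (𝓝 0)) :
    Tendsto (fun x => Q.eval x * wt b z x) l (𝓝 0) := by
  have h1 : Tendsto (fun x => ∑ k ∈ range (Q.natDegree + 1), Q.coeff k * wt (b - k) z x) l
      (𝓝 0) := by
    have := tendsto_finsetSum (range (Q.natDegree + 1))
      fun k _ => (h (b - k)).const_mul (Q.coeff k)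
    simpa using this
  refine h1.congr' ?_
  filter_upwards [hl] with x hx using (eval_mul_wt Q b z hx).symm

lemma integral_wtMeasure (b z : ℝ) (f : ℝ → ℝ) :
    ∫ x, f x ∂wtMeasure b z = ∫ x in Set.Ioi 0, wt b z x * f x := by
  rw [wtMeasure, integral_withDensity_eq_integral_toReal_smul
    (measurable_wt b z).ennreal_ofReal (by simp)]
  refine setIntegral_congr_fun measurableSet_Ioi fun x hx => ?_
  simp [ENNReal.toReal_ofReal (wt_pos b z hx).le]

lemma integrable_wtMeasure_iff (b z : ℝ) (f : ℝ → ℝ) :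
    Integrable f (wtMeasure b z) ↔ IntegrableOn (fun x => wt b z x * f x) (Set.Ioi 0) := by
  rw [wtMeasure, integrable_withDensity_iff_integrable_smul'
    (measurable_wt b z).ennreal_ofReal (by simp)]
  refine integrableOn_congr_fun (fun x hx => ?_) measurableSet_Ioi
  simp [ENNReal.toReal_ofReal (wt_pos b z hx).le]

lemma isFiniteMeasure_wtMeasure (b : ℝ) {z : ℝ} (hz : z < 0) :
    IsFiniteMeasure (wtMeasure b z) :=
  isFiniteMeasure_withDensity_ofReal (integrableOn_wt b hz).hasFiniteIntegral

lemma allMoments_wtMeasure (b : ℝ) {z : ℝ} (hz : z < 0) :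
    AllMoments (fun x => x) (wtMeasure b z) := by
  have := isFiniteMeasure_wtMeasure b hz
  intro p hp
  obtain ⟨N, hN⟩ := exists_nat_gt p.toReal
  have hpN : p ≤ (N : ENNReal) := by
    rw [← ENNReal.ofReal_toReal hp, ← ENNReal.ofReal_natCast]
    exact ENNReal.ofReal_le_ofReal hN.le
  have hN0 : N ≠ 0 := by
    rintro rfl
    simp at hN
    exact absurd hN (not_lt.2 ENNReal.toReal_nonneg)
  refine MemLp.mono_exponent ?_ hpN
  rw [← integrable_norm_rpow_iff (f := fun x : ℝ => x) aestronglyMeasurable_id (by exact_mod_cast hN0) (by simp),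
    integrable_wtMeasure_iff]
  refine (integrableOn_wt (b - N) hz).congr_fun (fun x hx => ?_) measurableSet_Ioi
  have hx : 0 < x := hx
  simp only [ENNReal.toReal_natCast, Real.rpow_natCast, Real.norm_eq_abs, abs_of_pos hx]
  rw [← pow_mul_wt b z N hx, mul_comm]

lemma hasDerivAt_wt (b z : ℝ) {x : ℝ} (hx : 0 < x) :
    HasDerivAt (wt b z) ((-b * x + 1 + z * x ^ 2) / x ^ 2 * wt b z x) x := by
  have h1 := Real.hasDerivAt_rpow_const (x := x) (p := -b) (Or.inl hx.ne')
  have h2 := (((hasDerivAt_inv hx.ne').neg).add ((hasDerivAt_id x).const_mul z)).exp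
  refine (h1.mul h2).congr_deriv ?_
  have h3 : x ^ (-b - 1) = x ^ (-b) / x := by rw [Real.rpow_sub hx, Real.rpow_one]
  simp only [wt, h3, Pi.add_apply, Pi.neg_apply, id]
  field_simp
  ring

/-- Integrals of a derivative over the half line, off a countable exceptional set. -/
lemma integral_Ioi_eq_zero_of_hasDerivAt_off_countable {f f' : ℝ → ℝ} {s : Set ℝ}
    (hs : s.Countable) (hc : ContinuousOn f (Set.Ioi 0))
    (hd : ∀ x ∈ Set.Ioi 0 \ s, HasDerivAt f (f' x) x) (hi : IntegrableOn f' (Set.Ioi 0))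
    (h0 : Tendsto f (𝓝[>] 0) (𝓝 0)) (h1 : Tendsto f atTop (𝓝 0)) :
    ∫ x in Set.Ioi 0, f' x = 0 := by
  have ha : Tendsto (fun n : ℕ => 1 / ((n : ℝ) + 1)) atTop (𝓝[>] 0) :=
    tendsto_nhdsWithin_iff.2 ⟨tendsto_one_div_add_atTop_nhds_zero_nat,
      Eventually.of_forall fun n => Set.mem_Ioi.2 Nat.one_div_pos_of_nat⟩
  have hb : Tendsto (fun n : ℕ => (n : ℝ) + 1) atTop atTop :=
    tendsto_atTop_add_const_right _ _ tendsto_natCast_atTop_atTop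
  have hcov : AECover (volume.restrict (Set.Ioi (0 : ℝ))) atTop
      fun n : ℕ => Set.Ioc (1 / ((n : ℝ) + 1)) ((n : ℝ) + 1) := by
    refine ⟨?_, fun n => measurableSet_Ioc⟩
    filter_upwards [ae_restrict_mem measurableSet_Ioi] with x hx
    have ha' := (tendsto_nhdsWithin_iff.1 ha).1
    filter_upwards [ha'.eventually_lt_const (show (0 : ℝ) < x from hx),
      hb.eventually_ge_atTop x] with n h1 h2 using ⟨h1, h2⟩
  have hlim := hcov.integral_tendsto_of_countably_generated hi
  have hlim2 : Tendsto (fun n : ℕ => f ((n : ℝ) + 1) - f (1 / ((n : ℝ) + 1))) atTop (𝓝 0) := by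
    simpa using (h1.comp hb).sub (h0.comp ha)
  refine tendsto_nhds_unique (hlim.congr fun n => ?_) hlim2
  have hp : (0 : ℝ) < 1 / ((n : ℝ) + 1) := Nat.one_div_pos_of_nat
  have hle : 1 / ((n : ℝ) + 1) ≤ (n : ℝ) + 1 := by
    rw [div_le_iff₀ (by positivity)]
    nlinarith [(Nat.cast_nonneg n : (0 : ℝ) ≤ n)]
  have hsub : Set.Ioc (1 / ((n : ℝ) + 1)) ((n : ℝ) + 1) ⊆ Set.Ioi 0 := fun x hx => hp.trans hx.1
  rw [Measure.restrict_restrict measurableSet_Ioc, Set.inter_eq_left.2 hsub,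
    ← intervalIntegral.integral_of_le hle]
  refine integral_eq_of_hasDerivAt_off_countable_of_le f f' hle hs
    (hc.mono fun x hx => hp.trans_le hx.1) (fun x hx => hd x ⟨hp.trans hx.1.1, hx.2⟩) ?_
  rw [intervalIntegrable_iff_integrableOn_Ioc_of_le hle]
  exact hi.mono_set hsub

end Weight

section PartialIntegration

open scoped Topology
open Polynomial (X C)

lemma hasDerivAt_abs_sg {x : ℝ} (hx : x ≠ 0) : HasDerivAt (fun y : ℝ => |y|) (sg x) x := by
  rcases lt_or_gt_of_ne hx with h | h
  · rw [sg_of_neg h]; exact hasDerivAt_abs_neg h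
  · rw [sg_of_pos h]; exact hasDerivAt_abs_pos h

lemma hasDerivAt_abs_eval_pow (P : Polynomial ℝ) (p : ℕ) {x : ℝ} (hx : P.eval x ≠ 0) :
    HasDerivAt (fun t => |P.eval t| ^ p)
      (p * |P.eval x| ^ (p - 1) * (sg (P.eval x) * P.derivative.eval x)) x := by
  have h : HasDerivAt (fun t => |P.eval t|) (sg (P.eval x) * P.derivative.eval x) x :=
    HasDerivAt.comp (h₂ := fun y => |y|) x (hasDerivAt_abs_sg hx) (P.hasDerivAt x)
  exact h.pow p

lemma AllMoments.eval_const {α : Type*} [MeasurableSpace α] {μ : Measure α} [IsFiniteMeasure μ]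
    {f : α → ℝ} (hf : AllMoments f μ) (Q : Polynomial ℝ) :
    AllMoments (fun x => Q.eval (f x)) μ := by
  simp only [Polynomial.eval_eq_sum_range]
  exact AllMoments.sum _ fun k _ => (hf.pow k).const_mul _

/-- Integration by parts in one variable, for the product of a polynomial with a power of the
absolute value of another one. -/
lemma integral_wtMeasure_parts (b : ℝ) {z : ℝ} (hz : z < 0) (S P : Polynomial ℝ) (hP : P ≠ 0)
    (p : ℕ) :
    ∫ t, ((X ^ 2 * S).derivative.eval t * |P.eval t| ^ p
      + (X ^ 2 * S).eval t * (p * |P.eval t| ^ (p - 1) * (sg (P.eval t) * P.derivative.eval t))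
      + (-b * t + 1 + z * t ^ 2) * S.eval t * |P.eval t| ^ p) ∂wtMeasure b z = 0 := by
  have := isFiniteMeasure_wtMeasure b hz
  have hν := allMoments_wtMeasure b hz
  rw [integral_wtMeasure]
  have hlim : ∀ {l : Filter ℝ}, (∀ᶠ x in l, 0 < x) → (∀ c, Tendsto (wt c z) l (𝓝 0)) →
      Tendsto (fun t => (X ^ 2 * S).eval t * |P.eval t| ^ p * wt b z t) l (𝓝 0) := by
    intro l hl h
    have h1 := (tendsto_eval_mul_wt (X ^ 2 * S * P ^ p) b z hl h).abs
    rw [abs_zero] at h1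
    rw [tendsto_zero_iff_abs_tendsto_zero]
    refine h1.congr fun t => ?_
    simp [abs_mul, abs_pow]
  refine integral_Ioi_eq_zero_of_hasDerivAt_off_countable
    (f := fun t => (X ^ 2 * S).eval t * |P.eval t| ^ p * wt b z t)
    (s := (P.rootSet ℝ)) (P.rootSet_finite ℝ).countable ?_ ?_ ?_
    (hlim self_mem_nhdsWithin fun c => tendsto_wt_nhdsGT c hz)
    (hlim (eventually_gt_atTop 0) fun c => tendsto_wt_atTop c hz)
  · exact (((X ^ 2 * S).continuous.mul ((P.continuous.abs).pow p)).continuousOn).mul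
      fun x hx => (hasDerivAt_wt b z hx).continuousAt.continuousWithinAt
  · rintro x ⟨hx, hxs⟩
    have hx : 0 < x := hx
    have hPx : P.eval x ≠ 0 := fun h => hxs (by simp [Polynomial.mem_rootSet, hP, h])
    refine ((((X ^ 2 * S).hasDerivAt x).mul (hasDerivAt_abs_eval_pow P p hPx)).mul
      (hasDerivAt_wt b z hx)).congr_deriv ?_
    simp only [Polynomial.eval_mul, Polynomial.eval_pow, Polynomial.eval_X, Pi.mul_apply]
    field_simp
  · rw [← integrable_wtMeasure_iff]
    refine AllMoments.integrable ?_
    have hPm := hν.eval_const P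
    refine ((((hν.eval_const _).mul (hPm.abs.pow p))).add
      ((hν.eval_const _).mul (((hPm.abs.pow (p - 1)).const_mul p).mul
        (hPm.sg.mul (hν.eval_const _))))).add
      (AllMoments.mul (AllMoments.mul ?_ (hν.eval_const _)) (hPm.abs.pow p))
    exact ((hν.const_mul (-b)).add (AllMoments.const 1)).add ((hν.pow 2).const_mul z)

end PartialIntegration

section LoopEquations

open Polynomial (C)

variable {m : ℕ}

/-- The derivative of the interaction factor in the `i`-th particle. -/
noncomputable def dnpv (p : ℕ) (T : Fin (m + 1) → ℝ) (i : Fin (m + 1)) : ℝ :=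
  npv p (i.removeNth T) * (p * |(nod (i.removeNth T)).eval (T i)| ^ (p - 1) *
    (sg ((nod (i.removeNth T)).eval (T i)) * (nod (i.removeNth T)).derivative.eval (T i)))

lemma eval_derivative_nod_eq {Y : Fin m → ℝ} {t : ℝ} (h : (nod Y).eval t ≠ 0) :
    (nod Y).derivative.eval t = (nod Y).eval t * ∑ j, (t - Y j)⁻¹ := by
  induction m with
  | zero => simp [nod]
  | succ m ih =>
    rw [nod_succAbove Y 0] at h ⊢
    simp only [Polynomial.eval_mul, Polynomial.eval_sub, Polynomial.eval_X, Polynomial.eval_C,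
      Polynomial.derivative_mul, Polynomial.derivative_sub, Polynomial.derivative_X,
      Polynomial.derivative_C, sub_zero, one_mul, Polynomial.eval_add, ne_eq, mul_eq_zero,
      not_or] at h ⊢
    rw [ih h.2, Fin.sum_univ_succ, mul_add]
    have h1 := h.1
    field_simp
    simp [Fin.removeNth]

lemma mul_sg (x : ℝ) : x * sg x = |x| := by
  rcases eq_or_ne x 0 with rfl | h
  · simp
  · nth_rewrite 1 [← abs_mul_sg x]
    rw [mul_assoc, sg_mul_self h, mul_one]

lemma dnpv_eq {p : ℕ} (hp : p ≠ 0) (T : Fin (m + 1) → ℝ) (hT : Function.Injective T)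
    (i : Fin (m + 1)) : dnpv p T i = npv p T * (p * ∑ j, (T i - T j)⁻¹) := by
  have hP := eval_nod_removeNth_ne_zero hT i
  obtain ⟨q, rfl⟩ := Nat.exists_eq_succ_of_ne_zero hp
  have hsum : ∑ j, (T i - T j)⁻¹ = ∑ j, (T i - i.removeNth T j)⁻¹ := by
    rw [Fin.sum_univ_succAbove _ i, sub_self, inv_zero, zero_add]
    rfl
  rw [dnpv, eval_derivative_nod_eq hP, npv_removeNth (q + 1) T i, hsum, pow_succ,
    Nat.succ_eq_add_one, Nat.add_sub_cancel]
  linear_combination npv (q + 1) (i.removeNth T) * ((q + 1 : ℕ) : ℝ) *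
    |(nod (i.removeNth T)).eval (T i)| ^ q * (∑ j, (T i - i.removeNth T j)⁻¹) *
    mul_sg ((nod (i.removeNth T)).eval (T i))

lemma dnpv_eq_zero {p : ℕ} (hp : p ≠ 0) {T : Fin (m + 1) → ℝ}
    (hT : ¬ Function.Injective T) (i : Fin (m + 1)) : dnpv p T i = 0 := by
  rcases npv_removeNth_mul_eq_zero hp hT i with h | h <;> simp [dnpv, h]

lemma sum_sum_symm (F : Fin m → Fin m → ℝ) :
    2 * ∑ i, ∑ j, F i j = ∑ i, ∑ j, (F i j + F j i) := by
  simp only [sum_add_distrib]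
  rw [Finset.sum_comm (f := fun i j => F j i)]
  ring

lemma sum_sq_dnpv {p : ℕ} (hp : p ≠ 0) (T : Fin (m + 1) → ℝ) :
    ∑ i, T i ^ 2 * dnpv p T i = npv p T * (p * (m * psum 1 T)) := by
  by_cases hT : Function.Injective T
  · have key : ∑ i, ∑ j, T i ^ 2 * (T i - T j)⁻¹ = m * psum 1 T := by
      have h : ∀ i j, T i ^ 2 * (T i - T j)⁻¹ + T j ^ 2 * (T j - T i)⁻¹ =
          T i + T j - if i = j then 2 * T i else 0 := by
        intro i j
        split_ifs with hij
        · subst hij; simp; ring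
        · have h1 : T i - T j ≠ 0 := sub_ne_zero.2 fun h => hij (hT h)
          have h2 : T j - T i ≠ 0 := sub_ne_zero.2 fun h => hij (hT h.symm)
          rw [← neg_sub (T i) (T j), inv_neg]
          field_simp
          ring
      have h2 := sum_sum_symm fun i j => T i ^ 2 * (T i - T j)⁻¹
      simp only [h, sum_sub_distrib, sum_add_distrib, sum_const, card_univ, Fintype.card_fin,
        nsmul_eq_mul, sum_ite_eq, mem_univ, if_true, ← mul_sum] at h2
      simp only [psum, pow_one, mul_sum] at h2 ⊢
      push_cast at h2
      simp only [← mul_sum] at h2 ⊢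
      linarith
    simp only [dnpv_eq hp T hT, ← key, mul_sum]
    exact sum_congr rfl fun i _ => sum_congr rfl fun j _ => by ring
  · rw [npv_eq_zero_of_not_injective hp hT, zero_mul]
    exact sum_eq_zero fun i _ => by rw [dnpv_eq_zero hp hT, mul_zero]

lemma sum_cube_dnpv {p : ℕ} (hp : p ≠ 0) (T : Fin (m + 1) → ℝ) :
    ∑ i, T i ^ 3 * dnpv p T i =
      npv p T * (p * (m * psum 2 T + (psum 1 T ^ 2 - psum 2 T) / 2)) := by
  by_cases hT : Function.Injective T
  · have key : ∑ i, ∑ j, T i ^ 3 * (T i - T j)⁻¹ =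
        m * psum 2 T + (psum 1 T ^ 2 - psum 2 T) / 2 := by
      have h : ∀ i j, T i ^ 3 * (T i - T j)⁻¹ + T j ^ 3 * (T j - T i)⁻¹ =
          T i ^ 2 + T i * T j + T j ^ 2 - if i = j then 3 * T i ^ 2 else 0 := by
        intro i j
        split_ifs with hij
        · subst hij; simp; ring
        · have h1 : T i - T j ≠ 0 := sub_ne_zero.2 fun h => hij (hT h)
          have h2 : T j - T i ≠ 0 := sub_ne_zero.2 fun h => hij (hT h.symm)
          rw [← neg_sub (T i) (T j), inv_neg]
          field_simp
          ring
      have h2 := sum_sum_symm fun i j => T i ^ 3 * (T i - T j)⁻¹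
      simp only [h, sum_sub_distrib, sum_add_distrib, sum_const, card_univ, Fintype.card_fin,
        nsmul_eq_mul, sum_ite_eq, mem_univ, if_true, ← mul_sum, ← sum_mul] at h2
      simp only [psum, pow_one] at h2 ⊢
      push_cast at h2
      simp only [← mul_sum] at h2 ⊢
      linarith
    simp only [dnpv_eq hp T hT, ← key, mul_sum]
    exact sum_congr rfl fun i _ => sum_congr rfl fun j _ => by ring
  · rw [npv_eq_zero_of_not_injective hp hT, zero_mul]
    exact sum_eq_zero fun i _ => by rw [dnpv_eq_zero hp hT, mul_zero]

end LoopEquations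

section LoopIntegrals

open Polynomial (X C)

variable {m : ℕ} {b z : ℝ}

lemma integrable_partsKernel (hz : z < 0) (p q l : ℕ) :
    Integrable (fun w : ℝ × (Fin m → ℝ) => npv p w.2 *
      (((q + 2) * w.1 ^ (q + 1) * (w.1 ^ l + psum l w.2) + l * w.1 ^ (q + 1 + l))
          * |(nod w.2).eval w.1| ^ p
        + w.1 ^ (q + 2) * (w.1 ^ l + psum l w.2) * (p * |(nod w.2).eval w.1| ^ (p - 1)
          * (sg ((nod w.2).eval w.1) * (nod w.2).derivative.eval w.1))
        + (-b * w.1 + 1 + z * w.1 ^ 2) * (w.1 ^ q * (w.1 ^ l + psum l w.2))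
          * |(nod w.2).eval w.1| ^ p))
      ((wtMeasure b z).prod (powMeasure (wtMeasure b z) m)) := by
  have := isFiniteMeasure_wtMeasure b hz
  have hν := allMoments_wtMeasure b hz
  have hy : AllMoments (fun w : ℝ × (Fin m → ℝ) => w.1)
      ((wtMeasure b z).prod (powMeasure (wtMeasure b z) m)) := AllMoments.comp_fst hν
  have hY : ∀ i, AllMoments (fun w : ℝ × (Fin m → ℝ) => w.2 i)
      ((wtMeasure b z).prod (powMeasure (wtMeasure b z) m)) := fun i => allMoments_snd hν _ i
  have hP := AllMoments.eval_nod hY hy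
  have hf := (hy.pow l).add (AllMoments.psum hY l)
  refine ((AllMoments.npv hY p).mul ((AllMoments.add (((((hy.pow (q + 1)).const_mul (q + 2)).mul
    hf).add ((hy.pow (q + 1 + l)).const_mul l)).mul (hP.abs.pow p))
    (((hy.pow (q + 2)).mul hf).mul (((hP.abs.pow (p - 1)).const_mul p).mul
      (hP.sg.mul (AllMoments.eval_derivative_nod hY hy))))).add
    ((AllMoments.mul ?_ ((hy.pow q).mul hf)).mul (hP.abs.pow p)))).integrable
  exact ((hy.const_mul (-b)).add (AllMoments.const 1)).add ((hy.pow 2).const_mul z)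

lemma integral_partsKernel (hz : z < 0) (p q l : ℕ) :
    ∫ w : ℝ × (Fin m → ℝ), npv p w.2 *
      (((q + 2) * w.1 ^ (q + 1) * (w.1 ^ l + psum l w.2) + l * w.1 ^ (q + 1 + l))
          * |(nod w.2).eval w.1| ^ p
        + w.1 ^ (q + 2) * (w.1 ^ l + psum l w.2) * (p * |(nod w.2).eval w.1| ^ (p - 1)
          * (sg ((nod w.2).eval w.1) * (nod w.2).derivative.eval w.1))
        + (-b * w.1 + 1 + z * w.1 ^ 2) * (w.1 ^ q * (w.1 ^ l + psum l w.2))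
          * |(nod w.2).eval w.1| ^ p)
      ∂(wtMeasure b z).prod (powMeasure (wtMeasure b z) m) = 0 := by
  have := isFiniteMeasure_wtMeasure b hz
  rw [integral_prod_symm _ (integrable_partsKernel hz p q l)]
  refine integral_eq_zero_of_ae (Eventually.of_forall fun Y => ?_)
  have h := integral_wtMeasure_parts b hz (X ^ q * (X ^ l + C (psum l Y))) (nod Y)
    (nod_monic Y).ne_zero p
  simp only [integral_const_mul, Pi.zero_apply]
  refine mul_eq_zero_of_right _ (Eq.trans (integral_congr_ae (Eventually.of_forall fun t => ?_)) h)
  have hS : (X ^ 2 * (X ^ q * (X ^ l + C (psum l Y))) : Polynomial ℝ) =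
      X ^ (q + 1 + l + 1) + C (psum l Y) * X ^ (q + 1 + 1) := by ring
  simp only [hS, Polynomial.derivative_add, Polynomial.derivative_X_pow,
    Polynomial.derivative_C_mul_X_pow, Polynomial.eval_add, Polynomial.eval_mul,
    Polynomial.eval_pow, Polynomial.eval_X, Polynomial.eval_C, Nat.add_sub_cancel]
  push_cast
  ring

/-- The loop equation attached to the vector field `λ ^ (q + 2) • psum l`. -/
lemma integral_loop (hz : z < 0) (p q l : ℕ) :
    ∫ T : Fin (m + 1) → ℝ, (npv p T * ((q + 2) * (psum l T * psum (q + 1) T)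
        + l * psum (q + 1 + l) T
        + psum l T * (-b * psum (q + 1) T + psum q T + z * psum (q + 2) T))
      + psum l T * ∑ i, T i ^ (q + 2) * dnpv p T i) ∂powMeasure (wtMeasure b z) (m + 1) = 0 := by
  have := isFiniteMeasure_wtMeasure b hz
  have hmp := fun i : Fin (m + 1) =>
    measurePreserving_piFinSuccAbove (fun _ : Fin (m + 1) => wtMeasure b z) i
  have hI := fun i => (hmp i).integrable_comp_of_integrable
    (integrable_partsKernel (m := m) hz p q l)
  have hE := fun i => ((hmp i).integral_comp' _).trans (integral_partsKernel (m := m) hz p q l)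
  have hsum := (integral_finsetSum univ fun i _ => hI i).trans (sum_eq_zero fun i _ => hE i)
  refine Eq.trans (integral_congr_ae (Eventually.of_forall fun T => ?_)) hsum
  have hterm : ∀ i : Fin (m + 1), psum l (i.removeNth T) = psum l T - T i ^ l := fun i =>
    psum_removeNth l T i
  have hpt : ∀ i : Fin (m + 1), (npv p (i.removeNth T) *
      (((q + 2) * T i ^ (q + 1) * (T i ^ l + psum l (i.removeNth T)) + l * T i ^ (q + 1 + l))
          * |(nod (i.removeNth T)).eval (T i)| ^ p
        + T i ^ (q + 2) * (T i ^ l + psum l (i.removeNth T)) *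
          (p * |(nod (i.removeNth T)).eval (T i)| ^ (p - 1)
          * (sg ((nod (i.removeNth T)).eval (T i)) *
            (nod (i.removeNth T)).derivative.eval (T i)))
        + (-b * T i + 1 + z * T i ^ 2) * (T i ^ q * (T i ^ l + psum l (i.removeNth T)))
          * |(nod (i.removeNth T)).eval (T i)| ^ p)) =
      npv p T * (((q + 2) * psum l T) * T i ^ (q + 1) + l * T i ^ (q + 1 + l)
        + psum l T * (-b * T i ^ (q + 1) + T i ^ q + z * T i ^ (q + 2)))
      + psum l T * (T i ^ (q + 2) * dnpv p T i) := by
    intro i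
    rw [hterm, npv_removeNth p T i, dnpv]
    ring
  refine Eq.trans ?_ (sum_congr rfl fun i _ => (hpt i).symm)
  simp only [sum_add_distrib, ← mul_sum, psum]
  ring

end LoopIntegrals

section LoopMoments

variable {b z : ℝ} {p : ℕ}

lemma hasInt_mom {ν : Measure ℝ} [IsFiniteMeasure ν] {a : ℕ} (hν : AllMoments (fun x => x) ν)
    (p : ℕ) {f : (Fin a → ℝ) → ℝ} (hf : AllMoments f (powMeasure ν a)) :
    HasInt (powMeasure ν a) (fun X => npv p X * f X) (mom ν p a f) :=
  ⟨((AllMoments.npv (allMoments_eval hν) p).mul hf).integrable, rfl⟩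

lemma psum_zero_eq {a : ℕ} (T : Fin a → ℝ) : psum 0 T = a := by simp [psum]

/-- The loop equations for the moments of the power sums. -/
lemma loop_equations (hz : z < 0) (hp : p ≠ 0) {n : ℕ} (hn : n ≠ 0) :
    let M := mom (wtMeasure b z) p n
    ((2 + p * (n - 1) - b) * M (psum 1) + n * M (fun _ => 1) + z * M (psum 2) = 0) ∧
    ((2 + p * (n - 1) - b) * M (fun X => psum 1 X ^ 2) + n * M (psum 1)
      + z * M (fun X => psum 1 X * psum 2 X) + M (psum 2) = 0) ∧
    ((2 + p * (n - 1) - b) * M (fun X => psum 1 X * psum 2 X) + n * M (psum 2)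
      + z * M (fun X => psum 2 X ^ 2) + 2 * M (psum 3) = 0) ∧
    ((3 + p * (n - 1) - p / 2 - b) * M (psum 2) + p / 2 * M (fun X => psum 1 X ^ 2)
      + M (psum 1) + z * M (psum 3) = 0) ∧
    ((3 + p * (n - 1) - p / 2 - b) * M (fun X => psum 1 X * psum 2 X)
      + p / 2 * M (fun X => psum 1 X ^ 3) + M (fun X => psum 1 X ^ 2)
      + z * M (fun X => psum 1 X * psum 3 X) + M (psum 3) = 0) := by
  intro M
  have := isFiniteMeasure_wtMeasure b hz
  have hν := allMoments_wtMeasure b hz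
  obtain ⟨m, rfl⟩ := Nat.exists_eq_succ_of_ne_zero hn
  have hX := fun i : Fin (m + 1) => allMoments_eval hν i
  have hq := fun k => AllMoments.psum hX k
  have I0 := hasInt_mom hν p (AllMoments.const (μ := powMeasure (wtMeasure b z) (m + 1)) 1)
  have I1 := hasInt_mom hν p (hq 1)
  have I2 := hasInt_mom hν p (hq 2)
  have I3 := hasInt_mom hν p (hq 3)
  have I11 := hasInt_mom hν p ((hq 1).pow 2)
  have I111 := hasInt_mom hν p ((hq 1).pow 3)
  have I12 := hasInt_mom hν p ((hq 1).mul (hq 2))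
  have I22 := hasInt_mom hν p ((hq 2).pow 2)
  have I13 := hasInt_mom hν p ((hq 1).mul (hq 3))
  have hm : ((m.succ : ℕ) : ℝ) - 1 = m := by push_cast; ring
  have hm0 : ((m.succ : ℕ) : ℝ) ≠ 0 := by positivity
  rw [hm]
  refine ⟨?_, ?_, ?_, ?_, ?_⟩
  · have h := (((I1.const_mul (2 + p * m - b)).add (I0.const_mul m.succ)).add
      (I2.const_mul z)).const_mul m.succ
    have h' := h.2.symm.trans ((integral_congr_ae (Eventually.of_forall fun T => ?_)).trans
      (integral_loop (m := m) (b := b) hz p 0 0))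
    · exact (mul_eq_zero.1 h').resolve_left hm0
    · simp only [zero_add, sum_sq_dnpv hp, psum_zero_eq]
      push_cast
      ring
  · have h := ((((I11.const_mul (2 + p * m - b)).add (I1.const_mul m.succ)).add
      (I12.const_mul z)).add I2)
    refine h.2.symm.trans ((integral_congr_ae (Eventually.of_forall fun T => ?_)).trans
      (integral_loop (m := m) (b := b) hz p 0 1))
    simp only [zero_add, sum_sq_dnpv hp, psum_zero_eq]
    push_cast
    ring
  · have h := ((((I12.const_mul (2 + p * m - b)).add (I2.const_mul m.succ)).add
      (I22.const_mul z)).add (I3.const_mul 2))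
    refine h.2.symm.trans ((integral_congr_ae (Eventually.of_forall fun T => ?_)).trans
      (integral_loop (m := m) (b := b) hz p 0 2))
    simp only [zero_add, sum_sq_dnpv hp, psum_zero_eq]
    push_cast
    ring
  · have h := ((((I2.const_mul (3 + p * m - p / 2 - b)).add (I11.const_mul (p / 2))).add
      I1).add (I3.const_mul z)).const_mul m.succ
    have h' := h.2.symm.trans ((integral_congr_ae (Eventually.of_forall fun T => ?_)).trans
      (integral_loop (m := m) (b := b) hz p 1 0))
    · exact (mul_eq_zero.1 h').resolve_left hm0
    · simp only [Nat.reduceAdd, sum_cube_dnpv hp, psum_zero_eq]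
      push_cast
      ring
  · have h := ((((I12.const_mul (3 + p * m - p / 2 - b)).add (I111.const_mul (p / 2))).add
      I11).add (I13.const_mul z)).add I3
    refine h.2.symm.trans ((integral_congr_ae (Eventually.of_forall fun T => ?_)).trans
      (integral_loop (m := m) (b := b) hz p 1 1))
    simp only [Nat.reduceAdd, sum_cube_dnpv hp]
    push_cast
    ring

end LoopMoments

section PartitionFunction

lemma lintegral_fin_prod {n : ℕ} (μ : Fin n → Measure ℝ) [∀ i, SigmaFinite (μ i)]
    {f : Fin n → ℝ → ENNReal} (hf : ∀ i, Measurable (f i)) :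
    ∫⁻ x, ∏ i, f i (x i) ∂Measure.pi μ = ∏ i, ∫⁻ x, f i x ∂μ i := by
  induction n with
  | zero => simp [lintegral_const]
  | succ n ih =>
    have hmp := measurePreserving_piFinSuccAbove μ 0
    have hmeas : Measurable fun x : Fin n → ℝ => ∏ i, f (Fin.succ i) (x i) :=
      Finset.measurable_prod _ fun i _ => (hf _).comp (measurable_pi_apply i)
    have h := hmp.lintegral_comp_emb (MeasurableEquiv.measurableEmbedding _)
      fun w : ℝ × (Fin n → ℝ) => f 0 w.1 * ∏ i, f (Fin.succ i) (w.2 i)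
    rw [Fin.prod_univ_succ, ← ih (fun i => μ i.succ) fun i => hf _]
    rw [lintegral_prod_mul (hf 0).aemeasurable hmeas.aemeasurable] at h
    refine Eq.trans (lintegral_congr fun x => ?_) h
    rw [Fin.prod_univ_succ]
    rfl

/-- The positive orthant. -/
def orth (m : ℕ) : Set (Fin m → ℝ) := Set.univ.pi fun _ => Set.Ioi 0

lemma measurableSet_orth (m : ℕ) : MeasurableSet (orth m) :=
  MeasurableSet.univ_pi fun _ => measurableSet_Ioi

lemma powMeasure_wtMeasure (b : ℝ) {z : ℝ} (hz : z < 0) (m : ℕ) :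
    powMeasure (wtMeasure b z) m =
      (volume.restrict (orth m)).withDensity fun x => ENNReal.ofReal (∏ j, wt b z (x j)) := by
  have := isFiniteMeasure_wtMeasure b hz
  refine Measure.pi_eq fun s hs => ?_
  rw [withDensity_apply _ (MeasurableSet.univ_pi hs), Measure.restrict_restrict
    (MeasurableSet.univ_pi hs), orth, ← Set.pi_inter_distrib, volume_pi, Measure.restrict_pi_pi]
  have h := lintegral_fin_prod
    (fun i => (volume : Measure ℝ).restrict (s i ∩ Set.Ioi 0))
    (f := fun _ x => ENNReal.ofReal (wt b z x)) fun _ => (measurable_wt b z).ennreal_ofReal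
  have h2 : ∀ i, wtMeasure b z (s i) =
      ∫⁻ x in s i ∩ Set.Ioi 0, ENNReal.ofReal (wt b z x) := fun i => by
    rw [wtMeasure, withDensity_apply _ (hs i), Measure.restrict_restrict (hs i)]
  simp only [h2]
  rw [← h, ← Measure.restrict_pi_pi]
  refine setLIntegral_congr_fun (MeasurableSet.univ_pi fun i => (hs i).inter measurableSet_Ioi)
    fun x hx => ?_
  exact ENNReal.ofReal_prod_of_nonneg fun i _ => (wt_pos b z (hx i trivial).2).le

lemma prod_wt_pos (b z : ℝ) {m : ℕ} {x : Fin m → ℝ} (hx : x ∈ orth m) : 0 < ∏ j, wt b z (x j) :=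
  prod_pos fun j _ => wt_pos b z (hx j trivial)

lemma measurable_prod_wt (b z : ℝ) (m : ℕ) :
    Measurable fun x : Fin m → ℝ => ∏ j, wt b z (x j) :=
  Finset.measurable_prod _ fun j _ => (measurable_wt b z).comp (measurable_pi_apply j)

lemma wigW_natCast (p : ℕ) (b : ℝ) (m : ℕ) (z : ℝ) (x : Fin m → ℝ) :
    wigW p b m z x = (∏ j, wt b z (x j)) * npv p x := by
  rw [wigW, vand_natCast]; rfl

lemma mom_wtMeasure (b : ℝ) {z : ℝ} (hz : z < 0) (p m : ℕ) (f : (Fin m → ℝ) → ℝ) :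
    mom (wtMeasure b z) p m f = ∫ x in orth m, wigW p b m z x * f x := by
  rw [mom, powMeasure_wtMeasure b hz, integral_withDensity_eq_integral_toReal_smul
    (measurable_prod_wt b z m).ennreal_ofReal (by simp)]
  refine setIntegral_congr_fun (measurableSet_orth m) fun x hx => ?_
  simp only [smul_eq_mul, wigW_natCast]
  rw [ENNReal.toReal_ofReal (prod_wt_pos b z hx).le]
  ring

lemma integrableOn_wigW_mul (b : ℝ) {z : ℝ} (hz : z < 0) (p m : ℕ) {f : (Fin m → ℝ) → ℝ}
    (hf : AllMoments f (powMeasure (wtMeasure b z) m)) :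
    IntegrableOn (fun x => wigW p b m z x * f x) (orth m) := by
  have := isFiniteMeasure_wtMeasure b hz
  have h := (hasInt_mom (allMoments_wtMeasure b hz) p hf).1
  rw [powMeasure_wtMeasure b hz, integrable_withDensity_iff_integrable_smul'
    (measurable_prod_wt b z m).ennreal_ofReal (by simp)] at h
  refine IntegrableOn.congr_fun h (fun x hx => ?_) (measurableSet_orth m)
  simp only [smul_eq_mul, wigW_natCast]
  rw [ENNReal.toReal_ofReal (prod_wt_pos b z hx).le]
  ring

end PartitionFunction

section ExponentialMoments

open scoped Topology

lemma wigW_eq_mul_exp (β b : ℝ) (m : ℕ) (z : ℝ) (x : Fin m → ℝ) :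
    wigW β b m z x = wigW β b m 0 x * Real.exp (z * psum 1 x) := by
  have h : Real.exp (z * psum 1 x) = ∏ j, Real.exp (z * x j) := by
    rw [← Real.exp_sum, psum, mul_sum]
    simp
  simp only [wigW, h, zero_mul, add_zero, Real.exp_add, prod_mul_distrib]
  ring

lemma wigW_nonneg (p : ℕ) (b : ℝ) (m : ℕ) (z : ℝ) {x : Fin m → ℝ} (hx : x ∈ orth m) :
    0 ≤ wigW p b m z x := by
  rw [wigW_natCast]
  exact mul_nonneg (prod_wt_pos b z hx).le (npv_nonneg p x)

lemma measurable_wigW (p : ℕ) (b : ℝ) (m : ℕ) (z : ℝ) :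
    Measurable fun x : Fin m → ℝ => wigW p b m z x := by
  simp only [wigW_natCast, npv]
  refine (measurable_prod_wt b z m).mul ?_
  fun_prop

/-- Integrals of powers of the trace against the deformed weight. -/
noncomputable def zmom (p : ℕ) (b : ℝ) (m k : ℕ) (z : ℝ) : ℝ :=
  ∫ x in orth m, wigW p b m z x * psum 1 x ^ k

/-- The measure with the undeformed weight. -/
noncomputable def baseMeasure (p : ℕ) (b : ℝ) (m : ℕ) : Measure (Fin m → ℝ) :=
  (volume.restrict (orth m)).withDensity fun x => ENNReal.ofReal (wigW p b m 0 x)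

lemma zmom_eq (p : ℕ) (b : ℝ) (m k : ℕ) (z : ℝ) :
    zmom p b m k z = ∫ x, psum 1 x ^ k * Real.exp (z * psum 1 x) ∂baseMeasure p b m := by
  rw [baseMeasure, integral_withDensity_eq_integral_toReal_smul
    (measurable_wigW p b m 0).ennreal_ofReal (by simp), zmom]
  refine setIntegral_congr_fun (measurableSet_orth m) fun x hx => ?_
  simp only [smul_eq_mul]
  rw [ENNReal.toReal_ofReal (wigW_nonneg p b m 0 hx), wigW_eq_mul_exp]
  ring

lemma integrableOn_wigW (p : ℕ) (b : ℝ) (m : ℕ) {z : ℝ} (hz : z < 0) :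
    IntegrableOn (fun x => wigW p b m z x) (orth m) := by
  have := isFiniteMeasure_wtMeasure b hz
  simpa using integrableOn_wigW_mul b hz p m (AllMoments.const 1)

lemma mem_interior_integrableExpSet (p : ℕ) (b : ℝ) (m : ℕ) {z : ℝ} (hz : z < 0) :
    z ∈ interior (ProbabilityTheory.integrableExpSet (psum 1) (baseMeasure p b m)) := by
  refine interior_mono (s := Set.Iio 0) (fun w hw => ?_) (by simpa using hz)
  have h := integrableOn_wigW p b m (show w < 0 from hw)
  rw [ProbabilityTheory.integrableExpSet, Set.mem_ofPred_eq, baseMeasure,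
    integrable_withDensity_iff_integrable_smul' (measurable_wigW p b m 0).ennreal_ofReal (by simp)]
  refine IntegrableOn.congr_fun h (fun x hx => ?_) (measurableSet_orth m)
  simp only [smul_eq_mul]
  rw [ENNReal.toReal_ofReal (wigW_nonneg p b m 0 hx), wigW_eq_mul_exp]

lemma hasDerivAt_zmom (p : ℕ) (b : ℝ) (m k : ℕ) {z : ℝ} (hz : z < 0) :
    HasDerivAt (zmom p b m k) (zmom p b m (k + 1) z) z := by
  have h := ProbabilityTheory.hasDerivAt_integral_pow_mul_exp_real
    (mem_interior_integrableExpSet p b m hz) k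
  rw [zmom_eq]
  exact h.congr_of_eventuallyEq (Eventually.of_forall fun w => zmom_eq p b m k w)

lemma analyticAt_zmom_zero (p : ℕ) (b : ℝ) (m : ℕ) {z : ℝ} (hz : z < 0) :
    AnalyticAt ℝ (zmom p b m 0) z := by
  have h := ProbabilityTheory.analyticAt_mgf (mem_interior_integrableExpSet p b m hz)
  refine h.congr (Eventually.of_forall fun w => ?_)
  simp [zmom_eq, ProbabilityTheory.mgf]

lemma npv_pos {p m : ℕ} {x : Fin m → ℝ} (hx : Function.Injective x) : 0 < npv p x := by
  rw [npv_eq_abs_det]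
  exact pow_pos (abs_pos.2 (Matrix.det_vandermonde_ne_zero_iff.2 hx)) p

lemma integral_wigW_pos {p : ℕ} {b : ℝ} {m : ℕ} {z : ℝ}
    (h : IntegrableOn (fun x => wigW p b m z x) (orth m)) : 0 < ∫ x in orth m, wigW p b m z x := by
  rw [setIntegral_pos_iff_support_of_nonneg_ae ?_ h]
  · let U : Set (Fin m → ℝ) := Set.univ.pi fun i => Set.Ioo (i : ℝ) (i + 1)
    have hU : IsOpen U := isOpen_set_pi Set.finite_univ fun _ _ => isOpen_Ioo
    have hne : U.Nonempty := ⟨fun i => i + 1 / 2, fun i _ => ⟨by simp, by norm_num⟩⟩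
    refine (hU.measure_pos volume hne).trans_le (measure_mono fun x hx => ?_)
    have hx' : ∀ i : Fin m, (i : ℝ) < x i ∧ x i < i + 1 := fun i => hx i trivial
    have horth : x ∈ orth m := fun i _ => (Nat.cast_nonneg _).trans_lt (hx' i).1
    refine ⟨?_, horth⟩
    have hinj : Function.Injective x := by
      intro i j hij
      have h1 := hx' i
      have h2 := hx' j
      rw [hij] at h1
      have h3 : (i : ℝ) < j + 1 := h1.1.trans h2.2
      have h4 : (j : ℝ) < i + 1 := h2.1.trans h1.2
      norm_cast at h3 h4
      omega
    rw [Function.mem_support, wigW_natCast]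
    exact (mul_pos (prod_wt_pos b z horth) (npv_pos hinj)).ne'
  · filter_upwards [ae_restrict_mem (measurableSet_orth m)] with x hx using wigW_nonneg p b m z hx

lemma zmom_zero_pos (p : ℕ) (b : ℝ) (m : ℕ) {z : ℝ} (hz : z < 0) : 0 < zmom p b m 0 z := by
  simpa [zmom] using integral_wigW_pos (integrableOn_wigW p b m hz)

end ExponentialMoments

section Normalization

lemma integrableOn_wt_zero {b : ℝ} (hb : 1 < b) : IntegrableOn (wt b 0) (Set.Ioi 0) := by
  rw [← Set.Ioc_union_Ioi_eq_Ioi zero_le_one]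
  refine IntegrableOn.union ?_ ?_
  · obtain ⟨N, hN⟩ := exists_nat_gt b
    refine Measure.integrableOn_of_bounded (M := N.factorial) (by simp)
      (measurable_wt b 0).aestronglyMeasurable ?_
    filter_upwards [ae_restrict_mem measurableSet_Ioc] with x hx
    rw [Real.norm_of_nonneg (wt_pos b 0 hx.1).le]
    refine (wt_le b 0 N hx.1).trans ?_
    have h := Real.rpow_le_one hx.1.le hx.2 (by linarith : (0 : ℝ) ≤ N - b)
    simp only [zero_mul, Real.exp_zero, mul_one]
    exact mul_le_of_le_one_right (by positivity) h
  · refine Integrable.mono' (integrableOn_Ioi_rpow_of_lt (a := -b) (by linarith) one_pos)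
      (measurable_wt b 0).aestronglyMeasurable ?_
    filter_upwards [ae_restrict_mem measurableSet_Ioi] with x hx
    have hx0 : 0 < x := one_pos.trans hx
    rw [Real.norm_of_nonneg (wt_pos b 0 hx0).le]
    simpa using wt_le b 0 0 hx0

lemma integrableOn_wt_mul_pow {b : ℝ} {K : ℕ} (hb : 1 < b - K) :
    IntegrableOn (fun x => wt b 0 x * (1 + x) ^ K) (Set.Ioi 0) := by
  have h : IntegrableOn (fun x => ∑ k ∈ range (((1 + Polynomial.X : Polynomial ℝ) ^ K).natDegree + 1),
      ((1 + Polynomial.X : Polynomial ℝ) ^ K).coeff k * wt (b - k) 0 x) (Set.Ioi 0) := by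
    refine integrable_finsetSum _ fun k hk => (integrableOn_wt_zero ?_).const_mul _
    have hd : ((1 + Polynomial.X : Polynomial ℝ) ^ K).natDegree ≤ K :=
      Polynomial.natDegree_pow_le_of_le K (m := 1) (by compute_degree) |>.trans (by simp)
    have hk' : (k : ℝ) ≤ K := by
      have := mem_range.1 hk
      exact_mod_cast (by omega : k ≤ K)
    linarith
  refine h.congr_fun (fun x hx => ?_) measurableSet_Ioi
  simp only []
  rw [← eval_mul_wt _ b 0 hx]
  simp [mul_comm]

lemma npv_le (p : ℕ) {m : ℕ} {x : Fin (m + 1) → ℝ} (hx : x ∈ orth (m + 1)) :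
    npv p x ≤ ∏ j, (1 + x j) ^ (p * m) := by
  have hpos : ∀ j, 0 < x j := fun j => hx j trivial
  induction m with
  | zero => simp [npv]
  | succ m ih =>
    have hP : |(nod (Fin.removeNth 0 x)).eval (x 0)| ^ p ≤
        ∏ j : Fin (m + 1), ((1 + x 0) ^ p * (1 + x j.succ) ^ p) := by
      rw [eval_nod, abs_prod, ← prod_pow]
      refine prod_le_prod (fun j _ => by positivity) fun j _ => ?_
      rw [← mul_pow]
      refine pow_le_pow_left₀ (abs_nonneg _) ?_ p
      have h0 := hpos 0
      have h1 := hpos j.succ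
      have h01 := mul_pos h0 h1
      simp only [Fin.removeNth, Fin.succAbove_zero]
      rw [abs_le]
      constructor <;> nlinarith
    have hI := ih (x := Fin.removeNth 0 x) (fun j _ => hpos _) fun j => hpos _
    rw [npv_removeNth p x 0]
    refine (mul_le_mul hI hP (by positivity) (prod_nonneg fun j _ => ?_)).trans (le_of_eq ?_)
    · have := hpos ((0 : Fin (m + 2)).succAbove j)
      simp only [Fin.removeNth]
      positivity
    · rw [Fin.prod_univ_succ fun j => (1 + x j) ^ (p * (m + 1)), prod_mul_distrib, prod_const, card_univ, Fintype.card_fin,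
        mul_left_comm, ← prod_mul_distrib, ← pow_mul]
      congr 1
      refine prod_congr rfl fun j _ => ?_
      simp only [Fin.removeNth, Fin.succAbove_zero]
      rw [← pow_add]
      ring_nf

lemma integrableOn_wigW_zero {p : ℕ} {b : ℝ} {m : ℕ} (hb : 1 < b - p * m) :
    IntegrableOn (fun x => wigW p b (m + 1) 0 x) (orth (m + 1)) := by
  have h1 : IntegrableOn (fun x => wt b 0 x * (1 + x) ^ (p * m)) (Set.Ioi 0) :=
    integrableOn_wt_mul_pow (by exact_mod_cast hb)
  have h2 := Integrable.fintype_prod (ι := Fin (m + 1))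
    (μ := fun _ => (volume : Measure ℝ).restrict (Set.Ioi 0))
    (f := fun _ x => wt b 0 x * (1 + x) ^ (p * m)) fun _ => h1
  rw [← Measure.restrict_pi_pi, ← volume_pi] at h2
  refine Integrable.mono' h2 (measurable_wigW p b (m + 1) 0).aestronglyMeasurable ?_
  filter_upwards [ae_restrict_mem (measurableSet_orth (m + 1))] with x hx
  rw [Real.norm_of_nonneg (wigW_nonneg p b _ 0 hx), wigW_natCast, prod_mul_distrib]
  exact mul_le_mul_of_nonneg_left (npv_le p hx) (prod_wt_pos b 0 hx).le

lemma mNorm_pos {p : ℕ} {b : ℝ} {m : ℕ} (hm : m ≠ 0) (hb : 1 < b - p * (m - 1)) :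
    0 < mNorm p b m := by
  obtain ⟨m, rfl⟩ := Nat.exists_eq_succ_of_ne_zero hm
  refine integral_wigW_pos (integrableOn_wigW_zero ?_)
  push_cast at hb
  simpa using hb

end Normalization

section Assembly

open scoped Topology ContDiff

lemma cumulant_ode_of_moments {β η n b z a₁ a₂ a₃ a₄ e₂ e₁₂ e₂₂ e₃ e₁₃ D : ℝ}
    (l₁ : (2 + β * (n - 1) - b) * a₁ + n + z * e₂ = 0)
    (l₂ : (2 + β * (n - 1) - b) * a₂ + n * a₁ + z * e₁₂ + e₂ = 0)
    (l₃ : (2 + β * (n - 1) - b) * e₁₂ + n * e₂ + z * e₂₂ + 2 * e₃ = 0)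
    (l₄ : (3 + β * (n - 1) - β / 2 - b) * e₂ + β / 2 * a₂ + a₁ + z * e₃ = 0)
    (l₅ : (3 + β * (n - 1) - β / 2 - b) * e₁₂ + β / 2 * a₃ + a₂ + z * e₁₃ + e₃ = 0)
    (h : η * (a₄ - 4 * a₁ * a₃ + 3 * a₂ ^ 2) - 4 * (e₁₃ - a₁ * e₃) + 3 * (e₂₂ - e₂ ^ 2) = D) :
    η * z ^ 3 * (a₄ - 4 * a₃ * a₁ - 3 * a₂ ^ 2 + 12 * a₂ * a₁ ^ 2 - 6 * a₁ ^ 4)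
      + 2 * β * z ^ 2 * (a₃ - 3 * a₁ * a₂ + 2 * a₁ ^ 3)
      + β * z * a₁ ^ 2
      + 4 * β * z ^ 2 * (a₂ - a₁ ^ 2) * a₁
      + 6 * η * z ^ 3 * (a₂ - a₁ ^ 2) ^ 2
      + (4 * z ^ 2 + β * z - (b - β * n - 6 + 3 * β) * (b - β * n - 2 + β) * z) * (a₂ - a₁ ^ 2)
      + (2 * z - (b - β * n - 2 + β) * (b - β * n)) * a₁
      + n * (b - β * n) = z ^ 3 * D := by
  linear_combination z ^ 3 * h + 4 * z ^ 2 * l₅ - 3 * z ^ 2 * l₃ + (2 * z - 4 * z ^ 2 * a₁) * l₄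
    + z * (3 * (2 + β * (n - 1) - b) - 4 * (3 + β * (n - 1) - β / 2 - b)) * l₂
    + (3 * z ^ 2 * e₂ + (4 * (3 + β * (n - 1) - β / 2 - b) - 3 * (2 + β * (n - 1) - b)) * z * a₁
      + (2 * (3 + β * (n - 1) - β / 2 - b) - 3 * (2 + β * (n - 1) - b))) * l₁

lemma mwig_eq (p : ℕ) (b : ℝ) (m : ℕ) (z : ℝ) :
    Mwig p b m z = zmom p b m 0 z / mNorm p b m := by
  simp [Mwig, zmom, orth]

lemma contDiffOn_xiWig (p : ℕ) (b : ℝ) (m : ℕ) :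
    ContDiffOn ℝ ∞ (xiWig p b m) (Set.Iio 0) := by
  have h : xiWig p b m = fun z => Real.log (zmom p b m 0 z / mNorm p b m) :=
    funext fun z => by rw [xiWig, mwig_eq]
  rw [h]
  by_cases hN : mNorm p b m = 0
  · simpa [hN] using contDiffOn_const
  · intro z hz
    exact (((analyticAt_zmom_zero p b m hz).contDiffAt.div_const _).log
      (div_ne_zero (zmom_zero_pos p b m hz).ne' hN)).contDiffWithinAt

lemma exp_xiWig {p : ℕ} {b : ℝ} {m : ℕ} (hN : 0 < mNorm p b m) {z : ℝ} (hz : z < 0) :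
    Real.exp (xiWig p b m z) = zmom p b m 0 z / mNorm p b m := by
  rw [xiWig, mwig_eq, Real.exp_log (div_pos (zmom_zero_pos p b m hz) hN)]

/-- The normalized moments of the trace. -/
noncomputable def trMom (p : ℕ) (b : ℝ) (m k : ℕ) (z : ℝ) : ℝ := zmom p b m k z / zmom p b m 0 z

lemma hasDerivAt_trMom (p : ℕ) (b : ℝ) (m k : ℕ) {z : ℝ} (hz : z < 0) :
    HasDerivAt (trMom p b m k)
      (trMom p b m (k + 1) z - trMom p b m k z * trMom p b m 1 z) z := by
  have h0 := (zmom_zero_pos p b m hz).ne'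
  refine ((hasDerivAt_zmom p b m k hz).fun_div (hasDerivAt_zmom p b m 0 hz) h0).congr_deriv ?_
  simp only [trMom]
  field_simp

lemma hasDerivAt_xiWig {p : ℕ} {b : ℝ} {m : ℕ} (hN : mNorm p b m ≠ 0) {z : ℝ} (hz : z < 0) :
    HasDerivAt (xiWig p b m) (trMom p b m 1 z) z := by
  have h0 := (zmom_zero_pos p b m hz).ne'
  have h := ((hasDerivAt_zmom p b m 0 hz).div_const (mNorm p b m)).log (div_ne_zero h0 hN)
  refine (h.congr_deriv ?_).congr_of_eventuallyEq
    (Eventually.of_forall fun w => by rw [xiWig, mwig_eq])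
  simp only [trMom]
  field_simp

lemma iteratedDeriv_succ_of_forall_neg {f g : ℝ → ℝ} {k : ℕ} {z g' : ℝ}
    (h : ∀ w < 0, iteratedDeriv k f w = g w) (hz : z < 0) (hg : HasDerivAt g g' z) :
    iteratedDeriv (k + 1) f z = g' := by
  rw [iteratedDeriv_succ, ← hg.deriv]
  refine EventuallyEq.deriv_eq ?_
  filter_upwards [Iio_mem_nhds hz] with w hw using h w hw

section Cumulants

variable {p : ℕ} {b : ℝ} {m : ℕ}

lemma iteratedDeriv_one_xiWig (hN : mNorm p b m ≠ 0) {z : ℝ} (hz : z < 0) :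
    iteratedDeriv 1 (xiWig p b m) z = trMom p b m 1 z := by
  rw [iteratedDeriv_one]
  exact (hasDerivAt_xiWig hN hz).deriv

lemma iteratedDeriv_two_xiWig (hN : mNorm p b m ≠ 0) {z : ℝ} (hz : z < 0) :
    iteratedDeriv 2 (xiWig p b m) z = trMom p b m 2 z - trMom p b m 1 z ^ 2 :=
  iteratedDeriv_succ_of_forall_neg (fun _ hw => iteratedDeriv_one_xiWig hN hw) hz
    ((hasDerivAt_trMom p b m 1 hz).congr_deriv (by ring))

lemma iteratedDeriv_three_xiWig (hN : mNorm p b m ≠ 0) {z : ℝ} (hz : z < 0) :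
    iteratedDeriv 3 (xiWig p b m) z =
      trMom p b m 3 z - 3 * trMom p b m 1 z * trMom p b m 2 z + 2 * trMom p b m 1 z ^ 3 :=
  iteratedDeriv_succ_of_forall_neg (fun _ hw => iteratedDeriv_two_xiWig hN hw) hz
    (((hasDerivAt_trMom p b m 2 hz).sub ((hasDerivAt_trMom p b m 1 hz).fun_pow 2)).congr_deriv
      (by push_cast; ring))

lemma iteratedDeriv_four_xiWig (hN : mNorm p b m ≠ 0) {z : ℝ} (hz : z < 0) :
    iteratedDeriv 4 (xiWig p b m) z =
      trMom p b m 4 z - 4 * trMom p b m 3 z * trMom p b m 1 z - 3 * trMom p b m 2 z ^ 2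
        + 12 * trMom p b m 2 z * trMom p b m 1 z ^ 2 - 6 * trMom p b m 1 z ^ 4 := by
  have h1 := hasDerivAt_trMom p b m 1 hz
  have h2 := hasDerivAt_trMom p b m 2 hz
  have h3 := hasDerivAt_trMom p b m 3 hz
  exact iteratedDeriv_succ_of_forall_neg (fun _ hw => iteratedDeriv_three_xiWig hN hw) hz
    (((h3.fun_sub ((h1.const_mul 3).fun_mul h2)).fun_add ((h1.fun_pow 3).const_mul 2)).congr_deriv
      (by push_cast; ring))

lemma mom_wtMeasure_zero (p : ℕ) (b : ℝ) (m : ℕ) {z : ℝ} (hz : z < 0) :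
    mom (wtMeasure b z) p m (fun _ => 1) = zmom p b m 0 z := by
  simp [mom_wtMeasure b hz, zmom]

lemma mom_wtMeasure_psum_one (p : ℕ) (b : ℝ) (m : ℕ) {z : ℝ} (hz : z < 0) :
    mom (wtMeasure b z) p m (psum 1) = zmom p b m 1 z := by
  simp [mom_wtMeasure b hz, zmom]

lemma mom_wtMeasure_psum_one_pow (p : ℕ) (b : ℝ) (m k : ℕ) {z : ℝ} (hz : z < 0) :
    mom (wtMeasure b z) p m (fun X => psum 1 X ^ k) = zmom p b m k z :=
  mom_wtMeasure b hz p m _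

lemma xiWig_ode {η d z : ℝ} (hz : z < 0) (hp : p ≠ 0) (hm : m ≠ 0) (hN : mNorm p b m ≠ 0)
    (h : let M := mom (wtMeasure b z) p m
      η * (M (fun _ => 1) * M (fun X => psum 1 X ^ 4) - 4 * M (psum 1) * M (fun X => psum 1 X ^ 3)
          + 3 * M (fun X => psum 1 X ^ 2) ^ 2)
        - 4 * (M (fun _ => 1) * M (fun X => psum 1 X * psum 3 X) - M (psum 1) * M (psum 3))
        + 3 * (M (fun _ => 1) * M (fun X => psum 2 X ^ 2) - M (psum 2) ^ 2) = d) :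
    η * z ^ 3 * iteratedDeriv 4 (xiWig p b m) z
        + 2 * p * z ^ 2 * iteratedDeriv 3 (xiWig p b m) z
        + p * z * (deriv (xiWig p b m) z) ^ 2
        + 4 * p * z ^ 2 * iteratedDeriv 2 (xiWig p b m) z * deriv (xiWig p b m) z
        + 6 * η * z ^ 3 * (iteratedDeriv 2 (xiWig p b m) z) ^ 2
        + (4 * z ^ 2 + p * z - (b - p * m - 6 + 3 * p) * (b - p * m - 2 + p) * z) *
            iteratedDeriv 2 (xiWig p b m) z
        + (2 * z - (b - p * m - 2 + p) * (b - p * m)) * deriv (xiWig p b m) z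
        + m * (b - p * m)
      = z ^ 3 * (d / zmom p b m 0 z ^ 2) := by
  have h0 := (zmom_zero_pos p b m hz).ne'
  obtain ⟨l1, l2, l3, l4, l5⟩ := loop_equations (b := b) hz hp hm
  simp only [mom_wtMeasure_zero p b m hz, mom_wtMeasure_psum_one p b m hz,
    mom_wtMeasure_psum_one_pow p b m _ hz] at h l1 l2 l3 l4 l5
  set E := fun f => mom (wtMeasure b z) p m f / zmom p b m 0 z with hE
  rw [(hasDerivAt_xiWig hN hz).deriv, iteratedDeriv_two_xiWig hN hz,
    iteratedDeriv_three_xiWig hN hz, iteratedDeriv_four_xiWig hN hz]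
  refine cumulant_ode_of_moments (e₂ := E (psum 2)) (e₃ := E (psum 3))
    (e₁₂ := E fun X => psum 1 X * psum 2 X) (e₂₂ := E fun X => psum 2 X ^ 2)
    (e₁₃ := E fun X => psum 1 X * psum 3 X) ?_ ?_ ?_ ?_ ?_ ?_ <;>
  simp only [hE, trMom] <;> field_simp
  · linear_combination l1
  · linear_combination l2
  · linear_combination l3
  · linear_combination 2 * l4
  · linear_combination 2 * l5
  · linear_combination h

end Cumulants

lemma integral_hir_one_eq_zmom (b : ℝ) {z : ℝ} (hz : z < 0) (m : ℕ) :
    ∫ w, hir 1 w.1 w.2 ∂(powMeasure (wtMeasure b z) (m + 3)).prod (powMeasure (wtMeasure b z) (m + 3))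
      = (m + 3) * (m + 2) / ((m + 4) * (m + 5)) * (zmom 1 b (m + 1) 0 z * zmom 1 b (m + 5) 0 z) := by
  have := isFiniteMeasure_wtMeasure b hz
  have h := integral_hir_one (m := m + 1) (allMoments_wtMeasure b hz)
  rw [mom_wtMeasure_zero _ _ _ hz, mom_wtMeasure_zero _ _ _ hz] at h
  push_cast at h
  rw [div_mul_eq_mul_div, eq_div_iff (by positivity)]
  linear_combination h

lemma integral_hir4_eq_zmom (b : ℝ) {z : ℝ} (hz : z < 0) (m : ℕ) :
    ∫ w, hir4 w.1 w.2 ∂(powMeasure (wtMeasure b z) (m + 2)).prod (powMeasure (wtMeasure b z) (m + 2))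
      = (m + 2) / (m + 3) * (zmom 4 b (m + 1) 0 z * zmom 4 b (m + 3) 0 z) := by
  have := isFiniteMeasure_wtMeasure b hz
  have h := integral_hir4 (m := m + 1) (allMoments_wtMeasure b hz)
  rw [mom_wtMeasure_zero _ _ _ hz, mom_wtMeasure_zero _ _ _ hz] at h
  push_cast at h
  rw [div_mul_eq_mul_div, eq_div_iff (by positivity)]
  linear_combination h

lemma exp_xiWig_combination {p : ℕ} {b : ℝ} {k l m : ℕ} (hk : 0 < mNorm p b k)
    (hl : 0 < mNorm p b l) (hm : 0 < mNorm p b m) {z : ℝ} (hz : z < 0) :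
    mNorm p b k * mNorm p b l / mNorm p b m ^ 2 *
        Real.exp (xiWig p b k z + xiWig p b l z - 2 * xiWig p b m z) =
      zmom p b k 0 z * zmom p b l 0 z / zmom p b m 0 z ^ 2 := by
  have h0 := (zmom_zero_pos p b m hz).ne'
  rw [Real.exp_sub, Real.exp_add, two_mul, Real.exp_add, exp_xiWig hk hz, exp_xiWig hl hz,
    exp_xiWig hm hz]
  field_simp

end Assembly

end WignerDelay

open WignerDelay in
/-- The nonlinear ODE satisfied by the cumulant generating function of the Wigner
delay time, for `β ∈ {1,2,4}`. -/
theorem wigner_cgf_ode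
    (β : ℝ) (hβ : β = 1 ∨ β = 2 ∨ β = 4)
    (n : ℕ) (hn : 1 ≤ n) (hn1 : β = 1 → 3 ≤ n) (hn4 : β = 4 → 2 ≤ n)
    (b : ℝ) (hb : b = 3 * β * n / 2 + 2 - β) :
    (∀ m : ℕ, ContDiffOn ℝ (⊤ : ℕ∞) (xiWig β b m) (Set.Iio 0)) ∧
    ∀ z : ℝ, z < 0 →
      eta β * z ^ 3 * iteratedDeriv 4 (xiWig β b n) z
        + 2 * β * z ^ 2 * iteratedDeriv 3 (xiWig β b n) z
        + β * z * (deriv (xiWig β b n) z) ^ 2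
        + 4 * β * z ^ 2 * iteratedDeriv 2 (xiWig β b n) z * deriv (xiWig β b n) z
        + 6 * eta β * z ^ 3 * (iteratedDeriv 2 (xiWig β b n) z) ^ 2
        + (4 * z ^ 2 + β * z - (b - β * n - 6 + 3 * β) * (b - β * n - 2 + β) * z) *
            iteratedDeriv 2 (xiWig β b n) z
        + (2 * z - (b - β * n - 2 + β) * (b - β * n)) * deriv (xiWig β b n) z
        + n * (b - β * n)
      = (12 * dcoef β b n / β) * z ^ 3 *
          Real.exp (xiWig β b (n - ibeta β) z + xiWig β b (n + ibeta β) z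
            - 2 * xiWig β b n z) := by
  have hn0 : n ≠ 0 := by omega
  obtain rfl | rfl | rfl := hβ
  · refine ⟨fun m => by simpa using contDiffOn_xiWig 1 b m, fun z hz => ?_⟩
    have := isFiniteMeasure_wtMeasure b hz
    obtain ⟨m, rfl⟩ := Nat.exists_eq_add_of_le' (hn1 rfl)
    push_cast at hb
    have hm := Nat.cast_nonneg (α := ℝ) m
    have hN : 0 < mNorm (1 : ℕ) b (m + 3) := mNorm_pos (by omega) (by push_cast; linarith)
    have hk : 0 < mNorm (1 : ℕ) b (m + 1) := mNorm_pos (by omega) (by push_cast; linarith)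
    have hl : 0 < mNorm (1 : ℕ) b (m + 5) := mNorm_pos (by omega) (by push_cast; linarith)
    have hE := integral_hir_eq (allMoments_wtMeasure b hz) 1 (m + 3)
    rw [integral_hir_one_eq_zmom b hz] at hE
    have h := xiWig_ode (η := 1) hz one_ne_zero hn0 hN.ne' (by simp only [one_mul]; exact hE.symm)
    have hX := exp_xiWig_combination hk hl hN hz
    simp only [Nat.cast_one] at h hX
    simp only [eta, ibeta, dcoef, show (1 : ℝ) ≠ 4 by norm_num, if_true, if_false,
      show m + 3 - 2 = m + 1 from rfl, show m + 3 + 2 = m + 5 from rfl]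
    rw [h]
    have h1 : ((m : ℝ) + 3) - 1 = m + 2 := by ring
    have h2 : ((m : ℝ) + 3) + 1 = m + 4 := by ring
    have h3 : ((m : ℝ) + 3) + 2 = m + 5 := by ring
    push_cast
    rw [h1, h2, h3]
    linear_combination -12 * z ^ 3 * ((m + 3) * (m + 2) / ((m + 4) * (m + 5))) * hX
  · refine ⟨fun m => by simpa using contDiffOn_xiWig 2 b m, fun z hz => ?_⟩
    have := isFiniteMeasure_wtMeasure b hz
    obtain ⟨m, rfl⟩ := Nat.exists_eq_add_of_le' hn
    have hN : 0 < mNorm (2 : ℕ) b (m + 1) := mNorm_pos (by omega) (by push_cast at *; linarith)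
    have hE := integral_hir_eq (allMoments_wtMeasure b hz) 2 (m + 1)
    rw [integral_hir_two (allMoments_wtMeasure b hz), mul_zero] at hE
    have h := xiWig_ode (η := 1) (d := 0) hz two_ne_zero hn0 hN.ne' (by simp only [one_mul]; exact hE.symm)
    norm_num [eta, dcoef] at h ⊢
    exact h
  · refine ⟨fun m => by simpa using contDiffOn_xiWig 4 b m, fun z hz => ?_⟩
    have := isFiniteMeasure_wtMeasure b hz
    obtain ⟨m, rfl⟩ := Nat.exists_eq_add_of_le' (hn4 rfl)
    push_cast at hb
    have hm := Nat.cast_nonneg (α := ℝ) m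
    have hN : 0 < mNorm (4 : ℕ) b (m + 2) := mNorm_pos (by omega) (by push_cast; linarith)
    have hk : 0 < mNorm (4 : ℕ) b (m + 1) := mNorm_pos (by omega) (by push_cast; linarith)
    have hl : 0 < mNorm (4 : ℕ) b (m + 3) := mNorm_pos (by omega) (by push_cast; linarith)
    have hE := integral_hir4_eq (allMoments_wtMeasure b hz) (m + 2)
    rw [integral_hir4_eq_zmom b hz] at hE
    have h := xiWig_ode (η := 4) hz four_ne_zero hn0 hN.ne' hE.symm
    have hX := exp_xiWig_combination hk hl hN hz
    simp only [Nat.cast_ofNat] at h hX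
    simp only [eta, ibeta, dcoef, show (4 : ℝ) ≠ 1 by norm_num, if_true, if_false,
      show m + 2 - 1 = m + 1 from rfl, show m + 2 + 1 = m + 3 from rfl]
    rw [h]
    have h1 : ((m : ℝ) + 2) + 1 = m + 3 := by ring
    push_cast
    rw [h1]
    linear_combination -3 * z ^ 3 * ((m + 2) / (m + 3)) * hX
end

section
/- Let a, d ∈ ℝ, let I ⊆ ℝ be an open interval, and let H : I → ℝ be three times continuously differentiable and satisfy on I the third-order ODE z²H''' + zH'' + 6z(H')² − 4HH' − (4z + a)H' + 2H − d = 0. Then the function z ↦ (zH''(z))² − 4H(z)((H'(z))² − H'(z)) + (4z(H'(z))² − (4z + a)H'(z) − 2d)·H'(z) is constant on I. (In particular, with a = (b−2n)², d = n(b−2n) and constant value n², the function H_n(z) = −z·(d/dz)ξ_n^{(2)}(−z) built from the Wigner delay time generating function satisfies the second-order equation (zH_n'')² = 4H_n((H_n')² − H_n') − (4z(H_n')² − (4z + (b−2n)²)H_n' − 2n(b−2n))H_n' + n², the Jimbo–Miwa–Okamoto σ-form of Painlevé III'.) -/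
/-- On an open set, a `C^n` function has iterated derivatives of order `< n` that are
differentiable, with the expected derivative. -/
theorem ContDiffOn.hasDerivAt_iteratedDeriv_of_isOpen {f : ℝ → ℝ} {s : Set ℝ} {n : WithTop ℕ∞}
    (hs : IsOpen s) (hf : ContDiffOn ℝ n f s) {k : ℕ} (hk : (k : WithTop ℕ∞) < n)
    {x : ℝ} (hx : x ∈ s) :
    HasDerivAt (iteratedDeriv k f) (iteratedDeriv (k + 1) f x) x := by
  rw [iteratedDeriv_succ]
  have h := (hf.differentiableOn_iteratedDerivWithin hk hs.uniqueDiffOn).congr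
    fun y hy => (iteratedDerivWithin_of_isOpen hs hy).symm
  exact (h.differentiableAt (hs.mem_nhds hx)).hasDerivAt

/-- Cosgrove's first integral of the Chazy-class ODE
`z²H''' + zH'' + 6z(H')² − 4HH' − (4z+a)H' + 2H − d = 0`:
for any C³ solution `H` on an open interval `I`, the expression
`(zH'')² − 4H((H')² − H') + (4z(H')² − (4z+a)H' − 2d)H'` is constant on `I`. -/
theorem chazy_first_integral
    (a d : ℝ) (I : Set ℝ) (hIopen : IsOpen I) (hIconn : I.OrdConnected)
    (H : ℝ → ℝ) (hH : ContDiffOn ℝ 3 H I)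
    (hode : ∀ z ∈ I,
      z ^ 2 * iteratedDeriv 3 H z + z * iteratedDeriv 2 H z
        + 6 * z * (deriv H z) ^ 2 - 4 * H z * deriv H z
        - (4 * z + a) * deriv H z + 2 * H z - d = 0) :
    ∃ c : ℝ, ∀ z ∈ I,
      (z * iteratedDeriv 2 H z) ^ 2
        - 4 * H z * ((deriv H z) ^ 2 - deriv H z)
        + (4 * z * (deriv H z) ^ 2 - (4 * z + a) * deriv H z - 2 * d) * deriv H z = c := by
  suffices hF : ∀ z ∈ I, HasDerivAt (fun z =>
      (z * iteratedDeriv 2 H z) ^ 2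
        - 4 * H z * ((deriv H z) ^ 2 - deriv H z)
        + (4 * z * (deriv H z) ^ 2 - (4 * z + a) * deriv H z - 2 * d) * deriv H z) 0 z from
    hIopen.exists_is_const_of_deriv_eq_zero hIconn.isPreconnected
      (fun z hz => (hF z hz).differentiableAt.differentiableWithinAt)
      (fun z hz => (hF z hz).deriv)
  intro z hz
  have h0 : HasDerivAt H (deriv H z) z := by
    simpa using hH.hasDerivAt_iteratedDeriv_of_isOpen hIopen (k := 0) (by norm_num) hz
  have h1 : HasDerivAt (deriv H) (iteratedDeriv 2 H z) z := by
    simpa using hH.hasDerivAt_iteratedDeriv_of_isOpen hIopen (k := 1) (by norm_num) hz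
  have h2 : HasDerivAt (iteratedDeriv 2 H) (iteratedDeriv 3 H z) z :=
    hH.hasDerivAt_iteratedDeriv_of_isOpen hIopen (k := 2) (by norm_num) hz
  have hid := hasDerivAt_id' z
  have h4 := hid.const_mul 4
  have hder := (((hid.mul h2).pow 2).sub ((h0.const_mul 4).mul ((h1.pow 2).sub h1))).add
    ((((h4.mul (h1.pow 2)).sub ((h4.add_const a).mul h1)).sub_const (2 * d)).mul h1)
  refine hder.congr_deriv ?_
  simp only [Pi.mul_apply, Pi.pow_apply, Pi.sub_apply]
  push_cast
  linear_combination (2 * iteratedDeriv 2 H z) * hode z hz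
end

section
/- Let (p_l)_{l≥1} be the sequence of rational numbers determined by p_1 = 1 and the recurrence (l+1)·p_{l+1} = 2(2l−1)·p_l + 2·∑_{i=0}^{l−1} (3i+1)(l−i)·p_{i+1}·p_{l−i} for all l ≥ 1. Then p_l is an integer for every l ≥ 1. -/
open Finset

open PowerSeries in
/-- An `X`-adically contracting self-map of the ideal `(X)` in `ℤ⟦X⟧` has a fixed point there. -/
theorem exists_fixed_point_of_contracting (F : ℤ⟦X⟧ → ℤ⟦X⟧)
    (hX : ∀ v, X ∣ v → X ∣ F v)
    (hF : ∀ v w, X ∣ v → X ∣ w → X * (v - w) ∣ F v - F w) :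
    ∃ v : ℤ⟦X⟧, X ∣ v ∧ F v = v := by
  let s : ℕ → ℤ⟦X⟧ := fun k => F^[k] 0
  have s_succ : ∀ k, s (k + 1) = F (s k) := fun k => Function.iterate_succ_apply' F k 0
  have hs : ∀ k, X ∣ s k := by
    intro k
    induction k with
    | zero => exact dvd_zero _
    | succ k ih => rw [s_succ]; exact hX _ ih
  have step : ∀ k, X ^ k ∣ s (k + 1) - s k := by
    intro k
    induction k with
    | zero => simp
    | succ k ih =>
      have h := (mul_dvd_mul_left X ih).trans (hF _ _ (hs (k + 1)) (hs k))
      rwa [← pow_succ', ← s_succ (k + 1), ← s_succ k] at h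
  have far : ∀ k m, X ^ k ∣ s (k + m) - s k := by
    intro k m
    induction m with
    | zero => simp
    | succ m ih =>
      have h := (pow_dvd_pow X (Nat.le_add_right k m)).trans (step (k + m))
      have := dvd_add h ih
      rwa [sub_add_sub_cancel] at this
  let v : ℤ⟦X⟧ := PowerSeries.mk fun n => coeff n (s (n + 1))
  have hv : ∀ k, X ^ k ∣ v - s k := by
    intro k
    rw [X_pow_dvd_iff]
    intro n hn
    obtain ⟨m, rfl⟩ := Nat.exists_eq_add_of_le (Nat.succ_le_of_lt hn)
    have h := X_pow_dvd_iff.1 (far (n + 1) m) n (Nat.lt_succ_self n)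
    rw [map_sub] at h
    simp only [v, map_sub, coeff_mk, Nat.succ_eq_add_one]
    linarith
  have hXv : X ∣ v := by
    have h := dvd_add ((pow_one (X : ℤ⟦X⟧)) ▸ hv 1) (hs 1)
    rwa [sub_add_cancel] at h
  refine ⟨v, hXv, ?_⟩
  have key : ∀ k, X ^ k ∣ F v - v := by
    intro k
    have h1 : X ^ k ∣ F v - F (s k) :=
      ((hv k).trans (dvd_mul_left _ _)).trans (hF v (s k) hXv (hs k))
    have h2 : X ^ k ∣ v - F (s k) := by
      rw [← s_succ]; exact (pow_dvd_pow X (Nat.le_succ k)).trans (hv (k + 1))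
    have h := dvd_sub h1 h2
    rwa [sub_sub_sub_cancel_right] at h
  rw [← sub_eq_zero]
  ext n
  simpa using X_pow_dvd_iff.1 (key (n + 1)) n (Nat.lt_succ_self n)

open PowerSeries in
/-- The algebraic series `v = X + 9 X² + ⋯` uniformizing the generating function of the
leading-order cumulants. -/
theorem exists_uniformizing_series :
    ∃ v : ℤ⟦X⟧, X ∣ v ∧ v * (1 + 3 * v) = X * ((1 + 4 * v) ^ 2 * (1 + 2 * v) ^ 2) := by
  obtain ⟨v, hX, hv⟩ := exists_fixed_point_of_contracting
    (fun v => X * ((1 + 4 * v) ^ 2 * (1 + 2 * v) ^ 2) - 3 * v ^ 2)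
    (fun v hv => dvd_sub (dvd_mul_right _ _)
      ((hv.trans (dvd_pow_self v two_ne_zero)).trans (dvd_mul_left _ _)))
    (by
      rintro _ _ ⟨a, rfl⟩ ⟨b, rfl⟩
      refine ⟨((1 + 4 * (X * a)) * (1 + 2 * (X * a)) + (1 + 4 * (X * b)) * (1 + 2 * (X * b)))
        * (6 + 8 * (X * a + X * b)) - 3 * (a + b), ?_⟩
      ring)
  exact ⟨v, hX, by linear_combination -hv⟩

open PowerSeries in
/-- The generating function of the leading-order cumulants exists over `ℤ`: it is an integral
solution of the d'Alembert equation equivalent to the recurrence. -/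
theorem exists_integral_solution_dAlembert :
    ∃ P : ℤ⟦X⟧, coeff 0 P = 0 ∧ coeff 1 P = 1 ∧
      d⁄dX ℤ P - 1 = 4 * (X * d⁄dX ℤ P) - 2 * P
        + (6 * (X * d⁄dX ℤ P) - 4 * P) * d⁄dX ℤ P := by
  obtain ⟨v, hXv, hv⟩ := exists_uniformizing_series
  have hv0 : constantCoeff v = 0 := X_dvd_iff.1 hXv
  obtain ⟨A, hA⟩ : ∃ A : ℤ⟦X⟧, A = (1 + 4 * v) * (1 + 2 * v) ^ 2 := ⟨_, rfl⟩
  obtain ⟨B, hB⟩ : ∃ B : ℤ⟦X⟧, A * B = 1 :=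
    ⟨invOfUnit A 1, mul_invOfUnit A 1 (by simp [hA, hv0])⟩
  have hA0 : A ≠ 0 := left_ne_zero_of_mul_eq_one hB
  have hfac : (1 + 4 * v) ≠ 0 ∧ (1 + 2 * v) ≠ 0 := by
    constructor <;> intro h <;> apply hA0 <;> rw [hA, h] <;> ring
  obtain ⟨P, hP⟩ : ∃ P : ℤ⟦X⟧, P = v * (1 + v - 4 * v ^ 2) * B := ⟨_, rfl⟩
  have hPA : P * ((1 + 4 * v) * (1 + 2 * v) ^ 2) = v * (1 + v - 4 * v ^ 2) := by
    rw [← hA, hP]; linear_combination v * (1 + v - 4 * v ^ 2) * hB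
  have hnat : ∀ n : ℕ, d⁄dX ℤ ((n : ℤ⟦X⟧)) = 0 := fun n => Derivation.map_natCast _ n
  have d2 : d⁄dX ℤ (2 : ℤ⟦X⟧) = 0 := hnat 2
  have d3 : d⁄dX ℤ (3 : ℤ⟦X⟧) = 0 := hnat 3
  have d4 : d⁄dX ℤ (4 : ℤ⟦X⟧) = 0 := hnat 4
  have hdv := congrArg (d⁄dX ℤ) hv
  have hdP := congrArg (d⁄dX ℤ) hPA
  simp only [Derivation.leibniz, Derivation.leibniz_pow, map_add, map_sub, smul_eq_mul,
    nsmul_eq_mul, d2, d3, d4, Derivation.map_one_eq_zero, derivative_X, Nat.cast_ofNat,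
    Nat.add_one_sub_one, pow_one, mul_zero, add_zero, zero_add, mul_one] at hdv hdP
  have hdP' : d⁄dX ℤ P = 1 + 4 * v := by
    refine mul_left_cancel₀ (mul_ne_zero (pow_ne_zero 3 hfac.1) (pow_ne_zero 4 hfac.2)) ?_
    linear_combination (1 + 4 * v) * ((1 + 4 * v) * (1 + 2 * v) ^ 2) * hdP
      - (1 + 4 * v) * (4 * (1 + 2 * v) ^ 2 + 4 * (1 + 4 * v) * (1 + 2 * v)) * d⁄dX ℤ v * hPA
      + (1 + 4 * v) ^ 2 * (1 + 2 * v) ^ 2 * hdv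
      - (8 * (1 + 4 * v) * (1 + 2 * v) ^ 2 + 4 * (1 + 4 * v) ^ 2 * (1 + 2 * v))
        * d⁄dX ℤ v * hv
  refine ⟨P, ?_, ?_, ?_⟩
  · simp [hP, hv0]
  · have h := congrArg (coeff 0) hdP'
    rw [coeff_derivative] at h
    simpa [hv0] using h
  · rw [hdP']
    refine mul_left_cancel₀ (mul_ne_zero (pow_ne_zero 2 hfac.1) (pow_ne_zero 2 hfac.2)) ?_
    linear_combination (-(4 * (1 + 4 * v) + 6 * (1 + 4 * v) ^ 2)) * (-hv)
      + (6 + 16 * v) * (1 + 4 * v) * hPA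

open PowerSeries in
/-- An integer sequence satisfying the cumulant recurrence. -/
theorem exists_integral_solution_recurrence :
    ∃ c : ℕ → ℤ, c 1 = 1 ∧ ∀ l : ℕ, 1 ≤ l →
      ((l : ℤ) + 1) * c (l + 1) = 2 * (2 * (l : ℤ) - 1) * c l
        + 2 * ∑ i ∈ range l, (3 * (i : ℤ) + 1) * ((l : ℤ) - i) * c (i + 1) * c (l - i) := by
  obtain ⟨P, h0, h1, hP⟩ := exists_integral_solution_dAlembert
  refine ⟨fun n => coeff n P, h1, fun l hl => ?_⟩
  have hXd : ∀ n, coeff n (X * d⁄dX ℤ P) = n * coeff n P := by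
    rintro (_ | n)
    · simp
    · rw [coeff_succ_X_mul, coeff_derivative]; push_cast; ring
  have hnum : ∀ (k : ℤ) (n : ℕ) (f : ℤ⟦X⟧), coeff n ((k : ℤ⟦X⟧) * f) = k * coeff n f := by
    intro k n f
    rw [← zsmul_eq_mul, map_zsmul, smul_eq_mul]
  have h2 := fun n f => hnum 2 n f
  have h4 := fun n f => hnum 4 n f
  have h6 := fun n f => hnum 6 n f
  push_cast at h2 h4 h6
  have h := congrArg (coeff l) hP
  rw [map_sub, map_add, map_sub, h4, h2, hXd, coeff_derivative, coeff_one,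
    if_neg (Nat.one_le_iff_ne_zero.1 hl), coeff_mul,
    Finset.Nat.sum_antidiagonal_eq_sum_range_succ_mk, sum_range_succ'] at h
  simp only [map_sub, h6, h4, hXd, coeff_derivative, h0] at h
  have hsum : ∑ i ∈ range l, (6 * (((i + 1 : ℕ) : ℤ) * coeff (i + 1) P) - 4 * coeff (i + 1) P)
        * (coeff (l - (i + 1) + 1) P * (((l - (i + 1) : ℕ) : ℤ) + 1))
      = 2 * ∑ i ∈ range l, (3 * (i : ℤ) + 1) * ((l : ℤ) - i) * coeff (i + 1) P
        * coeff (l - i) P := by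
    rw [mul_sum]
    refine sum_congr rfl fun i hi => ?_
    have hil : i + 1 ≤ l := mem_range.1 hi
    rw [show l - (i + 1) + 1 = l - i by omega, Nat.cast_sub hil]
    push_cast
    ring
  rw [hsum] at h
  linear_combination h

/-- The leading-order cumulants `p_l` of the Wigner delay time (β = 2), defined by
`p_1 = 1` and the quadratic recurrence
`(l+1)p_{l+1} = 2(2l−1)p_l + 2∑_{i=0}^{l−1}(3i+1)(l−i)p_{i+1}p_{l−i}`,
are integers. -/
theorem wigner_leading_cumulants_are_integers
    (p : ℕ → ℚ) (h1 : p 1 = 1)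
    (hrec : ∀ l : ℕ, 1 ≤ l →
      ((l : ℚ) + 1) * p (l + 1)
        = 2 * (2 * (l : ℚ) - 1) * p l
          + 2 * ∑ i ∈ Finset.range l,
              (3 * (i : ℚ) + 1) * ((l : ℚ) - (i : ℚ)) * p (i + 1) * p (l - i)) :
    ∀ l : ℕ, 1 ≤ l → ∃ m : ℤ, p l = m := by
  obtain ⟨c, hc1, hc⟩ := exists_integral_solution_recurrence
  suffices h : ∀ l : ℕ, 1 ≤ l → p l = c l from fun l hl => ⟨c l, h l hl⟩
  intro l
  induction l using Nat.strong_induction_on with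
  | _ l ih =>
    intro hl
    obtain _ | _ | l := l
    · omega
    · rw [h1, hc1, Int.cast_one]
    · have hr := hrec (l + 1) (Nat.le_add_left 1 l)
      have hcl := congrArg (Int.cast : ℤ → ℚ) (hc (l + 1) (Nat.le_add_left 1 l))
      rw [ih (l + 1) (Nat.lt_succ_self _) (Nat.le_add_left 1 l), sum_congr rfl fun i hi => by
        have hi' := mem_range.1 hi
        rw [ih (i + 1) (by omega) (by omega), ih (l + 1 - i) (by omega) (by omega)]] at hr
      have hne : ((l + 1 : ℕ) : ℚ) + 1 ≠ 0 := by positivity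
      refine mul_left_cancel₀ hne ?_
      rw [hr]
      push_cast at hcl ⊢
      exact hcl.symm
end

section
/- Let k, i, p be integers with k ≥ 1, 0 ≤ i ≤ k−1 and 0 ≤ p ≤ i. Then k divides the product C(2k, p) · C(2k, i−p) · C(2k−i−2, k−1) of binomial coefficients. -/
theorem Nat.dvd_mul_choose (n p : ℕ) : n ∣ p * n.choose p := by
  cases p with
  | zero => simp
  | succ p =>
    cases n with
    | zero => simp
    | succ n => exact ⟨n.choose p, by rw [Nat.add_one_mul_choose_eq, mul_comm]⟩

theorem Nat.dvd_choose_add_of_dvd_add_one {d m n : ℕ} (hm : d ∣ m + 1) (hn : d ∣ n + 1) :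
    d ∣ (m + n).choose m := by
  have hcop : Nat.Coprime d (m + n + 1) := by
    have hsum : d ∣ m + n + 1 + 1 := by
      simpa [add_assoc, add_comm, add_left_comm] using dvd_add hm hn
    exact Nat.Coprime.coprime_dvd_left hsum (by simp)
  refine hcop.dvd_of_dvd_mul_left ?_
  rw [Nat.add_one_mul_choose_eq]
  exact hm.mul_left _

/-- For `k ≥ 1`, `0 ≤ i ≤ k−1` and `0 ≤ p ≤ i`, the product
`C(2k,p)·C(2k,i−p)·C(2k−i−2,k−1)` of binomial coefficients is divisible by `k`. -/
theorem k_dvd_binomial_product (k i p : ℕ) (hk : 1 ≤ k) (hi : i ≤ k - 1) (hp : p ≤ i) :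
    k ∣ Nat.choose (2 * k) p * Nat.choose (2 * k) (i - p) *
      Nat.choose (2 * k - i - 2) (k - 1) := by
  obtain ⟨q, rfl⟩ := Nat.exists_eq_add_of_le hp
  rw [Nat.add_sub_cancel_left]
  set A := (2 * k).choose p
  set B := (2 * k).choose q
  have hA : k ∣ p * A := (Dvd.intro_left 2 rfl).trans (Nat.dvd_mul_choose (2 * k) p)
  have hB : k ∣ q * B := (Dvd.intro_left 2 rfl).trans (Nat.dvd_mul_choose (2 * k) q)
  set d := k.gcd (p.gcd q)
  have hAB : k ∣ A * B * d := by
    have hpq : k ∣ A * B * p.gcd q := by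
      rw [← Nat.gcd_mul_left]
      refine Nat.dvd_gcd ?_ ?_
      · exact (hA.mul_right B).trans (dvd_of_eq (by ring))
      · exact (hB.mul_left A).trans (dvd_of_eq (by ring))
    rw [← Nat.gcd_mul_left]
    exact Nat.dvd_gcd (Dvd.intro_left _ rfl) hpq
  have hdk : d ∣ k := Nat.gcd_dvd_left _ _
  have hdp : d ∣ p := (Nat.gcd_dvd_right _ _).trans (Nat.gcd_dvd_left _ _)
  have hdq : d ∣ q := (Nat.gcd_dvd_right _ _).trans (Nat.gcd_dvd_right _ _)
  have hd : d ∣ (2 * k - (p + q) - 2).choose (k - 1) := by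
    rw [show 2 * k - (p + q) - 2 = (k - 1) + (k - (p + q) - 1) by omega]
    refine Nat.dvd_choose_add_of_dvd_add_one ?_ ?_
    · rwa [Nat.sub_add_cancel hk]
    · rw [Nat.sub_add_cancel (by omega)]
      exact Nat.dvd_sub hdk (dvd_add hdp hdq)
  exact hAB.trans (mul_dvd_mul_left _ hd)
end

section
/- For every integer k ≥ 1, the rational number ζ_k := (4/k) · ∑_{i=0}^{k−1} C(2k−i−2, k−1) · (∑_{p=0}^{i} C(2k, p) · C(2k, i−p) · 2^{i+p}) · (−3)^{k−1−i} is an integer; equivalently, k divides 4 · ∑_{i=0}^{k−1} C(2k−i−2, k−1) · (∑_{p=0}^{i} C(2k, p) · C(2k, i−p) · 2^{i+p}) · (−3)^{k−1−i}. -/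
open Finset

/-- The coefficients `ζ_k` obtained by Lagrange inversion of
`z(Ω) = (1/4)(3Ω+1)(Ω−1)/(Ω²(Ω+1)²)` around `Ω = 1`. -/
noncomputable def zetaCoef (k : ℕ) : ℚ :=
  (4 / (k : ℚ)) *
    ∑ i ∈ Finset.range k,
      (Nat.choose (2 * k - i - 2) (k - 1) : ℚ) *
        (∑ p ∈ Finset.range (i + 1),
          (Nat.choose (2 * k) p : ℚ) * (Nat.choose (2 * k) (i - p) : ℚ) * 2 ^ (i + p)) *
        (-3 : ℚ) ^ (k - 1 - i)

open PowerSeries in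
/-- The degree `n` coefficient of an `(n + 1)`-st power of an integral power series is divisible
by `n + 1`. -/
theorem succ_dvd_coeff_pow_succ (F : ℤ⟦X⟧) (n : ℕ) :
    ((n + 1 : ℕ) : ℤ) ∣ coeff n (F ^ (n + 1)) := by
  cases n with
  | zero => simp
  | succ n =>
    have h : coeff (n + 1) (F ^ (n + 1 + 1)) * ((n + 1 : ℕ) : ℤ) =
        ((n + 1 + 1 : ℕ) : ℤ) * coeff n (F ^ (n + 1) * d⁄dX ℤ F) := by
      have hc := coeff_derivative (F ^ (n + 1 + 1)) n
      rw [derivative_pow, Nat.add_sub_cancel, mul_assoc, ← map_natCast (C (R := ℤ)),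
        coeff_C_mul] at hc
      rw [hc]
      push_cast
      ring
    have hcop : IsCoprime ((n + 1 + 1 : ℕ) : ℤ) ((n + 1 : ℕ) : ℤ) :=
      Nat.isCoprime_iff_coprime.mpr (by simp)
    exact hcop.dvd_of_dvd_mul_right (h ▸ dvd_mul_right _ _)

open PowerSeries in
theorem coeff_rescale_one_add_X_pow {R : Type*} [CommRing R] (a : R) (N n : ℕ) :
    coeff n (rescale a (1 + X) ^ N) = N.choose n * a ^ n := by
  rw [← map_pow, coeff_rescale, ← binomialSeries_nat (R := ℤ), binomialSeries_coeff,
    Ring.choose_natCast]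
  simp [mul_comm]

open PowerSeries in
theorem coeff_rescale_mk_one_pow_succ {R : Type*} [CommRing R] (a : R) (d n : ℕ) :
    coeff n (rescale a (mk 1) ^ (d + 1)) = (d + n).choose d * a ^ n := by
  rw [← map_pow, coeff_rescale, mk_one_pow_eq_mk_choose_add, coeff_mk, mul_comm]

open PowerSeries in
/-- Divisibility by `n + 1` of the Lagrange coefficient of
`((1 + 4 X) ^ 2 * (1 + 2 X) ^ 2 / (1 + 3 X)) ^ (n + 1)`. -/
theorem succ_dvd_lagrange_sum (n : ℕ) :
    ((n + 1 : ℕ) : ℤ) ∣ ∑ i ∈ Finset.range (n + 1),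
      (Nat.choose (2 * (n + 1) - i - 2) n : ℤ) *
        (∑ p ∈ Finset.range (i + 1),
          (Nat.choose (2 * (n + 1)) p : ℤ) * (Nat.choose (2 * (n + 1)) (i - p) : ℤ) *
            2 ^ (i + p)) *
        (-3 : ℤ) ^ (n - i) := by
  convert succ_dvd_coeff_pow_succ
    (rescale 4 (1 + X) ^ 2 * rescale 2 (1 + X) ^ 2 * rescale (-3) (mk 1)) n using 1
  simp only [mul_pow, ← pow_mul]
  rw [coeff_mul, Finset.Nat.sum_antidiagonal_eq_sum_range_succ_mk]
  refine Finset.sum_congr rfl fun i hi => ?_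
  have hin : i ≤ n := Nat.lt_succ_iff.mp (Finset.mem_range.mp hi)
  rw [coeff_rescale_mk_one_pow_succ, coeff_mul,
    Finset.Nat.sum_antidiagonal_eq_sum_range_succ_mk,
    show 2 * (n + 1) - i - 2 = n + (n - i) by lia, mul_comm (Nat.cast _), mul_assoc]
  congr 1
  refine Finset.sum_congr rfl fun p hp => ?_
  have hpi : p ≤ i := Nat.lt_succ_iff.mp (Finset.mem_range.mp hp)
  rw [coeff_rescale_one_add_X_pow, coeff_rescale_one_add_X_pow,
    show i + p = 2 * p + (i - p) by lia, pow_add, pow_mul]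
  norm_num
  ring

/-- For every `k ≥ 1`, `ζ_k` is an integer; equivalently `k` divides
`4·∑_{i=0}^{k−1} C(2k−i−2,k−1)(∑_{p=0}^{i} C(2k,p)C(2k,i−p)2^{i+p})(−3)^{k−1−i}`. -/
theorem zetaCoef_is_integer (k : ℕ) (hk : 1 ≤ k) :
    (∃ m : ℤ, zetaCoef k = m) ∧
    (k : ℤ) ∣ 4 * ∑ i ∈ Finset.range k,
      (Nat.choose (2 * k - i - 2) (k - 1) : ℤ) *
        (∑ p ∈ Finset.range (i + 1),
          (Nat.choose (2 * k) p : ℤ) * (Nat.choose (2 * k) (i - p) : ℤ) * 2 ^ (i + p)) *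
        (-3 : ℤ) ^ (k - 1 - i) := by
  obtain ⟨n, rfl⟩ := Nat.exists_eq_add_of_le' hk
  rw [Nat.add_sub_cancel]
  have h := succ_dvd_lagrange_sum n
  refine ⟨?_, h.mul_left 4⟩
  obtain ⟨c, hc⟩ := h
  refine ⟨4 * c, ?_⟩
  have hq := congrArg (Int.cast : ℤ → ℚ) hc
  push_cast at hq
  have hn : (n : ℚ) + 1 ≠ 0 := by positivity
  rw [zetaCoef, Nat.add_sub_cancel]
  push_cast
  rw [hq]
  field_simp
end

section
/- Let β > 0, α > −1, δ > −2 and n ≥ 1 an integer. Then the mean of the conductance satisfies (1/c_n^{(β)}) · ∫_{[0,1]^n} (∑_{j=1}^n T_j) · ∏_{j=1}^n T_j^α (1−T_j)^{δ/2} · ∏_{1≤j<k≤n} |T_k−T_j|^β dT_1⋯dT_n = n·(α + 1 + β(n−1)/2) / (α + δ/2 + 2 + β(n−1)). -/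
open MeasureTheory Filter Finset

/-- The Jacobi-ensemble weight `∏_j T_j^α (1-T_j)^{δ/2} ∏_{j<k} |T_k-T_j|^β`. -/
noncomputable def jacW (β α δ : ℝ) (n : ℕ) (T : Fin n → ℝ) : ℝ :=
  (∏ j, T j ^ α * (1 - T j) ^ (δ / 2)) * vand β T

/-- Selberg's integral `c_n^{(β)}`. -/
noncomputable def cSel (β α δ : ℝ) (n : ℕ) : ℝ :=
  ∫ T in Set.Icc (0 : Fin n → ℝ) 1, jacW β α δ n T

/-- The Möbius transformation of the line fixing `0` and `1` with multiplier `s` at `0`. -/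
noncomputable def mobius (s x : ℝ) : ℝ := s * x / (1 + (s - 1) * x)

theorem one_add_sub_one_mul_pos {s x : ℝ} (hs : 0 < s) (hx : x ∈ Set.Icc (0 : ℝ) 1) :
    0 < 1 + (s - 1) * x := by
  obtain ⟨h0, h1⟩ := hx
  rcases h0.eq_or_lt with rfl | h0
  · simp
  · nlinarith [mul_pos hs h0]

theorem one_sub_mobius {s x : ℝ} (hs : 0 < s) (hx : x ∈ Set.Icc (0 : ℝ) 1) :
    1 - mobius s x = (1 - x) / (1 + (s - 1) * x) := by
  have := (one_add_sub_one_mul_pos hs hx).ne'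
  rw [mobius, one_sub_div this]
  ring

theorem mobius_sub_mobius {s x y : ℝ} (hs : 0 < s) (hx : x ∈ Set.Icc (0 : ℝ) 1)
    (hy : y ∈ Set.Icc (0 : ℝ) 1) :
    mobius s x - mobius s y = s * (x - y) / ((1 + (s - 1) * x) * (1 + (s - 1) * y)) := by
  rw [mobius, mobius, div_sub_div _ _ (one_add_sub_one_mul_pos hs hx).ne'
    (one_add_sub_one_mul_pos hs hy).ne']
  ring

theorem mobius_mem_Icc {s x : ℝ} (hs : 0 < s) (hx : x ∈ Set.Icc (0 : ℝ) 1) :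
    mobius s x ∈ Set.Icc (0 : ℝ) 1 := by
  have hd := one_add_sub_one_mul_pos hs hx
  refine ⟨div_nonneg (mul_nonneg hs.le hx.1) hd.le, ?_⟩
  rw [← sub_nonneg, one_sub_mobius hs hx]
  exact div_nonneg (sub_nonneg.2 hx.2) hd.le

theorem mobius_inv_mobius {s x : ℝ} (hs : 0 < s) (hx : x ∈ Set.Icc (0 : ℝ) 1) :
    mobius s⁻¹ (mobius s x) = x := by
  have hd := (one_add_sub_one_mul_pos hs hx).ne'
  have hs' := hs.ne'
  have h : 1 + (s⁻¹ - 1) * mobius s x = 1 / (1 + (s - 1) * x) := by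
    rw [eq_div_iff hd, mobius, add_mul, mul_assoc, div_mul_cancel₀ _ hd]
    field_simp
    ring
  rw [mobius, h, mobius]
  generalize 1 + (s - 1) * x = d at hd
  field_simp

theorem hasDerivAt_mobius {s x : ℝ} (hs : 0 < s) (hx : x ∈ Set.Icc (0 : ℝ) 1) :
    HasDerivAt (mobius s) (s / (1 + (s - 1) * x) ^ 2) x := by
  have hd := (one_add_sub_one_mul_pos hs hx).ne'
  have h1 : HasDerivAt (fun y : ℝ => s * y) s x := by
    simpa using (hasDerivAt_id x).const_mul s
  have h2 : HasDerivAt (fun y : ℝ => 1 + (s - 1) * y) (s - 1) x := by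
    simpa using ((hasDerivAt_id x).const_mul (s - 1)).const_add 1
  convert! h1.div h2 hd using 1
  field_simp
  ring

theorem mem_Icc_zero_one_apply {n : ℕ} {T : Fin n → ℝ} (hT : T ∈ Set.Icc (0 : Fin n → ℝ) 1)
    (j : Fin n) : T j ∈ Set.Icc (0 : ℝ) 1 :=
  ⟨hT.1 j, hT.2 j⟩

theorem image_mobius_Icc {s : ℝ} (hs : 0 < s) (n : ℕ) :
    (fun (T : Fin n → ℝ) j => mobius s (T j)) '' Set.Icc 0 1 = Set.Icc 0 1 := by
  ext T
  constructor
  · rintro ⟨U, hU, rfl⟩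
    exact ⟨fun j => (mobius_mem_Icc hs (mem_Icc_zero_one_apply hU j)).1,
      fun j => (mobius_mem_Icc hs (mem_Icc_zero_one_apply hU j)).2⟩
  · intro hT
    have hs' := inv_pos.2 hs
    refine ⟨fun j => mobius s⁻¹ (T j),
      ⟨fun j => (mobius_mem_Icc hs' (mem_Icc_zero_one_apply hT j)).1,
        fun j => (mobius_mem_Icc hs' (mem_Icc_zero_one_apply hT j)).2⟩, ?_⟩
    funext j
    simpa using mobius_inv_mobius hs' (mem_Icc_zero_one_apply hT j)

theorem injOn_mobius_Icc {s : ℝ} (hs : 0 < s) (n : ℕ) :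
    Set.InjOn (fun (T : Fin n → ℝ) j => mobius s (T j)) (Set.Icc 0 1) := by
  intro T hT U hU h
  funext j
  rw [← mobius_inv_mobius hs (mem_Icc_zero_one_apply hT j),
    ← mobius_inv_mobius hs (mem_Icc_zero_one_apply hU j)]
  exact congrArg _ (congrFun h j)

theorem setIntegral_comp_mobius {s : ℝ} (hs : 0 < s) {n : ℕ} (f : (Fin n → ℝ) → ℝ) :
    ∫ T in Set.Icc (0 : Fin n → ℝ) 1, f T =
      ∫ T in Set.Icc (0 : Fin n → ℝ) 1,
        (∏ j, s / (1 + (s - 1) * T j) ^ 2) * f (fun j => mobius s (T j)) := by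
  have h := integral_image_eq_integral_abs_det_fderiv_smul (volume : Measure (Fin n → ℝ))
    (s := Set.Icc 0 1) (f := fun T j => mobius s (T j))
    (f' := fun T => ContinuousLinearMap.pi fun j =>
      (ContinuousLinearMap.toSpanSingleton ℝ (s / (1 + (s - 1) * T j) ^ 2)).comp
        (ContinuousLinearMap.proj j))
    measurableSet_Icc
    (fun T hT => ((hasFDerivAt_pi (φ := fun j (T : Fin n → ℝ) => mobius s (T j))).2 fun j =>
      HasFDerivAt.comp (g := mobius s) T
        (hasDerivAt_mobius hs (mem_Icc_zero_one_apply hT j)).hasFDerivAt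
        (ContinuousLinearMap.proj (R := ℝ) (φ := fun _ : Fin n => ℝ) j).hasFDerivAt
      ).hasFDerivWithinAt)
    (injOn_mobius_Icc hs n) f
  rw [image_mobius_Icc hs] at h
  rw [h]
  refine setIntegral_congr_fun measurableSet_Icc fun T _ => ?_
  simp only [ContinuousLinearMap.det_pi, smul_eq_mul]
  congr 1
  rw [abs_of_nonneg]
  · refine Finset.prod_congr rfl fun j _ => ?_
    simp [ContinuousLinearMap.det]
  · refine Finset.prod_nonneg fun j _ => ?_
    simp only [ContinuousLinearMap.det, LinearMap.det_ring]
    simp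
    positivity

theorem prod_prod_Ioi_mul {M : Type*} [CommMonoid M] {n : ℕ} (f : Fin n → M) :
    ∏ j, ∏ k ∈ Finset.Ioi j, f j * f k = ∏ j, f j ^ (n - 1) := by
  simp_rw [Finset.prod_mul_distrib]
  have h : ∏ j, ∏ k ∈ Finset.Ioi j, f k = ∏ k, ∏ _j ∈ Finset.Iio k, f k :=
    Finset.prod_comm' (by simp)
  rw [h, ← Finset.prod_mul_distrib]
  refine Finset.prod_congr rfl fun j _ => ?_
  simp only [Finset.prod_const]
  rw [← pow_add, Fin.card_Ioi, Fin.card_Iio]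
  congr 1
  omega

theorem abs_mobius_sub_mobius_rpow {s x y : ℝ} (β : ℝ) (hs : 0 < s)
    (hx : x ∈ Set.Icc (0 : ℝ) 1) (hy : y ∈ Set.Icc (0 : ℝ) 1) :
    |mobius s y - mobius s x| ^ β =
      (s ^ (β / 2) * (1 + (s - 1) * x) ^ (-β)) * (s ^ (β / 2) * (1 + (s - 1) * y) ^ (-β)) *
        |y - x| ^ β := by
  have hdx := one_add_sub_one_mul_pos hs hx
  have hdy := one_add_sub_one_mul_pos hs hy
  have hsβ : s ^ β = s ^ (β / 2) * s ^ (β / 2) := by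
    rw [← Real.rpow_add hs, add_halves]
  rw [mobius_sub_mobius hs hy hx, abs_div, abs_mul, abs_of_pos hs, abs_of_pos (mul_pos hdy hdx),
    Real.div_rpow (by positivity) (by positivity), Real.mul_rpow hs.le (abs_nonneg _),
    Real.mul_rpow hdy.le hdx.le, Real.rpow_neg hdx.le, Real.rpow_neg hdy.le, hsβ]
  field_simp

theorem vand_mobius {s : ℝ} (β : ℝ) (hs : 0 < s) {n : ℕ} {T : Fin n → ℝ}
    (hT : T ∈ Set.Icc (0 : Fin n → ℝ) 1) :
    vand β (fun j => mobius s (T j)) =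
      (∏ j, (s ^ (β / 2) * (1 + (s - 1) * T j) ^ (-β)) ^ (n - 1)) * vand β T := by
  rw [← prod_prod_Ioi_mul, vand, vand, ← Finset.prod_mul_distrib]
  refine Finset.prod_congr rfl fun j _ => ?_
  rw [← Finset.prod_mul_distrib]
  exact Finset.prod_congr rfl fun k _ => abs_mobius_sub_mobius_rpow β hs
    (mem_Icc_zero_one_apply hT j) (mem_Icc_zero_one_apply hT k)

theorem mobius_weight {s x : ℝ} (β α γ : ℝ) {n : ℕ} (hn : 1 ≤ n) (hs : 0 < s)
    (hx : x ∈ Set.Icc (0 : ℝ) 1) :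
    s / (1 + (s - 1) * x) ^ 2 * (mobius s x ^ α * (1 - mobius s x) ^ γ) *
        (s ^ (β / 2) * (1 + (s - 1) * x) ^ (-β)) ^ (n - 1) =
      Real.exp ((α + 1 + β * (n - 1) / 2) * Real.log s -
        (α + γ + 2 + β * (n - 1)) * Real.log (1 + (s - 1) * x)) * (x ^ α * (1 - x) ^ γ) := by
  have hd := one_add_sub_one_mul_pos hs hx
  rw [one_sub_mobius hs hx, mobius, Real.div_rpow (mul_nonneg hs.le hx.1) hd.le,
    Real.mul_rpow hs.le hx.1, Real.div_rpow (sub_nonneg.2 hx.2) hd.le]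
  generalize 1 + (s - 1) * x = d at hd
  generalize x ^ α = u
  generalize (1 - x) ^ γ = v
  have key : Real.exp ((α + 1 + β * (n - 1) / 2) * Real.log s -
      (α + γ + 2 + β * (n - 1)) * Real.log d) =
      s / d ^ 2 * (s ^ α / d ^ α / d ^ γ) * (s ^ (β / 2) * d ^ (-β)) ^ (n - 1) := by
    nth_rewrite 2 [← Real.exp_log hs]
    nth_rewrite 2 [← Real.exp_log hd]
    simp only [Real.rpow_def_of_pos hs, Real.rpow_def_of_pos hd, ← Real.exp_add, ← Real.exp_sub,
      ← Real.exp_nat_mul]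
    congr 1
    push_cast [Nat.cast_sub hn]
    ring
  rw [key]
  field_simp

/-- The factor by which the Jacobi weight, together with the Jacobian, is multiplied under the
Möbius substitution. -/
noncomputable def mobiusFactor (a b : ℝ) {n : ℕ} (s : ℝ) (T : Fin n → ℝ) : ℝ :=
  Real.exp (∑ j, (a * Real.log s - b * Real.log (1 + (s - 1) * T j)))

theorem jacW_mobius (β α δ : ℝ) {n : ℕ} (hn : 1 ≤ n) {s : ℝ} (hs : 0 < s) {T : Fin n → ℝ}
    (hT : T ∈ Set.Icc (0 : Fin n → ℝ) 1) :
    (∏ j, s / (1 + (s - 1) * T j) ^ 2) * jacW β α δ n (fun j => mobius s (T j)) =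
      mobiusFactor (α + 1 + β * (n - 1) / 2) (α + δ / 2 + 2 + β * (n - 1)) s T *
        jacW β α δ n T := by
  rw [jacW, jacW, vand_mobius β hs hT, mobiusFactor, Real.exp_sum, ← mul_assoc, ← mul_assoc,
    ← mul_assoc, ← Finset.prod_mul_distrib, ← Finset.prod_mul_distrib, ← Finset.prod_mul_distrib]
  congr 1
  exact Finset.prod_congr rfl fun j _ =>
    mobius_weight β α (δ / 2) hn hs (mem_Icc_zero_one_apply hT j)

theorem setIntegral_mobiusFactor_mul_jacW (β α δ : ℝ) {n : ℕ} (hn : 1 ≤ n) {s : ℝ} (hs : 0 < s) :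
    ∫ T in Set.Icc (0 : Fin n → ℝ) 1,
      mobiusFactor (α + 1 + β * (n - 1) / 2) (α + δ / 2 + 2 + β * (n - 1)) s T *
        jacW β α δ n T = cSel β α δ n := by
  rw [cSel, setIntegral_comp_mobius hs (jacW β α δ n)]
  exact setIntegral_congr_fun measurableSet_Icc fun T hT => (jacW_mobius β α δ hn hs hT).symm

/-- The derivative of `mobiusFactor a b s T` in `s`. -/
noncomputable def mobiusFactorDeriv (a b : ℝ) {n : ℕ} (s : ℝ) (T : Fin n → ℝ) : ℝ :=
  mobiusFactor a b s T * ∑ j, (a / s - b * (T j / (1 + (s - 1) * T j)))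

theorem hasDerivAt_mobiusFactor (a b : ℝ) {n : ℕ} {s : ℝ} (hs : 0 < s) {T : Fin n → ℝ}
    (hT : T ∈ Set.Icc (0 : Fin n → ℝ) 1) :
    HasDerivAt (fun r => mobiusFactor a b r T) (mobiusFactorDeriv a b s T) s := by
  refine HasDerivAt.exp (HasDerivAt.fun_sum fun j _ => ?_)
  have hd := one_add_sub_one_mul_pos hs (mem_Icc_zero_one_apply hT j)
  have h : HasDerivAt (fun r : ℝ => 1 + (r - 1) * T j) (T j) s := by
    simpa using (((hasDerivAt_id s).sub_const 1).mul_const (T j)).const_add 1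
  convert! ((Real.hasDerivAt_log hs.ne').const_mul a).sub ((h.log hd.ne').const_mul b) using 1

theorem continuousOn_mobiusFactor (a b : ℝ) (n : ℕ) :
    ContinuousOn (fun p : ℝ × (Fin n → ℝ) => mobiusFactor a b p.1 p.2)
      (Set.Ioi 0 ×ˢ Set.Icc 0 1) := by
  refine Real.continuous_exp.comp_continuousOn (continuousOn_finsetSum _ fun j _ => ?_)
  refine (continuousOn_const.mul (continuousOn_fst.log fun p hp => (ne_of_gt hp.1))).sub
    (continuousOn_const.mul (ContinuousOn.log (by fun_prop) fun p hp => ?_))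
  exact (one_add_sub_one_mul_pos hp.1 (mem_Icc_zero_one_apply hp.2 j)).ne'

theorem continuousOn_mobiusFactorDeriv (a b : ℝ) (n : ℕ) :
    ContinuousOn (fun p : ℝ × (Fin n → ℝ) => mobiusFactorDeriv a b p.1 p.2)
      (Set.Ioi 0 ×ˢ Set.Icc 0 1) := by
  refine (continuousOn_mobiusFactor a b n).mul (continuousOn_finsetSum _ fun j _ => ?_)
  refine (continuousOn_const.div continuousOn_fst fun p hp => (ne_of_gt hp.1)).sub
    (continuousOn_const.mul (ContinuousOn.div (by fun_prop) (by fun_prop) fun p hp => ?_))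
  exact (one_add_sub_one_mul_pos hp.1 (mem_Icc_zero_one_apply hp.2 j)).ne'

theorem integrableOn_rpow_mul_one_sub_rpow {α γ : ℝ} (hα : -1 < α) (hγ : -1 < γ) :
    IntegrableOn (fun x : ℝ => x ^ α * (1 - x) ^ γ) (Set.Icc 0 1) := by
  have h := (Complex.betaIntegral_convergent (u := (α + 1 : ℝ)) (v := (γ + 1 : ℝ))
    (by simp; linarith) (by simp; linarith)).norm
  rw [intervalIntegrable_iff_integrableOn_Ioo_of_le zero_le_one] at h
  rw [integrableOn_Icc_iff_integrableOn_Ioo]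
  refine h.congr_fun (fun x hx => ?_) measurableSet_Ioo
  have h1 : (0 : ℝ) < 1 - x := sub_pos.2 hx.2
  have h2 : (1 - x : ℂ) = ((1 - x : ℝ) : ℂ) := by push_cast; rfl
  simp only [norm_mul]
  rw [h2, Complex.norm_cpow_eq_rpow_re_of_pos hx.1, Complex.norm_cpow_eq_rpow_re_of_pos h1]
  simp

theorem measurable_vand (β : ℝ) (n : ℕ) : Measurable (fun T : Fin n → ℝ => vand β T) := by
  unfold vand
  fun_prop

theorem vand_nonneg (β : ℝ) {n : ℕ} (T : Fin n → ℝ) : 0 ≤ vand β T :=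
  Finset.prod_nonneg fun _ _ => Finset.prod_nonneg fun _ _ => by positivity

theorem vand_le_one {β : ℝ} (hβ : 0 ≤ β) {n : ℕ} {T : Fin n → ℝ}
    (hT : T ∈ Set.Icc (0 : Fin n → ℝ) 1) : vand β T ≤ 1 := by
  refine Finset.prod_le_one (fun _ _ => Finset.prod_nonneg fun _ _ => by positivity) fun j _ =>
    Finset.prod_le_one (fun _ _ => by positivity) fun k _ =>
      Real.rpow_le_one (abs_nonneg _) ?_ hβ
  have hj := mem_Icc_zero_one_apply hT j
  have hk := mem_Icc_zero_one_apply hT k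
  exact abs_le.2 ⟨by linarith [hj.2, hk.1], by linarith [hj.1, hk.2]⟩

theorem integrableOn_jacW {β α δ : ℝ} (hβ : 0 ≤ β) (hα : -1 < α) (hδ : -2 < δ) (n : ℕ) :
    IntegrableOn (jacW β α δ n) (Set.Icc 0 1) := by
  have h : IntegrableOn (fun T : Fin n → ℝ => ∏ j, T j ^ α * (1 - T j) ^ (δ / 2))
      (Set.Icc 0 1) := by
    rw [IntegrableOn, ← Set.pi_univ_Icc, volume_pi, Measure.restrict_pi_pi]
    exact Integrable.fintype_prod (f := fun _ x => x ^ α * (1 - x) ^ (δ / 2)) fun _ =>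
      integrableOn_rpow_mul_one_sub_rpow hα (by linarith)
  refine Integrable.mul_bdd (c := 1) h (measurable_vand β n).aestronglyMeasurable ?_
  refine (ae_restrict_iff' measurableSet_Icc).2 (.of_forall fun T hT => ?_)
  rw [Real.norm_of_nonneg (vand_nonneg β T)]
  exact vand_le_one hβ hT

theorem jacW_nonneg (β α δ : ℝ) {n : ℕ} {T : Fin n → ℝ}
    (hT : T ∈ Set.Icc (0 : Fin n → ℝ) 1) : 0 ≤ jacW β α δ n T :=
  mul_nonneg (Finset.prod_nonneg fun j _ => mul_nonneg (Real.rpow_nonneg (hT.1 j) _)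
    (Real.rpow_nonneg (sub_nonneg.2 (hT.2 j)) _)) (vand_nonneg β T)

theorem jacW_pos (β α δ : ℝ) {n : ℕ} {T : Fin n → ℝ} (h0 : ∀ j, 0 < T j) (h1 : ∀ j, T j < 1)
    (hlt : ∀ j k, j < k → T j < T k) : 0 < jacW β α δ n T := by
  refine mul_pos (Finset.prod_pos fun j _ => mul_pos (Real.rpow_pos_of_pos (h0 j) _)
    (Real.rpow_pos_of_pos (sub_pos.2 (h1 j)) _)) (Finset.prod_pos fun j _ =>
      Finset.prod_pos fun k hk => Real.rpow_pos_of_pos (abs_pos.2 ?_) _)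
  exact (sub_pos.2 (hlt j k (Finset.mem_Ioi.1 hk))).ne'

theorem cSel_pos {β α δ : ℝ} (hβ : 0 ≤ β) (hα : -1 < α) (hδ : -2 < δ) (n : ℕ) :
    0 < cSel β α δ n := by
  rw [cSel, setIntegral_pos_iff_support_of_nonneg_ae
    ((ae_restrict_iff' measurableSet_Icc).2 (.of_forall fun T hT => jacW_nonneg β α δ hT))
    (integrableOn_jacW hβ hα hδ n)]
  let U : Set (Fin n → ℝ) :=
    {T | (∀ j, 0 < T j) ∧ (∀ j, T j < 1) ∧ ∀ j k, j < k → T j < T k}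
  have hU : IsOpen U := by
    simp only [U, Set.ofPred_and, Set.ofPred_forall]
    refine .inter (isOpen_iInter_of_finite fun j => ?_)
      (.inter (isOpen_iInter_of_finite fun j => ?_) (isOpen_iInter_of_finite fun j =>
        isOpen_iInter_of_finite fun k => isOpen_iInter_of_finite fun _ => ?_))
    · exact isOpen_lt continuous_const (continuous_apply j)
    · exact isOpen_lt (continuous_apply j) continuous_const
    · exact isOpen_lt (continuous_apply j) (continuous_apply k)
  have hne : U.Nonempty := by
    refine ⟨fun j => ((j : ℕ) + 1 : ℝ) / (n + 1), fun j => by positivity, fun j => ?_,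
      fun j k hjk => ?_⟩
    · rw [div_lt_one (by positivity)]
      have : ((j : ℕ) : ℝ) < n := by exact_mod_cast j.2
      linarith
    · have : ((j : ℕ) : ℝ) < ((k : ℕ) : ℝ) := by exact_mod_cast hjk
      exact div_lt_div_of_pos_right (by linarith) (by positivity)
  refine (hU.measure_pos volume hne).trans_le (measure_mono fun T hT => ?_)
  exact ⟨(jacW_pos β α δ hT.1 hT.2.1 hT.2.2).ne', fun j => (hT.1 j).le, fun j => (hT.2.1 j).le⟩

theorem setIntegral_mobiusFactorDeriv_one_mul_jacW {β α δ : ℝ} (hβ : 0 ≤ β) (hα : -1 < α)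
    (hδ : -2 < δ) {n : ℕ} (hn : 1 ≤ n) :
    ∫ T in Set.Icc (0 : Fin n → ℝ) 1,
      mobiusFactorDeriv (α + 1 + β * (n - 1) / 2) (α + δ / 2 + 2 + β * (n - 1)) 1 T *
        jacW β α δ n T = 0 := by
  have hconst := fun s (hs : 0 < s) => setIntegral_mobiusFactor_mul_jacW β α δ hn (s := s) hs
  generalize α + 1 + β * ((n : ℝ) - 1) / 2 = a at *
  generalize α + δ / 2 + 2 + β * ((n : ℝ) - 1) = b at *
  have hint := integrableOn_jacW hβ hα hδ n
  have hpos : Set.Icc (1 / 2 : ℝ) (3 / 2) ⊆ Set.Ioi 0 := fun s hs =>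
    lt_of_lt_of_le (by norm_num) hs.1
  have hnhds : Set.Icc (1 / 2 : ℝ) (3 / 2) ∈ nhds (1 : ℝ) :=
    Icc_mem_nhds (by norm_num) (by norm_num)
  obtain ⟨C, hC⟩ := ((isCompact_Icc (a := (1 / 2 : ℝ)) (b := 3 / 2)).prod
    (isCompact_Icc (a := (0 : Fin n → ℝ)) (b := 1))).exists_bound_of_continuousOn
    ((continuousOn_mobiusFactorDeriv a b n).mono (Set.prod_mono_left hpos))
  have hslice : ∀ s ∈ Set.Ioi (0 : ℝ), ContinuousOn (fun T : Fin n → ℝ => (s, T)) (Set.Icc 0 1) ∧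
      Set.MapsTo (fun T : Fin n → ℝ => (s, T)) (Set.Icc 0 1) (Set.Ioi 0 ×ˢ Set.Icc 0 1) :=
    fun s hs => ⟨by fun_prop, fun T hT => ⟨hs, hT⟩⟩
  have hderiv := (hasDerivAt_integral_of_dominated_loc_of_deriv_le
    (μ := volume.restrict (Set.Icc (0 : Fin n → ℝ) 1))
    (F := fun s T => mobiusFactor a b s T * jacW β α δ n T)
    (F' := fun s T => mobiusFactorDeriv a b s T * jacW β α δ n T)
    (bound := fun T => C * ‖jacW β α δ n T‖) hnhds
    (Filter.mem_of_superset hnhds fun s hs =>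
      (((continuousOn_mobiusFactor a b n).comp (hslice s (hpos hs)).1
        (hslice s (hpos hs)).2).aestronglyMeasurable measurableSet_Icc).mul
        hint.aestronglyMeasurable)
    (by simpa [mobiusFactor, IntegrableOn] using hint)
    ((((continuousOn_mobiusFactorDeriv a b n).comp (hslice 1 (Set.mem_Ioi.2 one_pos)).1
      (hslice 1 (Set.mem_Ioi.2 one_pos)).2).aestronglyMeasurable measurableSet_Icc).mul
      hint.aestronglyMeasurable)
    ((ae_restrict_iff' measurableSet_Icc).2 (.of_forall fun T hT s hs => by
      rw [norm_mul]
      exact mul_le_mul_of_nonneg_right (hC (s, T) ⟨hs, hT⟩) (norm_nonneg _)))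
    (hint.norm.const_mul C)
    ((ae_restrict_iff' measurableSet_Icc).2 (.of_forall fun T hT s hs =>
      (hasDerivAt_mobiusFactor a b (hpos hs) hT).mul_const _))).2
  exact hderiv.unique ((hasDerivAt_const (1 : ℝ) (cSel β α δ n)).congr_of_eventuallyEq
    (Filter.mem_of_superset hnhds fun s hs => hconst s (hpos hs)))

/-- The mean conductance `κ_1^{(β)} = E[∑_j T_j]` in the Jacobi β-ensemble. -/
theorem conductance_mean
    (β α δ : ℝ) (hβ : 0 < β) (hα : -1 < α) (hδ : -2 < δ) (n : ℕ) (hn : 1 ≤ n) :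
    (∫ T in Set.Icc (0 : Fin n → ℝ) 1, (∑ j, T j) * jacW β α δ n T) / cSel β α δ n
      = n * (α + 1 + β * (n - 1) / 2) / (α + δ / 2 + 2 + β * (n - 1)) := by
  have hint := integrableOn_jacW hβ.le hα hδ n
  have hsum : IntegrableOn (fun T : Fin n → ℝ => (∑ j, T j) * jacW β α δ n T) (Set.Icc 0 1) :=
    hint.continuousOn_mul (by fun_prop) isCompact_Icc
  have hzero := setIntegral_mobiusFactorDeriv_one_mul_jacW hβ.le hα hδ hn
  have hn' : (1 : ℝ) ≤ n := by exact_mod_cast hn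
  have hb : 0 < α + δ / 2 + 2 + β * (n - 1) := by
    have := mul_nonneg hβ.le (sub_nonneg.2 hn')
    linarith
  generalize α + 1 + β * ((n : ℝ) - 1) / 2 = a at *
  generalize α + δ / 2 + 2 + β * ((n : ℝ) - 1) = b at *
  have hfun : ∀ T : Fin n → ℝ, mobiusFactorDeriv a b 1 T * jacW β α δ n T =
      n * a * jacW β α δ n T - b * ((∑ j, T j) * jacW β α δ n T) := fun T => by
    simp [mobiusFactorDeriv, mobiusFactor, Finset.sum_sub_distrib, ← Finset.mul_sum]
    ring
  simp_rw [hfun] at hzero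
  rw [integral_sub (hint.const_mul _) (hsum.const_mul _), integral_const_mul,
    integral_const_mul] at hzero
  change n * a * cSel β α δ n - _ = 0 at hzero
  rw [div_eq_div_iff (cSel_pos hβ.le hα hδ n).ne' hb.ne']
  linarith
end
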